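/- The reachability problem for VASSB is decidable: there is an algorithm that, given a VASSB V and two semiconfigurations s1 and s2 of V, decides whether there is a run s1 →* s2 in V. -/

import Mathlib

/-!
Formalization of context-bounded liveness for dynamic networks of concurrent
pushdown systems (DCPS) and VASS with balloons (VASSB).
Global states, stack symbols, places, balloon states etc. are drawn from ℕ;
the finite components of the systems are recorded as `Finset`s.
-/

noncomputable section

namespace CBL

/-! ### VASS with balloons (VASSB) -/

/-- A vector in `ℕ^P` (finitely supported, places drawn from `ℕ`). -/
abbrev Vec : Type := ℕ →₀ ℕ

/-- A vector in `ℤ^P`. -/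
abbrev ZVec : Type := ℕ →₀ ℤ

/-- A balloon: a balloon state together with its contents, a vector over the
balloon places. -/
abbrev Balloon : Type := ℕ × Vec

/-- A representation of a semilinear subset of `ℕ^Φ`: a finite union of
linear sets, each given by a base vector and a list of period vectors. -/
abbrev SemilinRep : Type := List (Vec × List Vec)

/-- Membership in the semilinear set denoted by a representation. -/
def memSL (k : Vec) (L : SemilinRep) : Prop :=
  ∃ bp ∈ L, ∃ cs : List ℕ, cs.length = bp.2.length ∧
    k = bp.1 + (List.zipWith (fun (c : ℕ) (v : Vec) => c • v) cs bp.2).sum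

/-- Operations labelling the edges of a VASSB. -/
inductive VOp : Type where
  | delta : ZVec → VOp
  | inflate : ℕ → SemilinRep → VOp
  | deflate : ℕ → ℕ → ℕ → ℕ → VOp
  | burst : ℕ → VOp

/-- An edge of a VASSB: source state, operation, target state. -/
abbrev VEdge : Type := ℕ × VOp × ℕ

/-- A VASS with balloons `(Q, P, Ω, Φ, E)`. -/
structure VASSB where
  states : Finset ℕ
  places : Finset ℕ
  bstates : Finset ℕ
  bplaces : Finset ℕ
  edges : Finset VEdge

/-- A configuration `(q, m, n)` of a VASSB. -/
structure VConfig where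
  q : ℕ
  m : Vec
  bag : Multiset Balloon

/-- The effect of an operation on the places and the multiset of balloons. -/
def OpRel : VOp → Vec → Multiset Balloon → Vec → Multiset Balloon → Prop
  | .delta d, m, n, m', n' =>
      (∀ p, (m' p : ℤ) = (m p : ℤ) + d p) ∧ n' = n
  | .inflate s L, m, n, m', n' =>
      m' = m ∧ ∃ k : Vec, memSL k L ∧ n' = n + {(s, k)}
  | .deflate s s' pl p, m, n, m', n' =>
      ∃ (k : Vec) (n0 : Multiset Balloon),
        n = n0 + {(s, k)} ∧ m' = m + Finsupp.single p (k pl) ∧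
        n' = n0 + {(s', Finsupp.erase pl k)}
  | .burst s, m, n, m', n' =>
      m' = m ∧ ∃ (k : Vec) (n0 : Multiset Balloon), n = n0 + {(s, k)} ∧ n' = n0

/-- The step relation induced by the edge `e`. -/
def EdgeRel (e : VEdge) (c c' : VConfig) : Prop :=
  c.q = e.1 ∧ c'.q = e.2.2 ∧ OpRel e.2.1 c.m c.bag c'.m c'.bag

/-- One step of the VASSB `V`. -/
def VStep (V : VASSB) (c c' : VConfig) : Prop :=
  ∃ e ∈ V.edges, EdgeRel e c c'

/-- Reachability in a VASSB. -/
def VReach (V : VASSB) : VConfig → VConfig → Prop :=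
  Relation.ReflTransGen (VStep V)

/-- Semiconfigurations: configurations with no balloons. -/
def IsSemi (c : VConfig) : Prop := c.bag = 0

/-- An infinite run of the VASSB `V` from `c0`, given by its sequence of
configurations and the sequence of edges taken. -/
def IsInfRunV (V : VASSB) (c0 : VConfig) (rho : ℕ → VConfig) (es : ℕ → VEdge) : Prop :=
  rho 0 = c0 ∧ ∀ i, es i ∈ V.edges ∧ EdgeRel (es i) (rho i) (rho (i + 1))

/-- A finite run of length `n` of the VASSB `V` (the first `n` steps). -/
def IsFinRunV (V : VASSB) (n : ℕ) (rho : ℕ → VConfig) (es : ℕ → VEdge) : Prop :=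
  ∀ i < n, es i ∈ V.edges ∧ EdgeRel (es i) (rho i) (rho (i + 1))

/-- The step from `c` to `c'` via the edge `e` applies a deflate or a burst
operation to (an instance of) the balloon `b`. -/
def Touches (e : VEdge) (c c' : VConfig) (b : Balloon) : Prop :=
  (∃ (s' pl p : ℕ), e.2.1 = VOp.deflate b.1 s' pl p ∧
     ∃ n0, c.bag = n0 + {b} ∧ c'.bag = n0 + {(s', Finsupp.erase pl b.2)}) ∨
  (e.2.1 = VOp.burst b.1 ∧ ∃ n0, c.bag = n0 + {b} ∧ c'.bag = n0)

/-- A progressive infinite run: every balloon present in some configuration is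
deflated or burst at some later point, and every place carrying a token is
decremented by some later edge. -/
def ProgressiveV (V : VASSB) (c0 : VConfig) (rho : ℕ → VConfig) (es : ℕ → VEdge) : Prop :=
  IsInfRunV V c0 rho es ∧
  (∀ k, ∀ b ∈ (rho k).bag, ∃ j ≥ k, Touches (es j) (rho j) (rho (j + 1)) b) ∧
  (∀ k p, (rho k).m p ≠ 0 → ∃ j ≥ k, ∃ d : ZVec, (es j).2.1 = VOp.delta d ∧ d p < 0)

/-- `V` has an infinite progressive run from `c0`. -/
def HasProgRunV (V : VASSB) (c0 : VConfig) : Prop :=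
  ∃ rho es, ProgressiveV V c0 rho es

/-- A run of a VASSB is shallow if there is a bound `B` such that every
balloon inflated along the run contains at most `B` tokens. -/
def ShallowVRun (rho : ℕ → VConfig) (es : ℕ → VEdge) : Prop :=
  ∃ B, ∀ (i : ℕ) (s : ℕ) (L : SemilinRep) (k : Vec),
    (es i).2.1 = VOp.inflate s L →
    (rho (i + 1)).bag = (rho i).bag + {(s, k)} →
    (k.sum fun _ x => x) ≤ B

/-- A VASSB is zero-base if every linear set occurring in an inflate label of
one of its edges has base vector `0`. -/
def ZeroBase (V : VASSB) : Prop :=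
  ∀ e ∈ V.edges, ∀ (s : ℕ) (L : SemilinRep), e.2.1 = VOp.inflate s L →
    ∀ bp ∈ L, bp.1 = (0 : Vec)

/-! ### Effective encodings of VASSB and their configurations -/

def encodeVec (v : Vec) : ℕ := Encodable.encode v.graph.val

def encodeZVec (v : ZVec) : ℕ := Encodable.encode v.graph.val

def encodeSL (L : SemilinRep) : ℕ :=
  Encodable.encode (L.map fun bp => (encodeVec bp.1, bp.2.map encodeVec))

def encodeVOp : VOp → ℕ
  | .delta d => Nat.pair 0 (encodeZVec d)
  | .inflate s L => Nat.pair 1 (Nat.pair s (encodeSL L))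
  | .deflate s s' pl p => Nat.pair 2 (Encodable.encode (s, s', pl, p))
  | .burst s => Nat.pair 3 s

/-- An effective encoding of VASSB by natural numbers. -/
def encodeVASSB (V : VASSB) : ℕ :=
  Encodable.encode (V.states.val, V.places.val, V.bstates.val, V.bplaces.val,
    V.edges.val.map fun e => (e.1, encodeVOp e.2.1, e.2.2))

def encodeBalloon (b : Balloon) : ℕ := Encodable.encode (b.1, encodeVec b.2)

/-- An effective encoding of VASSB configurations by natural numbers. -/
def encodeVConfig (c : VConfig) : ℕ :=
  Encodable.encode (c.q, encodeVec c.m, c.bag.map encodeBalloon)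

section Cones

/-- The relatively open rational cone spanned by a finite family. -/
def openCone {M : Type} [AddCommMonoid M] {κ : Type} [Fintype κ] (a : κ → M) : Set M :=
  {v | ∃ m : ℕ, 1 ≤ m ∧ ∃ n : κ → ℕ, (∀ i, 1 ≤ n i) ∧ m • v = ∑ i, n i • a i}

/-- Finite unions of relatively open rational cones. -/
def IsFinCones {M : Type} [AddCommMonoid M] (C : Set M) : Prop :=
  ∃ 𝓢 : Set (Set M), 𝓢.Finite ∧
    (∀ D ∈ 𝓢, ∃ (κ : Type) (_ : Fintype κ) (a : κ → M), D = openCone a) ∧ C = ⋃₀ 𝓢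

/-- The elements some positive multiple of which lies in `P`. -/
def satur {M : Type} [AddCommMonoid M] (P : AddSubmonoid M) : Set M :=
  {v | ∃ m : ℕ, 1 ≤ m ∧ m • v ∈ P}

variable {M N : Type} [AddCommMonoid M] [AddCommMonoid N]

theorem IsFinCones.openCone {κ : Type} [Fintype κ] (a : κ → M) : IsFinCones (openCone a) :=
  ⟨{CBL.openCone a}, Set.finite_singleton _, by
    rintro D rfl
    exact ⟨κ, _, a, rfl⟩, by simp⟩

theorem IsFinCones.empty : IsFinCones (∅ : Set M) :=
  ⟨∅, Set.finite_empty, by simp, by simp⟩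

theorem IsFinCones.sUnion {𝓢 : Set (Set M)} (h𝓢 : 𝓢.Finite) (h : ∀ C ∈ 𝓢, IsFinCones C) :
    IsFinCones (⋃₀ 𝓢) := by
  choose! F hF hF' hF'' using h
  refine ⟨⋃ C ∈ 𝓢, F C, h𝓢.biUnion hF, ?_, ?_⟩
  · intro D hD
    simp only [Set.mem_iUnion] at hD
    obtain ⟨C, hC, hD⟩ := hD
    exact hF' C hC D hD
  · ext v
    simp only [Set.mem_sUnion, Set.mem_iUnion]
    constructor
    · rintro ⟨C, hC, hv⟩
      rw [hF'' C hC] at hv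
      obtain ⟨D, hD, hv⟩ := hv
      exact ⟨D, ⟨C, hC, hD⟩, hv⟩
    · rintro ⟨D, ⟨C, hC, hD⟩, hv⟩
      refine ⟨C, hC, ?_⟩
      rw [hF'' C hC]
      exact ⟨D, hD, hv⟩

theorem IsFinCones.iUnion {ι : Type*} [Finite ι] {C : ι → Set M} (h : ∀ i, IsFinCones (C i)) :
    IsFinCones (⋃ i, C i) := by
  rw [← Set.sUnion_range]
  refine .sUnion (Set.finite_range _) ?_
  rintro _ ⟨i, rfl⟩
  exact h i

theorem subset_satur (P : AddSubmonoid M) : (P : Set M) ⊆ satur P :=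
  fun v hv => ⟨1, le_rfl, by simpa using hv⟩

theorem satur_add {P : AddSubmonoid M} {u v : M} (hu : u ∈ satur P) (hv : v ∈ satur P) :
    u + v ∈ satur P := by
  obtain ⟨m, hm, hu⟩ := hu
  obtain ⟨n, hn, hv⟩ := hv
  refine ⟨m * n, Nat.mul_pos hm hn, ?_⟩
  rw [smul_add]
  refine P.add_mem ?_ ?_
  · rw [mul_comm, mul_smul]; exact P.nsmul_mem hu n
  · rw [mul_smul]; exact P.nsmul_mem hv m

/-- Images of the strictly positive solutions of a linear system form an open cone. -/
theorem isFinCones_positive_solutions [IsCancelAdd N] {κ : Type} [Fintype κ]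
    (f g : (κ → ℕ) →+ N) (h : (κ → ℕ) →+ M) :
    IsFinCones {v : M | ∃ m : ℕ, 1 ≤ m ∧ ∃ x : κ → ℕ, (∀ i, 1 ≤ x i) ∧ f x = g x ∧
      m • v = h x} := by
  classical
  by_cases hpos : ∃ x : κ → ℕ, (∀ i, 1 ≤ x i) ∧ f x = g x
  swap
  · convert IsFinCones.empty (M := M)
    ext v
    simp only [Set.mem_ofPred_eq, Set.mem_empty_iff_false, iff_false]
    rintro ⟨m, hm, x, hx, hfg, -⟩
    exact hpos ⟨x, hx, hfg⟩
  obtain ⟨x0, hx0, hfg0⟩ := hpos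
  have hE : (AddMonoidHom.eqLocusM f g).FG := by
    apply AddSubmonoid.fg_of_subtractive
    intro x hx y hxy
    simp only [AddMonoidHom.mem_eqLocusM, map_add] at hx hxy ⊢
    rw [hx] at hxy
    exact add_left_cancel hxy
  obtain ⟨G, hG⟩ := hE
  have hmem : ∀ x : κ → ℕ, f x = g x ↔ ∃ c : G → ℕ, x = ∑ e, c e • (e : κ → ℕ) := by
    intro x
    rw [← AddMonoidHom.mem_eqLocusM, ← hG]
    constructor
    · intro hx
      induction hx using AddSubmonoid.closure_induction with
      | mem x hx => exact ⟨Pi.single ⟨x, hx⟩ 1, by simp [Pi.single_apply]⟩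
      | zero => exact ⟨0, by simp⟩
      | add x y _ _ hx hy =>
        obtain ⟨c, rfl⟩ := hx
        obtain ⟨d, rfl⟩ := hy
        exact ⟨c + d, by simp [add_smul, Finset.sum_add_distrib]⟩
    · rintro ⟨c, rfl⟩
      exact sum_mem fun e _ => AddSubmonoid.nsmul_mem _ (AddSubmonoid.subset_closure e.2) _
  convert IsFinCones.openCone (fun e : G => h e)
  ext v
  constructor
  · rintro ⟨m, hm, x, hx, hfg, hv⟩
    set y : κ → ℕ := ∑ e : G, (e : κ → ℕ) with hy
    have hyE : f y = g y := (hmem y).2 ⟨1, by simp [hy]⟩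
    set l := (∑ i, y i) + 1 with hl
    have hle : y ≤ l • x := by
      intro i
      have h1 : y i ≤ ∑ i, y i := Finset.single_le_sum (fun _ _ => Nat.zero_le _) (Finset.mem_univ i)
      have := hx i
      simp only [Pi.smul_apply, smul_eq_mul]
      nlinarith
    obtain ⟨z, hz⟩ := exists_add_of_le hle
    have hzE : f z = g z := by
      have h1 : f (l • x) = g (l • x) := by rw [map_nsmul, map_nsmul, hfg]
      rw [hz, map_add, map_add, hyE] at h1
      exact add_left_cancel h1
    obtain ⟨c, hc⟩ := (hmem z).1 hzE
    refine ⟨l * m, Nat.mul_pos (Nat.succ_pos _) hm, fun e => 1 + c e, fun e => Nat.le_add_right _ _, ?_⟩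
    rw [mul_smul, hv, ← map_nsmul, hz, hc, hy, ← Finset.sum_add_distrib, map_sum]
    refine Finset.sum_congr rfl fun e _ => ?_
    rw [map_add, map_nsmul, add_smul, one_smul]
  · rintro ⟨m, hm, c, hc, hv⟩
    refine ⟨m, hm, ∑ e, c e • (e : κ → ℕ), ?_, (hmem _).2 ⟨c, rfl⟩, ?_⟩
    · intro i
      obtain ⟨d, hd⟩ := (hmem x0).1 hfg0
      have h1 := hx0 i
      rw [hd] at h1
      simp only [Finset.sum_apply, Pi.smul_apply, smul_eq_mul] at h1 ⊢
      obtain ⟨e, -, he⟩ : ∃ e ∈ Finset.univ, d e * (e : κ → ℕ) i ≠ 0 := by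
        by_contra hcon
        push Not at hcon
        rw [Finset.sum_eq_zero hcon] at h1
        omega
      have he' : 1 ≤ (e : κ → ℕ) i := Nat.pos_of_ne_zero fun h0 => he (by simp [h0])
      calc 1 ≤ c e * (e : κ → ℕ) i := Nat.mul_pos (hc e) he'
        _ ≤ _ := Finset.single_le_sum (f := fun e : G => c e * (e : κ → ℕ) i)
            (fun _ _ => Nat.zero_le _) (Finset.mem_univ e)
    · rw [hv, map_sum]
      exact Finset.sum_congr rfl fun e _ => (map_nsmul _ _ _).symm

/-- A submonoid is definable if its saturation is a finite union of open cones. -/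
def DefinableCone (P : AddSubmonoid M) : Prop := IsFinCones (satur P)

/-- The linear map `n ↦ ∑ n i • a i`. -/
def combHom {κ : Type} [Fintype κ] (a : κ → M) : (κ → ℕ) →+ M where
  toFun n := ∑ i, n i • a i
  map_zero' := by simp
  map_add' x y := by simp [add_smul, Finset.sum_add_distrib]

@[simp] theorem combHom_apply {κ : Type} [Fintype κ] (a : κ → M) (n : κ → ℕ) :
    combHom a n = ∑ i, n i • a i := rfl

theorem DefinableCone.eqLocus [IsCancelAdd N] [IsAddTorsionFree N] {P : AddSubmonoid M}
    (hP : DefinableCone P) (f g : M →+ N) :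
    DefinableCone (P ⊓ AddMonoidHom.eqLocusM f g) := by
  obtain ⟨𝓢, h𝓢, hc, hs⟩ := hP
  have key : satur (P ⊓ AddMonoidHom.eqLocusM f g) =
      ⋃₀ ((fun C => C ∩ {v | f v = g v}) '' 𝓢) := by
    ext v
    have : (∃ C ∈ 𝓢, v ∈ C) ↔ v ∈ satur P := by rw [hs]; rfl
    simp only [Set.mem_sUnion, Set.exists_mem_image, Set.mem_inter_iff]
    constructor
    · rintro ⟨m, hm, hv, hv'⟩
      obtain ⟨C, hC, hvC⟩ := this.2 ⟨m, hm, hv⟩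
      refine ⟨C, hC, hvC, ?_⟩
      have h1 : f (m • v) = g (m • v) := hv'
      rw [map_nsmul, map_nsmul] at h1
      exact nsmul_right_injective (by omega : m ≠ 0) h1
    · rintro ⟨C, hC, hvC, hv⟩
      obtain ⟨m, hm, h1⟩ := this.1 ⟨C, hC, hvC⟩
      refine ⟨m, hm, h1, ?_⟩
      have hv : f v = g v := hv
      change f (m • v) = g (m • v)
      rw [map_nsmul, map_nsmul, hv]
  unfold DefinableCone
  rw [key]
  refine .sUnion (h𝓢.image _) ?_
  rintro _ ⟨C, hC, rfl⟩
  obtain ⟨κ, _, a, rfl⟩ := hc C hC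
  convert isFinCones_positive_solutions (f.comp (combHom a)) (g.comp (combHom a)) (combHom a)
    using 1
  ext v
  constructor
  · rintro ⟨⟨m, hm, n, hn, hv⟩, hfg⟩
    have hfg : f v = g v := hfg
    refine ⟨m, hm, n, hn, ?_, hv⟩
    simp only [AddMonoidHom.comp_apply, combHom_apply, ← hv, map_nsmul, hfg]
  · rintro ⟨m, hm, n, hn, hfg, hv⟩
    refine ⟨⟨m, hm, n, hn, hv⟩, ?_⟩
    simp only [AddMonoidHom.comp_apply, ← hv, map_nsmul] at hfg
    exact nsmul_right_injective (by omega : m ≠ 0) hfg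

theorem DefinableCone.map {P : AddSubmonoid M} (hP : DefinableCone P) (f : M →+ N) :
    DefinableCone (P.map f) := by
  obtain ⟨𝓢, h𝓢, hc, hs⟩ := hP
  choose κ hκ a ha using fun C : 𝓢 => hc C.1 C.2
  have key : satur (P.map f) = ⋃ C : 𝓢, openCone (fun i => f (a C i)) := by
    ext v
    simp only [Set.mem_iUnion]
    constructor
    · rintro ⟨m, hm, p, hp, hv⟩
      have h1 : p ∈ satur P := subset_satur P hp
      rw [hs] at h1
      obtain ⟨C, hC, hpC⟩ := h1
      obtain ⟨C, rfl⟩ : ∃ C' : 𝓢, C = C' := ⟨⟨C, hC⟩, rfl⟩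
      refine ⟨C, ?_⟩
      rw [ha C] at hpC
      obtain ⟨k, hk, n, hn, h2⟩ := hpC
      refine ⟨k * m, Nat.mul_pos hk hm, n, hn, ?_⟩
      rw [mul_smul, ← hv, ← map_nsmul, h2, map_sum]
      simp [map_nsmul]
    · rintro ⟨C, m, hm, n, hn, hv⟩
      have h1 : (∑ i, n i • a C i) ∈ satur P := by
        rw [hs]
        refine ⟨C, C.2, ?_⟩
        rw [ha C]
        exact ⟨1, le_rfl, n, hn, by simp⟩
      obtain ⟨k, hk, h2⟩ := h1
      refine ⟨k * m, Nat.mul_pos hk hm, _, h2, ?_⟩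
      rw [mul_smul, hv, map_nsmul, map_sum]
      simp [map_nsmul]
  unfold DefinableCone
  rw [key]
  have := h𝓢.to_subtype
  exact .iUnion fun C => .openCone _

theorem DefinableCone.prod {P : AddSubmonoid M} {Q : AddSubmonoid N} (hP : DefinableCone P)
    (hQ : DefinableCone Q) : DefinableCone (P.prod Q) := by
  obtain ⟨𝓢, h𝓢, hc, hs⟩ := hP
  obtain ⟨𝓣, h𝓣, hd, ht⟩ := hQ
  have key : satur (P.prod Q) = ⋃₀ (Set.image2 (fun C D => C ×ˢ D) 𝓢 𝓣) := by
    ext ⟨u, v⟩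
    have h1 : (∃ C ∈ 𝓢, u ∈ C) ↔ u ∈ satur P := by rw [hs]; rfl
    have h2 : (∃ C ∈ 𝓣, v ∈ C) ↔ v ∈ satur Q := by rw [ht]; rfl
    constructor
    · rintro ⟨m, hm, hu, hv⟩
      obtain ⟨C, hC, hu⟩ := h1.2 ⟨m, hm, hu⟩
      obtain ⟨D, hD, hv⟩ := h2.2 ⟨m, hm, hv⟩
      exact ⟨_, ⟨C, hC, D, hD, rfl⟩, hu, hv⟩
    · rintro ⟨_, ⟨C, hC, D, hD, rfl⟩, hu, hv⟩
      obtain ⟨m, hm, hu⟩ := h1.1 ⟨C, hC, hu⟩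
      obtain ⟨n, hn, hv⟩ := h2.1 ⟨D, hD, hv⟩
      refine ⟨m * n, Nat.mul_pos hm hn, ?_, ?_⟩
      · change (m * n) • u ∈ P
        rw [mul_comm, mul_smul]; exact P.nsmul_mem hu n
      · change (m * n) • v ∈ Q
        rw [mul_smul]; exact Q.nsmul_mem hv m
  unfold DefinableCone
  rw [key]
  refine .sUnion (h𝓢.image2 _ h𝓣) ?_
  rintro _ ⟨C, hC, D, hD, rfl⟩
  obtain ⟨κ, _, a, rfl⟩ := hc C hC
  obtain ⟨μ, _, b, rfl⟩ := hd D hD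
  convert IsFinCones.openCone (Sum.elim (fun i => (a i, (0 : N))) (fun j => ((0 : M), b j))) using 1
  ext ⟨u, v⟩
  constructor
  · rintro ⟨⟨m, hm, x, hx, hu⟩, ⟨n, hn, y, hy, hv⟩⟩
    refine ⟨m * n, Nat.mul_pos hm hn, Sum.elim (fun i => n * x i) (fun j => m * y j), ?_, ?_⟩
    · rintro (i | j)
      · exact Nat.mul_pos hn (hx i)
      · exact Nat.mul_pos hm (hy j)
    · have hu : m • u = ∑ i, x i • a i := hu
      have hv : n • v = ∑ i, y i • b i := hv
      simp only [Fintype.sum_sum_type, Sum.elim_inl, Sum.elim_inr, Prod.smul_mk, smul_zero]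
      ext
      · simp only [Prod.fst_add, Prod.fst_sum, Finset.sum_const_zero, add_zero]
        rw [mul_comm, mul_smul, hu, Finset.smul_sum]
        simp [mul_smul]
      · simp only [Prod.snd_add, Prod.snd_sum, Finset.sum_const_zero, zero_add]
        rw [mul_smul, hv, Finset.smul_sum]
        simp [mul_smul]
  · rintro ⟨m, hm, n, hn, h⟩
    simp only [Fintype.sum_sum_type, Sum.elim_inl, Sum.elim_inr, Prod.smul_mk, smul_zero] at h
    have hu := congrArg Prod.fst h
    have hv := congrArg Prod.snd h
    simp only [Prod.fst_add, Prod.fst_sum, Finset.sum_const_zero, add_zero, Prod.snd_add,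
      Prod.snd_sum, zero_add] at hu hv
    exact ⟨⟨m, hm, fun i => n (.inl i), fun i => hn _, hu⟩,
      ⟨m, hm, fun i => n (.inr i), fun i => hn _, hv⟩⟩

theorem DefinableCone.of_comb {κ : Type} [Fintype κ] (a : κ → M) :
    DefinableCone (AddMonoidHom.mrange (combHom a)) := by
  classical
  have key : satur (AddMonoidHom.mrange (combHom a)) =
      ⋃ s : Finset κ, openCone (fun i : s => a i) := by
    ext v
    simp only [Set.mem_iUnion]
    constructor
    · rintro ⟨m, hm, n, hn⟩
      refine ⟨Finset.univ.filter (fun i => n i ≠ 0), m, hm, fun i => n i, ?_, ?_⟩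
      · rintro ⟨i, hi⟩
        simp only [Finset.mem_filter, Finset.mem_univ, true_and] at hi
        exact Nat.pos_of_ne_zero hi
      · rw [← hn, combHom_apply, Finset.sum_coe_sort _ (fun i => n i • a i), Finset.sum_filter]
        refine Finset.sum_congr rfl fun i _ => ?_
        split_ifs with h
        · rfl
        · simp only [not_not] at h; simp [h]
    · rintro ⟨s, m, hm, n, hn, h⟩
      refine ⟨m, hm, fun i => if hi : i ∈ s then n ⟨i, hi⟩ else 0, ?_⟩
      rw [h, combHom_apply, ← Finset.sum_subset (Finset.subset_univ s)]
      · rw [← Finset.sum_coe_sort s]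
        refine Finset.sum_congr rfl fun i _ => ?_
        simp
      · intro i _ hi
        simp [hi]
  unfold DefinableCone
  rw [key]
  exact .iUnion fun s => .openCone _

theorem DefinableCone.inf [IsCancelAdd M] [IsAddTorsionFree M] {P Q : AddSubmonoid M}
    (hP : DefinableCone P) (hQ : DefinableCone Q) : DefinableCone (P ⊓ Q) := by
  have h := ((hP.prod hQ).eqLocus (AddMonoidHom.fst M M) (AddMonoidHom.snd M M)).map
    (AddMonoidHom.fst M M)
  convert h
  ext x
  constructor
  · rintro ⟨h1, h2⟩
    exact ⟨(x, x), ⟨⟨h1, h2⟩, rfl⟩, rfl⟩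
  · rintro ⟨⟨y, z⟩, ⟨⟨h1, h2⟩, h3⟩, rfl⟩
    have h3 : y = z := h3
    subst h3
    exact ⟨h1, h2⟩

/-- Composition of two submonoids of `M × M`, seen as relations. -/
def compRel (P Q : AddSubmonoid (M × M)) : AddSubmonoid (M × M) where
  carrier := {x | ∃ y, (x.1, y) ∈ P ∧ (y, x.2) ∈ Q}
  zero_mem' := ⟨0, P.zero_mem, Q.zero_mem⟩
  add_mem' := by
    rintro ⟨a, b⟩ ⟨c, d⟩ ⟨y, h1, h2⟩ ⟨z, h3, h4⟩
    exact ⟨y + z, P.add_mem h1 h3, Q.add_mem h2 h4⟩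

theorem DefinableCone.compRel [IsCancelAdd M] [IsAddTorsionFree M] {P Q : AddSubmonoid (M × M)}
    (hP : DefinableCone P) (hQ : DefinableCone Q) : DefinableCone (compRel P Q) := by
  have h := ((hP.prod hQ).eqLocus
    ((AddMonoidHom.snd M M).comp (AddMonoidHom.fst (M × M) (M × M)))
    ((AddMonoidHom.fst M M).comp (AddMonoidHom.snd (M × M) (M × M)))).map
    (((AddMonoidHom.fst M M).comp (AddMonoidHom.fst (M × M) (M × M))).prod
      ((AddMonoidHom.snd M M).comp (AddMonoidHom.snd (M × M) (M × M))))
  convert h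
  ext ⟨x, z⟩
  constructor
  · rintro ⟨y, h1, h2⟩
    exact ⟨((x, y), (y, z)), ⟨⟨h1, h2⟩, rfl⟩, rfl⟩
  · rintro ⟨⟨⟨x', y⟩, ⟨y', z'⟩⟩, ⟨⟨h1, h2⟩, h3⟩, h4⟩
    have h3 : y = y' := h3
    subst h3
    obtain ⟨rfl, rfl⟩ := Prod.mk.inj h4
    exact ⟨y, h1, h2⟩

/-- A finite family of directions describing a submonoid up to multiples. -/
def NiceSubmonoid (P : AddSubmonoid M) : Prop :=
  ∃ (κ : Type) (_ : Fintype κ) (a : κ → M), ∃ w ∈ P,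
    (∀ p ∈ P, ∃ m : ℕ, 1 ≤ m ∧ ∃ n : κ → ℕ, m • p = ∑ i, n i • a i) ∧
    ∀ n : κ → ℕ, ∃ m : ℕ, 1 ≤ m ∧ m • ((∑ i, n i • a i) + w) ∈ P

theorem DefinableCone.nice {P : AddSubmonoid M} (hP : DefinableCone P) : NiceSubmonoid P := by
  classical
  obtain ⟨𝓢, h𝓢, hc, hs⟩ := hP
  choose κ hκ a ha using fun C : 𝓢 => hc C.1 C.2
  have := h𝓢.fintype
  have hmem : ∀ (C : 𝓢) (v : M), v ∈ openCone (a C) → v ∈ satur P := by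
    intro C v hv
    rw [hs]
    exact ⟨C.1, C.2, by rw [ha C]; exact hv⟩
  have hw : ∀ C : 𝓢, ∃ m : ℕ, 1 ≤ m ∧ m • ∑ i, a C i ∈ P := fun C =>
    hmem C (∑ i, a C i) ⟨1, le_rfl, fun _ => 1, fun _ => le_rfl, by simp⟩
  choose k hk hkP using hw
  refine ⟨(C : 𝓢) × κ C, inferInstance, fun x => a x.1 x.2, ∑ C, k C • ∑ i, a C i,
    sum_mem fun C _ => hkP C, ?_, ?_⟩
  · intro p hp
    have h1 := subset_satur P hp
    rw [hs] at h1
    obtain ⟨C, hC, hpC⟩ := h1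
    obtain ⟨C, rfl⟩ : ∃ C' : 𝓢, C = C' := ⟨⟨C, hC⟩, rfl⟩
    rw [ha C] at hpC
    obtain ⟨m, hm, n, hn, h⟩ := hpC
    refine ⟨m, hm, fun x => if h : x.1 = C then n (h ▸ x.2) else 0, ?_⟩
    rw [h, Fintype.sum_sigma, Finset.sum_eq_single C]
    · simp
    · intro D _ hD
      simp [hD]
    · simp
  · intro n
    have : (∑ x : (C : 𝓢) × κ C, n x • a x.1 x.2) + ∑ C, k C • ∑ i, a C i =
        ∑ C : 𝓢, ∑ i, (n ⟨C, i⟩ + k C) • a C i := by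
      rw [Fintype.sum_sigma, ← Finset.sum_add_distrib]
      simp [add_smul, Finset.sum_add_distrib, Finset.smul_sum]
    rw [this]
    have hsum : ∀ s : Finset 𝓢, (∑ C ∈ s, ∑ i, (n ⟨C, i⟩ + k C) • a C i) ∈ satur P := by
      intro s
      induction s using Finset.induction_on with
      | empty => exact ⟨1, le_rfl, by simp⟩
      | insert C s hC ih =>
        rw [Finset.sum_insert hC]
        refine satur_add (hmem C _ ⟨1, le_rfl, fun i => n ⟨C, i⟩ + k C, ?_, by simp⟩) ih
        intro i
        exact (hk C).trans (Nat.le_add_left _ _)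
    exact hsum Finset.univ

end Cones

section Nets

variable {ι : Type}

/-- Transitions of a Petri net: tokens consumed and tokens produced. -/
abbrev Trans (ι : Type) : Type := (ι → ℕ) × (ι → ℕ)

/-- One firing step of a Petri net. -/
def NStep (T : Set (Trans ι)) (x y : ι → ℕ) : Prop :=
  ∃ t ∈ T, ∃ z, x = z + t.1 ∧ y = z + t.2

/-- Reachability in a Petri net. -/
def NReach (T : Set (Trans ι)) : (ι → ℕ) → (ι → ℕ) → Prop := Relation.ReflTransGen (NStep T)

theorem NReach.refl {T : Set (Trans ι)} {x : ι → ℕ} : NReach T x x := Relation.ReflTransGen.refl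

theorem NReach.trans {T : Set (Trans ι)} {x y z : ι → ℕ} (h : NReach T x y) (h' : NReach T y z) :
    NReach T x z := Relation.ReflTransGen.trans h h'

theorem NReach.add_right {T : Set (Trans ι)} {x y : ι → ℕ} (h : NReach T x y) (v : ι → ℕ) :
    NReach T (x + v) (y + v) := by
  refine Relation.ReflTransGen.lift (· + v) ?_ x y h
  rintro _ _ ⟨t, ht, z, rfl, rfl⟩
  exact ⟨t, ht, z + v, by simp only []; ac_rfl, by simp only []; ac_rfl⟩

theorem NReach.congr {T : Set (Trans ι)} {x y x' y' : ι → ℕ} (h : NReach T x y) (hx : x' = x)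
    (hy : y' = y) : NReach T x' y' := hx ▸ hy ▸ h

/-- Runs of a net under a projection of its configurations, recording the configurations from which
transitions are fired. -/
inductive Walk (T : Set (Trans ι)) (φ : (ι → ℕ) →+ (ι → ℕ)) :
    (ι → ℕ) → List ((ι → ℕ) × Trans ι) → (ι → ℕ) → Prop
  | nil (u) : Walk T φ u [] u
  | cons {t z l v} (ht : t ∈ T) (h : Walk T φ (z + φ t.2) l v) :
      Walk T φ (z + φ t.1) ((z + φ t.1, t) :: l) v

/-- Total consumption along a walk. -/
def preSum (l : List ((ι → ℕ) × Trans ι)) : ι → ℕ := (l.map fun p => p.2.1).sum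

/-- Total production along a walk. -/
def postSum (l : List ((ι → ℕ) × Trans ι)) : ι → ℕ := (l.map fun p => p.2.2).sum

@[simp] theorem preSum_nil : preSum ([] : List ((ι → ℕ) × Trans ι)) = 0 := rfl
@[simp] theorem postSum_nil : postSum ([] : List ((ι → ℕ) × Trans ι)) = 0 := rfl
@[simp] theorem preSum_cons (p : (ι → ℕ) × Trans ι) (l) : preSum (p :: l) = p.2.1 + preSum l := rfl
@[simp] theorem postSum_cons (p : (ι → ℕ) × Trans ι) (l) :
    postSum (p :: l) = p.2.2 + postSum l := rfl
@[simp] theorem preSum_append (l l' : List ((ι → ℕ) × Trans ι)) :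
    preSum (l ++ l') = preSum l + preSum l' := by simp [preSum]
@[simp] theorem postSum_append (l l' : List ((ι → ℕ) × Trans ι)) :
    postSum (l ++ l') = postSum l + postSum l' := by simp [postSum]

variable {T : Set (Trans ι)} {φ : (ι → ℕ) →+ (ι → ℕ)}

theorem Walk.append {u v w : ι → ℕ} {l l'} (h : Walk T φ u l v) (h' : Walk T φ v l' w) :
    Walk T φ u (l ++ l') w := by
  induction h with
  | nil u => exact h'
  | cons ht h ih => exact .cons ht (ih h')

theorem Walk.split {u w : ι → ℕ} {l p l'} (h : Walk T φ u (l ++ p :: l') w) :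
    Walk T φ u l p.1 ∧ Walk T φ p.1 (p :: l') w := by
  induction l generalizing u with
  | nil =>
    cases h with
    | cons ht h => exact ⟨.nil _, .cons ht h⟩
  | cons q l ih =>
    cases h with
    | cons ht h => exact ⟨.cons ht (ih h).1, (ih h).2⟩

theorem Walk.mem_trans {u w : ι → ℕ} {l} (h : Walk T φ u l w) : ∀ p ∈ l, p.2 ∈ T := by
  induction h with
  | nil u => simp
  | cons ht h ih =>
    intro p hp
    rcases List.mem_cons.1 hp with rfl | hp
    · exact ht
    · exact ih p hp

theorem exists_walk_of_reach {x y : ι → ℕ} (h : NReach T x y) :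
    ∃ l, Walk T (AddMonoidHom.id _) x l y := by
  induction h using Relation.ReflTransGen.head_induction_on with
  | refl => exact ⟨[], .nil _⟩
  | head h _ ih =>
    obtain ⟨t, ht, z, rfl, rfl⟩ := h
    obtain ⟨l, hl⟩ := ih
    exact ⟨_, Walk.cons (φ := AddMonoidHom.id _) ht hl⟩

theorem Walk.reach {x y : ι → ℕ} {l} (h : Walk T (AddMonoidHom.id _) x l y) : NReach T x y := by
  induction h with
  | nil u => exact .refl
  | cons ht h ih => exact Relation.ReflTransGen.head ⟨_, ht, _, rfl, rfl⟩ ih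

theorem Walk.map (φ : (ι → ℕ) →+ (ι → ℕ)) {x y : ι → ℕ} {l}
    (h : Walk T (AddMonoidHom.id _) x l y) :
    Walk T φ (φ x) (l.map fun p => (φ p.1, p.2)) (φ y) := by
  induction h with
  | nil u => exact .nil _
  | cons ht h ih =>
    simp only [AddMonoidHom.id_apply, List.map_cons, map_add] at ih ⊢
    exact .cons ht ih

theorem Walk.displacement {x y : ι → ℕ} {l} (h : Walk T (AddMonoidHom.id _) x l y) :
    x + postSum l = y + preSum l := by
  induction h with
  | nil u => simp
  | @cons t z l v ht h ih =>
    simp only [AddMonoidHom.id_apply, preSum_cons, postSum_cons] at ih ⊢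
    calc z + t.1 + (t.2 + postSum l) = (z + t.2 + postSum l) + t.1 := by ac_rfl
      _ = _ := by rw [ih]; ac_rfl

@[simp] theorem preSum_map (f : (ι → ℕ) → (ι → ℕ)) (l : List ((ι → ℕ) × Trans ι)) :
    preSum (l.map fun p => (f p.1, p.2)) = preSum l := by
  simp [preSum, Function.comp_def]
@[simp] theorem postSum_map (f : (ι → ℕ) → (ι → ℕ)) (l : List ((ι → ℕ) × Trans ι)) :
    postSum (l.map fun p => (f p.1, p.2)) = postSum l := by
  simp [postSum, Function.comp_def]

theorem exists_repeated_vertex {α β : Type*} (l : List (α × β)) (h : ¬ (l.map Prod.fst).Nodup) :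
    ∃ l₁ x t l₂ t' l₃, l = l₁ ++ (x, t) :: (l₂ ++ (x, t') :: l₃) := by
  induction l with
  | nil => simp at h
  | cons p l ih =>
    by_cases hp : p.1 ∈ l.map Prod.fst
    · obtain ⟨q, hq, hpq⟩ := List.mem_map.1 hp
      obtain ⟨l₂, l₃, rfl⟩ := List.append_of_mem hq
      refine ⟨[], p.1, p.2, l₂, q.2, l₃, ?_⟩
      rw [← hpq]
      simp only [List.nil_append, Prod.mk.eta, List.cons.injEq, and_true]
      rw [hpq]
    · have : ¬ (l.map Prod.fst).Nodup := fun h' => h (by simp only [List.map_cons, List.nodup_cons]; exact ⟨hp, h'⟩)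
      obtain ⟨l₁, x, t, l₂, t', l₃, rfl⟩ := ih this
      exact ⟨p :: l₁, x, t, l₂, t', l₃, rfl⟩

theorem Walk.decompose (U : Finset (ι → ℕ)) {u : ι → ℕ} {l} (h : Walk T φ u l u)
    (hU : ∀ p ∈ l, p.1 ∈ U) :
    ∃ W : List (List ((ι → ℕ) × Trans ι)),
      (∀ w ∈ W, w.length ≤ U.card ∧ (∀ p ∈ w, p.1 ∈ U ∧ p.2 ∈ T) ∧
        ∃ v, Walk T φ v w v ∧ ∃ p ∈ l, p.1 = v) ∧
      preSum l = (W.map preSum).sum ∧ postSum l = (W.map postSum).sum := by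
  classical
  induction hn : l.length using Nat.strong_induction_on generalizing l u with
  | _ n ih =>
    subst hn
    by_cases hl : l.length ≤ U.card
    · cases l with
      | nil => exact ⟨[], by simp⟩
      | cons p l =>
        refine ⟨[p :: l], ?_, by simp⟩
        simp only [List.mem_singleton, forall_eq]
        refine ⟨hl, fun q hq => ⟨hU q hq, h.mem_trans q hq⟩, u, h, p, by simp, ?_⟩
        cases h
        rfl
    · have hnd : ¬ (l.map Prod.fst).Nodup := by
        intro hnd
        apply hl
        rw [← List.length_map (f := Prod.fst), ← List.toFinset_card_of_nodup hnd]
        refine Finset.card_le_card fun x hx => ?_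
        simp only [List.mem_toFinset, List.mem_map] at hx
        obtain ⟨p, hp, rfl⟩ := hx
        exact hU p hp
      obtain ⟨l₁, x, t, l₂, t', l₃, rfl⟩ := exists_repeated_vertex l hnd
      obtain ⟨h1, h2⟩ := h.split
      obtain ⟨h3, h4⟩ := Walk.split (l := (x, t) :: l₂) (p := (x, t')) h2
      have h5 : Walk T φ u (l₁ ++ (x, t') :: l₃) u := h1.append h4
      obtain ⟨W₁, hW₁, hp₁, hq₁⟩ := ih _ (by simp; omega) h3
        (fun p hp => hU p (by
          simp only [List.mem_cons, List.mem_append] at hp ⊢; tauto)) rfl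
      obtain ⟨W₂, hW₂, hp₂, hq₂⟩ := ih _ (by simp) h5
        (fun p hp => hU p (by
          simp only [List.mem_cons, List.mem_append] at hp ⊢; tauto)) rfl
      refine ⟨W₁ ++ W₂, ?_, ?_, ?_⟩
      · intro w hw
        rcases List.mem_append.1 hw with hw | hw
        · obtain ⟨a, b, v, hv, p, hp, hpv⟩ := hW₁ w hw
          exact ⟨a, b, v, hv, p, by simp only [List.mem_cons, List.mem_append] at hp ⊢; tauto, hpv⟩
        · obtain ⟨a, b, v, hv, p, hp, hpv⟩ := hW₂ w hw
          exact ⟨a, b, v, hv, p, by simp only [List.mem_cons, List.mem_append] at hp ⊢; tauto, hpv⟩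
      · rw [List.map_append, List.sum_append, ← hp₁, ← hp₂]
        simp only [preSum_append, preSum_cons]
        ac_rfl
      · rw [List.map_append, List.sum_append, ← hq₁, ← hq₂]
        simp only [postSum_append, postSum_cons]
        ac_rfl

theorem Walk.insert {u : ι → ℕ} {l} (h : Walk T φ u l u)
    (W : List (List ((ι → ℕ) × Trans ι)))
    (hW : ∀ w ∈ W, ∃ v, Walk T φ v w v ∧ ∃ p ∈ l, p.1 = v) :
    ∃ l', Walk T φ u l' u ∧ preSum l' = preSum l + (W.map preSum).sum ∧
      postSum l' = postSum l + (W.map postSum).sum := by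
  induction W generalizing l with
  | nil => exact ⟨l, h, by simp⟩
  | cons w W ih =>
    obtain ⟨v, hw, p, hp, rfl⟩ := hW w (by simp)
    obtain ⟨l₁, l₂, rfl⟩ := List.append_of_mem hp
    obtain ⟨h1, h2⟩ := h.split
    obtain ⟨l', hl', hp', hq'⟩ := ih (h1.append (hw.append h2)) (by
      intro w' hw'
      obtain ⟨v, hv, q, hq, hqv⟩ := hW w' (by simp [hw'])
      exact ⟨v, hv, q, by simp only [List.mem_cons, List.mem_append] at hq ⊢; tauto, hqv⟩)
    refine ⟨l', hl', ?_, ?_⟩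
    · rw [hp']
      simp only [preSum_append, List.map_cons, List.sum_cons]
      ac_rfl
    · rw [hq']
      simp only [postSum_append, List.map_cons, List.sum_cons]
      ac_rfl

/-- Restriction of a vector to a set of places, the others being set to `0`. -/
def resHom (J : Finset ι) : (ι → ℕ) →+ (ι → ℕ) := by
  classical
  exact
  { toFun := fun x i => if i ∈ J then x i else 0
    map_zero' := by ext; simp
    map_add' := by intro x y; ext i; by_cases h : i ∈ J <;> simp [h] }

theorem resHom_apply_mem {J : Finset ι} {i : ι} (h : i ∈ J) (x : ι → ℕ) : resHom J x i = x i := by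
  simp [resHom, h]

theorem resHom_apply_notMem {J : Finset ι} {i : ι} (h : i ∉ J) (x : ι → ℕ) :
    resHom J x i = 0 := by
  simp [resHom, h]

theorem Walk.fire {J : Finset ι} {u v : ι → ℕ} {l} (h : Walk T (resHom J) u l v) (x : ι → ℕ)
    (hx : resHom J x = u) (hpre : ∀ i ∉ J, preSum l i ≤ x i) :
    ∃ y, NReach T x y ∧ x + postSum l = y + preSum l := by
  induction h generalizing x with
  | nil u => exact ⟨x, .refl, by simp⟩
  | @cons t z l v ht h ih =>
    have hle : t.1 ≤ x := by
      intro i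
      change t.1 i ≤ x i
      by_cases hi : i ∈ J
      · have := congrFun hx i
        simp only [resHom_apply_mem hi, Pi.add_apply] at this
        omega
      · have := hpre i hi
        simp only [preSum_cons, Pi.add_apply] at this
        omega
    obtain ⟨w, hw⟩ := exists_add_of_le hle
    rw [add_comm] at hw
    obtain ⟨y, hy, hd⟩ := ih (w + t.2) (by
      have : resHom J w = z := by
        rw [hw, map_add] at hx
        exact add_right_cancel hx
      rw [map_add, this]) (by
      intro i hi
      have := hpre i hi
      simp only [preSum_cons, Pi.add_apply, hw] at this ⊢
      omega)
    refine ⟨y, Relation.ReflTransGen.head ⟨t, ht, w, hw, rfl⟩ hy, ?_⟩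
    simp only [preSum_cons, postSum_cons]
    calc x + (t.2 + postSum l) = (w + t.2 + postSum l) + t.1 := by rw [hw]; ac_rfl
      _ = _ := by rw [hd]; ac_rfl

/-- The submonoid of pairs of increments by which both ends of a trivial run at `c` may grow. -/
def prodRel (T : Set (Trans ι)) (c : ι → ℕ) : AddSubmonoid ((ι → ℕ) × (ι → ℕ)) where
  carrier := {x | NReach T (c + x.1) (c + x.2)}
  zero_mem' := .refl
  add_mem' := by
    rintro ⟨a, b⟩ ⟨a', b'⟩ h h'
    refine NReach.trans ((NReach.add_right h a').congr ?_ rfl) ((NReach.add_right h' b).congr ?_ ?_)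
    all_goals simp only [Prod.mk_add_mk]; ac_rfl

theorem mem_prodRel {c r s : ι → ℕ} : (r, s) ∈ prodRel T c ↔ NReach T (c + r) (c + s) := Iff.rfl

theorem prodRel_trans {c r s u : ι → ℕ} (h : (r, s) ∈ prodRel T c) (h' : (s, u) ∈ prodRel T c) :
    (r, u) ∈ prodRel T c := NReach.trans h h'

theorem prodRel_add {c r s u : ι → ℕ} (h : (r, s) ∈ prodRel T c) :
    (r + u, s + u) ∈ prodRel T c := by
  have h0 : (u, u) ∈ prodRel T c := NReach.refl
  exact (prodRel T c).add_mem h h0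

end Nets

section BadPaths

/-- Reversed paths from `c` in which no vertex dominates an earlier one. -/
inductive BadPath {α : Type*} [LE α] (step : α → α → Prop) (c : α) : List α → Prop
  | base : BadPath step c [c]
  | cons {u v l} (h : BadPath step c (u :: l)) (hs : step u v) (hb : ∀ w ∈ u :: l, ¬ w ≤ v) :
      BadPath step c (v :: u :: l)

variable {α : Type*} [Preorder α] {step : α → α → Prop} {c : α}

theorem BadPath.not_le {v : α} {l : List α} (h : BadPath step c (v :: l)) :
    ∀ w ∈ l, ¬ w ≤ v := by
  cases h with
  | base => simp
  | cons _ _ hb => exact hb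

theorem BadPath.of_suffix {l l' : List α} (h : BadPath step c l) (hs : l' <:+ l) (hl' : l' ≠ []) :
    BadPath step c l' := by
  induction h with
  | base =>
    rcases List.suffix_cons_iff.1 hs with rfl | hs
    · exact .base
    · exact absurd (List.suffix_nil.1 hs) hl'
  | cons h h1 h2 ih =>
    rcases List.suffix_cons_iff.1 hs with rfl | hs
    · exact .cons h h1 h2
    · exact ih hs

theorem wellFounded_badPath_extension [WellQuasiOrderedLE α] :
    WellFounded (fun l' l : List α => BadPath step c l' ∧ ∃ v, l' = v :: l) := by
  rw [wellFounded_iff_isEmpty_descending_chain]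
  refine ⟨fun ⟨f, hf⟩ => ?_⟩
  choose hbad x hx using hf
  have hmem : ∀ i j, i < j → x i ∈ f j := by
    intro i j hij
    induction j with
    | zero => omega
    | succ j ih =>
      rw [hx j]
      rcases Nat.lt_succ_iff_lt_or_eq.1 hij with h | rfl
      · exact List.mem_cons_of_mem _ (ih h)
      · simp
  obtain ⟨i, j, hij, hle⟩ := wellQuasiOrdered_le x
  have := hbad j
  rw [hx j] at this
  exact this.not_le _ (hmem i j hij) hle

theorem finite_badPath [WellQuasiOrderedLE α] (hfin : ∀ u, {v | step u v}.Finite) :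
    {v | ∃ l, BadPath step c (v :: l)}.Finite := by
  have key : ∀ l : List α, l ≠ [] →
      {v | ∃ l', BadPath step c (v :: l') ∧ l <:+ v :: l'}.Finite := by
    intro l
    induction l using (wellFounded_badPath_extension (step := step) (c := c)).induction with
    | _ l ih =>
      intro hl
      obtain ⟨u, l, rfl⟩ := List.exists_cons_of_ne_nil hl
      refine Set.Finite.subset (s := {u} ∪ ⋃ v ∈ {v | step u v},
        {w | ∃ l', BadPath step c (w :: l') ∧ BadPath step c (v :: u :: l) ∧
          v :: u :: l <:+ w :: l'}) ?_ ?_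
      · refine (Set.finite_singleton u).union ((hfin u).biUnion fun v _ => ?_)
        by_cases hv : BadPath step c (v :: u :: l)
        · refine (ih (v :: u :: l) ⟨hv, v, rfl⟩ (by simp)).subset ?_
          rintro w ⟨l', h1, -, h2⟩
          exact ⟨l', h1, h2⟩
        · convert Set.finite_empty (α := α)
          ext w
          simp only [Set.mem_empty_iff_false, iff_false]
          rintro ⟨l', -, h, -⟩
          exact hv h
      · rintro w ⟨l', hw, s, hs⟩
        rcases List.eq_nil_or_concat s with rfl | ⟨s, v, rfl⟩
        · left
          simp only [List.nil_append, List.cons.injEq] at hs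
          exact hs.1.symm
        · right
          have h1 : v :: u :: l <:+ w :: l' := ⟨s, by rw [← hs]; simp⟩
          have h2 := hw.of_suffix h1 (by simp)
          simp only [Set.mem_iUnion]
          refine ⟨v, ?_, l', hw, h2, h1⟩
          cases h2 with
          | cons _ h _ => exact h
  refine (key [c] (by simp)).subset ?_
  rintro v ⟨l, hl⟩
  refine ⟨l, hl, ?_⟩
  generalize v :: l = l' at hl
  induction hl with
  | base => exact List.suffix_rfl
  | cons h h1 h2 ih => exact ih.trans (List.suffix_cons _ _)

/-- A path inside a set of pairwise incomparable vertices only visits endpoints of bad paths. -/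
theorem exists_badPath_of_antichain {V : Set α} (hV : ∀ x ∈ V, ∀ y ∈ V, x ≤ y → x = y)
    {u v : α} {l : List α} (hl : BadPath step c (u :: l)) (hlV : ∀ x ∈ u :: l, x ∈ V)
    (hs : step u v) (hv : v ∈ V) :
    ∃ l', BadPath step c (v :: l') ∧ ∀ x ∈ v :: l', x ∈ V := by
  by_cases hmem : v ∈ u :: l
  · obtain ⟨l₁, l₂, h⟩ := List.append_of_mem hmem
    refine ⟨l₂, hl.of_suffix ⟨l₁, h.symm⟩ (by simp), fun x hx => hlV x ?_⟩
    rw [h]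
    exact List.mem_append_right _ hx
  · refine ⟨u :: l, .cons hl hs fun w hw hle => ?_, ?_⟩
    · have := hV w (hlV w hw) v hv hle
      exact hmem (this ▸ hw)
    · intro x hx
      rcases List.mem_cons.1 hx with rfl | hx
      · exact hv
      · exact hlV x hx

end BadPaths

section Core

variable {ι : Type} {T : Set (Trans ι)}

/-- Steps of the projected net. -/
def PStep (T : Set (Trans ι)) (J : Finset ι) (u v : ι → ℕ) : Prop :=
  ∃ t ∈ T, ∃ z, u = z + resHom J t.1 ∧ v = z + resHom J t.2

theorem finite_pstep (hT : T.Finite) (J : Finset ι) (u : ι → ℕ) : {v | PStep T J u v}.Finite := by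
  refine (hT.image fun t => u - resHom J t.1 + resHom J t.2).subset ?_
  rintro v ⟨t, ht, z, rfl, rfl⟩
  exact ⟨t, ht, by simp⟩

/-- The vertices that loop-free antichain walks from `c` can visit in the projected net. -/
def badVertices (T : Set (Trans ι)) (c : ι → ℕ) (J : Finset ι) : Set (ι → ℕ) :=
  {v | ∃ l, BadPath (PStep T J) (resHom J c) (v :: l)}

theorem finite_badVertices [Finite ι] (hT : T.Finite) (c : ι → ℕ) (J : Finset ι) :
    (badVertices T c J).Finite := finite_badPath (finite_pstep hT J)

theorem Walk.start_mem {J : Finset ι} {V : Set (ι → ℕ)} {u v : ι → ℕ} {l}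
    (h : Walk T (resHom J) u l v) (hl : ∀ p ∈ l, p.1 ∈ V) (hv : v ∈ V) : u ∈ V := by
  cases h with
  | nil => exact hv
  | cons ht h => exact hl _ (List.mem_cons_self ..)

theorem Walk.mem_badVertices {c : ι → ℕ} {J : Finset ι} {V : Set (ι → ℕ)}
    (hV : ∀ x ∈ V, ∀ y ∈ V, x ≤ y → x = y) {u v : ι → ℕ} {l}
    (h : Walk T (resHom J) u l v) (hl : ∀ p ∈ l, p.1 ∈ V) (hv : v ∈ V)
    (hu : ∃ l', BadPath (PStep T J) (resHom J c) (u :: l') ∧ ∀ x ∈ u :: l', x ∈ V) :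
    ∀ p ∈ l, p.1 ∈ badVertices T c J := by
  induction h with
  | nil => simp
  | @cons t z l v ht h ih =>
    intro p hp
    obtain ⟨l', hl', hl'V⟩ := hu
    have hl2 : ∀ p ∈ l, p.1 ∈ V := fun p hp => hl p (List.mem_cons_of_mem _ hp)
    rcases List.mem_cons.1 hp with rfl | hp
    · exact ⟨l', hl'⟩
    · exact ih hl2 hv (exists_badPath_of_antichain hV hl' hl'V ⟨_, ht, _, rfl, rfl⟩
        (h.start_mem hl2 hv)) p hp

theorem exists_list_replicate {α : Type*} (B : Finset α) (e : α → ℕ) :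
    ∃ W : List α, (∀ w ∈ W, w ∈ B) ∧ ∀ f : α → ι → ℕ, (W.map f).sum = ∑ w ∈ B, e w • f w := by
  classical
  induction B using Finset.induction_on with
  | empty => exact ⟨[], by simp⟩
  | insert a B ha ih =>
    obtain ⟨W, hW, hf⟩ := ih
    refine ⟨List.replicate (e a) a ++ W, ?_, fun f => ?_⟩
    · intro w hw
      rcases List.mem_append.1 hw with hw | hw
      · simp [(List.mem_replicate.1 hw).2]
      · simp [hW w hw]
    · rw [List.map_append, List.sum_append, hf, Finset.sum_insert ha]
      simp

variable [Fintype ι]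

/-- Iterating a closed walk of the projected net, exchanging multiples of `h₁` for `h₂`. -/
theorem exists_nsmul_mem_prodRel {c h₁ h₂ : ι → ℕ} {J : Finset ι} {l}
    (hl : Walk T (resHom J) (resHom J c) l (resHom J c))
    (hd : preSum l + h₂ = postSum l + h₁)
    (h1J : ∀ i ∈ J, h₁ i = 0) (h2J : ∀ i ∈ J, h₂ i = 0)
    (h1 : ∀ i ∉ J, 1 ≤ h₁ i) (h2 : ∀ i ∉ J, 1 ≤ h₂ i) :
    ∃ k : ℕ, 1 ≤ k ∧ (k • h₁, k • h₂) ∈ prodRel T c := by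
  set k := (∑ i, preSum l i) + 1 with hk
  have hki : ∀ i, preSum l i ≤ k := fun i =>
    (Finset.single_le_sum (f := preSum l) (fun _ _ => Nat.zero_le _) (Finset.mem_univ i)).trans
      (Nat.le_succ _)
  have key : ∀ j ≤ k, NReach T (c + k • h₁) (c + ((k - j) • h₁ + j • h₂)) := by
    intro j
    induction j with
    | zero => intro _; simpa using NReach.refl
    | succ j ih =>
      intro hj
      refine (ih (by omega)).trans ?_
      obtain ⟨y, hy, hyd⟩ := hl.fire (c + ((k - j) • h₁ + j • h₂)) (by
        ext i
        by_cases hi : i ∈ J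
        · simp [resHom_apply_mem hi, h1J i hi, h2J i hi]
        · simp [resHom_apply_notMem hi]) (by
        intro i hi
        have e1 := h1 i hi
        have e2 := h2 i hi
        have e3 := hki i
        simp only [Pi.add_apply, Pi.smul_apply, smul_eq_mul]
        have : (k - j) + j ≤ (k - j) * h₁ i + j * h₂ i :=
          Nat.add_le_add (Nat.le_mul_of_pos_right _ e1) (Nat.le_mul_of_pos_right _ e2)
        omega)
      convert hy using 1
      obtain ⟨n, hn⟩ : ∃ n, k - j = n + 1 := ⟨k - j - 1, by omega⟩
      have hn' : k - (j + 1) = n := by omega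
      rw [hn] at hyd
      rw [hn']
      ext i
      have e1 := congrFun hd i
      have e2 := congrFun hyd i
      simp only [Pi.add_apply, Pi.smul_apply, smul_eq_mul, Nat.add_mul, one_mul] at e1 e2 ⊢
      omega
  refine ⟨k, Nat.succ_pos _, ?_⟩
  have := key k le_rfl
  rw [mem_prodRel]
  simpa using this

theorem exists_cone_prodRel (hT : T.Finite) {c r s : ι → ℕ} (hrs : (r, s) ∈ prodRel T c) :
    ∃ (J : Finset ι) (B : Finset (List ((ι → ℕ) × Trans ι))),
      (∀ w ∈ B, w.length ≤ (finite_badVertices hT c J).toFinset.card ∧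
        ∀ p ∈ w, p.1 ∈ badVertices T c J ∧ p.2 ∈ T) ∧
      (∃ m : ℕ, 1 ≤ m ∧ ∃ n : List ((ι → ℕ) × Trans ι) → ℕ, (∀ w ∈ B, 1 ≤ n w) ∧
        m • s + ∑ w ∈ B, n w • preSum w = m • r + ∑ w ∈ B, n w • postSum w) ∧
      ∀ r' s' : ι → ℕ, (∀ i, r' i = 0 ↔ r i = 0) → (∀ i, s' i = 0 ↔ s i = 0) →
        (∃ m : ℕ, 1 ≤ m ∧ ∃ n : List ((ι → ℕ) × Trans ι) → ℕ, (∀ w ∈ B, 1 ≤ n w) ∧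
          m • s' + ∑ w ∈ B, n w • preSum w = m • r' + ∑ w ∈ B, n w • postSum w) →
        ∃ k : ℕ, 1 ≤ k ∧ (k • r', k • s') ∈ prodRel T c := by
  classical
  -- intermediate increments of maximal support
  set 𝓗 : Set (Finset ι) := {I | ∃ (M : ℕ) (h : ι → ℕ), 1 ≤ M ∧ (M • r, h) ∈ prodRel T c ∧
    (h, M • s) ∈ prodRel T c ∧ I = Finset.univ.filter (fun i => h i ≠ 0)} with h𝓗
  have hdiag : ∀ x, (x, x) ∈ prodRel T c := fun x => NReach.refl
  have hne : 𝓗.Nonempty := ⟨_, 1, r, le_rfl, by simpa using hdiag r, by simpa using hrs, rfl⟩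
  obtain ⟨I, ⟨⟨M, h, hM, hrh, hhs, hI⟩, hImax⟩⟩ := (Set.toFinite 𝓗).exists_maximal hne
  set J := Iᶜ with hJ
  have hJmem : ∀ i, i ∉ J ↔ h i ≠ 0 := by intro i; simp [hJ, hI]
  have hmax : ∀ (M' : ℕ) (h' : ι → ℕ), 1 ≤ M' → (M' • r, h') ∈ prodRel T c →
      (h', M' • s) ∈ prodRel T c → ∀ i ∈ J, h' i = 0 := by
    intro M' h' hM' h1 h2 i hi
    have hmem : Finset.univ.filter (fun i => (h + h') i ≠ 0) ∈ 𝓗 := by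
      refine ⟨M + M', h + h', by omega, ?_, ?_, rfl⟩
      · rw [add_smul]; exact (prodRel T c).add_mem hrh h1
      · rw [add_smul]; exact (prodRel T c).add_mem hhs h2
    have hle := hImax hmem (by
      intro j hj
      rw [hI] at hj
      simp only [Finset.mem_filter, Finset.mem_univ, true_and] at hj ⊢
      simp only [Pi.add_apply]
      omega)
    by_contra hcon
    have : i ∈ I := hle (by
      simp only [Finset.mem_filter, Finset.mem_univ, true_and, Pi.add_apply]
      omega)
    simp [hJ, this] at hi
  have hr0 : ∀ i ∈ J, r i = 0 :=
    hmax 1 r le_rfl (by simpa using hdiag r) (by simpa using hrs)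
  have hs0 : ∀ i ∈ J, s i = 0 :=
    hmax 1 s le_rfl (by simpa using hrs) (by simpa using hdiag s)
  have hJ0 : ∀ i ∈ J, h i = 0 := hmax M h hM hrh hhs
  -- visited vertices are pairwise incomparable
  set V : Set (ι → ℕ) := {u | ∃ x, u = resHom J x ∧ NReach T (c + M • r) x ∧
    NReach T x (c + M • s)} with hVdef
  have hV : ∀ x ∈ V, ∀ y ∈ V, x ≤ y → x = y := by
    rintro _ ⟨x₁, rfl, ha, hb⟩ _ ⟨x₂, rfl, ha', hb'⟩ hle
    set K := ∑ i, x₁ i with hK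
    have hle' : x₁ ≤ x₂ + K • h := by
      intro i
      simp only [Pi.add_apply, Pi.smul_apply, smul_eq_mul]
      by_cases hi : i ∈ J
      · have h1 : resHom J x₁ i ≤ resHom J x₂ i := hle i
        rw [resHom_apply_mem hi, resHom_apply_mem hi] at h1
        exact h1.trans (Nat.le_add_right _ _)
      · have h1 : x₁ i ≤ K :=
          Finset.single_le_sum (f := x₁) (fun _ _ => Nat.zero_le _) (Finset.mem_univ i)
        have h2 : K ≤ K * h i := Nat.le_mul_of_pos_right _ (Nat.pos_of_ne_zero ((hJmem i).1 hi))
        omega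
    obtain ⟨δ, hδ⟩ := exists_add_of_le hle'
    have hKr := (prodRel T c).nsmul_mem hrh K
    have hKs := (prodRel T c).nsmul_mem hhs K
    have A1 : NReach T (c + (M + K * M) • r) (x₂ + K • h) := by
      refine ((NReach.add_right hKr (M • r)).congr ?_ rfl).trans
        ((NReach.add_right ha' (K • h)).congr ?_ rfl)
      · simp only [Prod.smul_mk, add_smul, mul_smul]; ac_rfl
      · simp only [Prod.smul_mk]; ac_rfl
    have A2 : NReach T (x₂ + K • h) (c + (M + K * M) • s) := by
      refine ((NReach.add_right hb' (K • h)).congr rfl ?_).trans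
        ((NReach.add_right hKs (M • s)).congr rfl ?_)
      · simp only [Prod.smul_mk]; ac_rfl
      · rw [add_smul, mul_smul]; simp only [Prod.smul_mk]; ac_rfl
    rw [hδ] at A1 A2
    have B1 : (((M + K * M) + M) • r, δ + M • r + M • s) ∈ prodRel T c := by
      rw [mem_prodRel]
      refine ((NReach.add_right A1 (M • r)).congr ?_ rfl).trans
        ((NReach.add_right hb (δ + M • r)).congr ?_ ?_)
      · rw [add_smul]; ac_rfl
      · ac_rfl
      · ac_rfl
    have B2 : (δ + M • r + M • s, ((M + K * M) + M) • s) ∈ prodRel T c := by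
      rw [mem_prodRel]
      refine ((NReach.add_right ha (δ + M • s)).congr ?_ rfl).trans
        ((NReach.add_right A2 (M • s)).congr ?_ ?_)
      · ac_rfl
      · ac_rfl
      · rw [add_smul _ M]; ac_rfl
    have hδ0 := hmax _ _ (by omega) B1 B2
    ext i
    by_cases hi : i ∈ J
    · have h1 := hδ0 i hi
      have h2 := congrFun hδ i
      have h3 := hJ0 i hi
      simp only [Pi.add_apply, Pi.smul_apply, smul_eq_mul, h3, mul_zero] at h1 h2
      rw [resHom_apply_mem hi, resHom_apply_mem hi]
      omega
    · rw [resHom_apply_notMem hi, resHom_apply_notMem hi]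
  -- the run through `h`, projected to a closed walk
  obtain ⟨l₁, hl₁⟩ := exists_walk_of_reach hrh
  obtain ⟨l₂, hl₂⟩ := exists_walk_of_reach hhs
  have hl := hl₁.append hl₂
  set l := l₁ ++ l₂
  have hdisp := hl.displacement
  have hresr : resHom J (c + M • r) = resHom J c := by
    ext i
    by_cases hi : i ∈ J
    · simp [resHom_apply_mem hi, hr0 i hi]
    · simp [resHom_apply_notMem hi]
  have hress : resHom J (c + M • s) = resHom J c := by
    ext i
    by_cases hi : i ∈ J
    · simp [resHom_apply_mem hi, hs0 i hi]
    · simp [resHom_apply_notMem hi]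
  have hreach : NReach T (c + M • r) (c + M • s) := hl.reach
  have hp := hl.map (resHom J)
  rw [hresr, hress] at hp
  have hcV : resHom J c ∈ V := ⟨_, hresr.symm, .refl, hreach⟩
  have hlV : ∀ p ∈ l.map (fun p => (resHom J p.1, p.2)), p.1 ∈ V := by
    intro p hp
    obtain ⟨q, hq, rfl⟩ := List.mem_map.1 hp
    obtain ⟨m₁, m₂, hm⟩ := List.append_of_mem hq
    rw [hm] at hl
    exact ⟨q.1, rfl, hl.split.1.reach, hl.split.2.reach⟩
  have hlU := hp.mem_badVertices (c := c) hV hlV hcV ⟨[], .base, by simpa using hcV⟩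
  obtain ⟨W, hW, hWpre, hWpost⟩ := hp.decompose (finite_badVertices hT c J).toFinset
    (fun p hp => (finite_badVertices hT c J).mem_toFinset.2 (hlU p hp))
  set B := W.toFinset with hB
  set d : List ((ι → ℕ) × Trans ι) → ℕ := fun w => W.count w with hd
  have hsumpre : preSum l = ∑ w ∈ B, d w • preSum w := by
    rw [← preSum_map (resHom J), hWpre, Finset.sum_list_map_count]
    simp only [hd, hB]
    congr!
  have hsumpost : postSum l = ∑ w ∈ B, d w • postSum w := by
    rw [← postSum_map (resHom J), hWpost, Finset.sum_list_map_count]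
    simp only [hd, hB]
    congr!
  have hdpos : ∀ w ∈ B, 1 ≤ d w := fun w hw => List.count_pos_iff.2 (List.mem_toFinset.1 hw)
  have hdeq : M • s + ∑ w ∈ B, d w • preSum w = M • r + ∑ w ∈ B, d w • postSum w := by
    rw [← hsumpre, ← hsumpost]
    have : c + M • r + postSum l = c + M • s + preSum l := hdisp
    rw [add_assoc, add_assoc] at this
    exact (add_left_cancel this).symm
  refine ⟨J, B, ?_, ⟨M, hM, d, hdpos, hdeq⟩, ?_⟩
  · intro w hw
    obtain ⟨h1, h2, -⟩ := hW w (List.mem_toFinset.1 hw)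
    exact ⟨h1, fun p hp => ⟨(finite_badVertices hT c J).mem_toFinset.1 (h2 p hp).1, (h2 p hp).2⟩⟩
  rintro r' s' hr' hs' ⟨m₀, hm₀, n₀, hn₀, heq⟩
  set L := M * ∑ i, r i + M * ∑ i, s i + 2 * ∑ w ∈ B, d w + 1 with hL
  have hle : ∀ (x x' : ι → ℕ), (∀ i, x' i = 0 ↔ x i = 0) → M * ∑ i, x i ≤ L →
      M • x ≤ (L * m₀) • x' := by
    intro x x' hx hxL i
    simp only [Pi.smul_apply, smul_eq_mul]
    by_cases h0 : x i = 0
    · simp [h0]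
    · have h1 : 1 ≤ x' i := Nat.pos_of_ne_zero fun h => h0 ((hx i).1 h)
      have h2 : x i ≤ ∑ i, x i :=
        Finset.single_le_sum (f := x) (fun _ _ => Nat.zero_le _) (Finset.mem_univ i)
      calc M * x i ≤ M * ∑ i, x i := Nat.mul_le_mul_left _ h2
        _ ≤ L := hxL
        _ ≤ L * m₀ * x' i := by
          rw [mul_assoc]; exact Nat.le_mul_of_pos_right _ (Nat.mul_pos hm₀ h1)
  obtain ⟨a, ha⟩ := exists_add_of_le (hle r r' hr' (by omega))
  obtain ⟨b, hb⟩ := exists_add_of_le (hle s s' hs' (by omega))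
  set e : List ((ι → ℕ) × Trans ι) → ℕ := fun w => L * n₀ w - 2 * d w with he
  have hen : ∀ w ∈ B, L * n₀ w = e w + 2 * d w := by
    intro w hw
    have h1 : d w ≤ ∑ w ∈ B, d w := Finset.single_le_sum (fun _ _ => Nat.zero_le _) hw
    have h2 : L ≤ L * n₀ w := Nat.le_mul_of_pos_right _ (hn₀ w hw)
    simp only [he]
    omega
  have hsplit : ∀ f : List ((ι → ℕ) × Trans ι) → ι → ℕ,
      L • ∑ w ∈ B, n₀ w • f w = ∑ w ∈ B, e w • f w + 2 • ∑ w ∈ B, d w • f w := by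
    intro f
    rw [Finset.smul_sum, Finset.smul_sum, ← Finset.sum_add_distrib]
    refine Finset.sum_congr rfl fun w hw => ?_
    rw [← mul_smul, ← mul_smul, ← add_smul, hen w hw]
  obtain ⟨W', hW', hWsum⟩ := exists_list_replicate (ι := ι) B e
  obtain ⟨μ, hμ, hμpre, hμpost⟩ := hp.insert W' (fun w hw =>
    (hW w (List.mem_toFinset.1 (hW' w hw))).2.2)
  rw [preSum_map, hWsum, hsumpre] at hμpre
  rw [postSum_map, hWsum, hsumpost] at hμpost
  have ha0 : ∀ i ∈ J, a i = 0 := by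
    intro i hi
    have h1 := congrFun ha i
    simp only [Pi.smul_apply, Pi.add_apply, hr0 i hi, (hr' i).2 (hr0 i hi), smul_eq_mul, mul_zero] at h1
    omega
  have hb0 : ∀ i ∈ J, b i = 0 := by
    intro i hi
    have h1 := congrFun hb i
    simp only [Pi.smul_apply, Pi.add_apply, hs0 i hi, (hs' i).2 (hs0 i hi), smul_eq_mul, mul_zero] at h1
    omega
  obtain ⟨k, hk, hkmem⟩ := exists_nsmul_mem_prodRel (h₁ := h + a) (h₂ := h + b) hμ (by
      have h1 := congrArg (L • ·) heq
      simp only [smul_add, hsplit, ← mul_smul] at h1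
      rw [hμpre, hμpost]
      ext i
      have e1 := congrFun h1 i
      have e2 := congrFun ha i
      have e3 := congrFun hb i
      have e4 := congrFun hdeq i
      simp only [Pi.add_apply, Pi.smul_apply (2 : ℕ), smul_eq_mul] at e1 e2 e3 e4 ⊢
      simp only [Pi.smul_apply _ r, Pi.smul_apply _ s] at e1 e2 e3 e4 ⊢
      omega)
    (fun i hi => by simp [hJ0 i hi, ha0 i hi]) (fun i hi => by simp [hJ0 i hi, hb0 i hi])
    (fun i hi => by have := (hJmem i).1 hi; simp only [Pi.add_apply]; omega)
    (fun i hi => by have := (hJmem i).1 hi; simp only [Pi.add_apply]; omega)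
  refine ⟨k * (L * m₀), Nat.mul_pos hk (Nat.mul_pos (Nat.succ_pos _) hm₀), ?_⟩
  have h1 : ((L * m₀) • r', h + a) ∈ prodRel T c := by
    rw [ha]; exact prodRel_add hrh
  have h2 : (h + b, (L * m₀) • s') ∈ prodRel T c := by
    rw [hb]; exact prodRel_add hhs
  have h1' := (prodRel T c).nsmul_mem h1 k
  have h2' := (prodRel T c).nsmul_mem h2 k
  rw [mul_smul k _ r', mul_smul k _ s']
  exact prodRel_trans (prodRel_trans h1' hkmem) h2'

end Core

section ConeProdRel

theorem Set.Finite.lists_le {α : Type*} {s : Set α} (hs : s.Finite) (n : ℕ) :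
    {l : List α | l.length ≤ n ∧ ∀ x ∈ l, x ∈ s}.Finite := by
  have : Finite s := hs
  refine ((List.finite_length_le s n).image (List.map Subtype.val)).subset ?_
  rintro l ⟨hl, hs⟩
  exact ⟨l.pmap Subtype.mk hs, by simpa using hl, by simp [List.map_pmap]⟩

variable {ι : Type} {T : Set (Trans ι)}

theorem sum_smul_single [DecidableEq ι] (R : Finset ι) (x : R → ℕ) (i : ι) :
    (∑ j : R, x j • (Pi.single j.1 1 : ι → ℕ)) i = if h : i ∈ R then x ⟨i, h⟩ else 0 := by
  rw [Finset.sum_apply]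
  simp only [Pi.smul_apply, Pi.single_apply, smul_eq_mul, mul_ite, mul_one, mul_zero]
  split_ifs with h
  · rw [Finset.sum_eq_single ⟨i, h⟩]
    · simp
    · intro b _ hb
      rw [if_neg]
      rintro rfl
      exact hb rfl
    · simp
  · refine Finset.sum_eq_zero fun b _ => if_neg ?_
    rintro rfl
    exact h b.2

variable [Fintype ι]

/-- Pairs of increments of prescribed supports whose difference is a positive rational combination
of the effects of the closed walks in `B`. -/
def walkCone (R S : Finset ι) (B : Finset (List ((ι → ℕ) × Trans ι))) :
    Set ((ι → ℕ) × (ι → ℕ)) :=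
  {v | (∀ i, v.1 i ≠ 0 ↔ i ∈ R) ∧ (∀ i, v.2 i ≠ 0 ↔ i ∈ S) ∧ ∃ m : ℕ, 1 ≤ m ∧
    ∃ n : List ((ι → ℕ) × Trans ι) → ℕ, (∀ w ∈ B, 1 ≤ n w) ∧
      m • v.2 + ∑ w ∈ B, n w • preSum w = m • v.1 + ∑ w ∈ B, n w • postSum w}

theorem isFinCones_walkCone (R S : Finset ι) (B : Finset (List ((ι → ℕ) × Trans ι))) :
    IsFinCones (walkCone R S B) := by
  classical
  convert isFinCones_positive_solutions (κ := R ⊕ S ⊕ B)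
    (combHom (Sum.elim (fun _ => 0) (Sum.elim (fun i => Pi.single i.1 1) (fun w => preSum w.1))))
    (combHom (Sum.elim (fun i => Pi.single i.1 1) (Sum.elim (fun _ => 0) (fun w => postSum w.1))))
    (combHom (Sum.elim (fun i => ((Pi.single i.1 1 : ι → ℕ), (0 : ι → ℕ)))
      (Sum.elim (fun i => (0, Pi.single i.1 1)) (fun _ => 0)))) using 1
  ext ⟨v₁, v₂⟩
  simp only [walkCone, Set.mem_ofPred_eq, combHom_apply, Fintype.sum_sum_type, Sum.elim_inl,
    Sum.elim_inr, smul_zero, Finset.sum_const_zero, zero_add, add_zero, Prod.smul_mk,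
    ← Prod.mk_zero_zero, ← prod_mk_sum, Prod.mk.injEq]
  constructor
  · rintro ⟨h1, h2, m, hm, n, hn, heq⟩
    have e1 : m • v₁ = ∑ i : R, (m * v₁ i.1) • (Pi.single i.1 1 : ι → ℕ) := by
      ext i
      rw [sum_smul_single R (fun i => m * v₁ i.1)]
      by_cases h : i ∈ R
      · simp [h]
      · simp [h, not_not.1 (mt (h1 i).1 h)]
    have e2 : m • v₂ = ∑ i : S, (m * v₂ i.1) • (Pi.single i.1 1 : ι → ℕ) := by
      ext i
      rw [sum_smul_single S (fun i => m * v₂ i.1)]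
      by_cases h : i ∈ S
      · simp [h]
      · simp [h, not_not.1 (mt (h2 i).1 h)]
    refine ⟨m, hm, Sum.elim (fun i => m * v₁ i.1) (Sum.elim (fun i => m * v₂ i.1)
      (fun w => n w.1)), ?_, ?_, ?_, ?_⟩
    · rintro (i | i | w)
      · exact Nat.mul_pos hm (Nat.pos_of_ne_zero ((h1 _).2 i.2))
      · exact Nat.mul_pos hm (Nat.pos_of_ne_zero ((h2 _).2 i.2))
      · exact hn _ w.2
    · simp only [Sum.elim_inl, Sum.elim_inr]
      rw [← e1, ← e2, Finset.sum_coe_sort B fun w => n w • preSum w,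
        Finset.sum_coe_sort B fun w => n w • postSum w, heq]
    · simpa only [Sum.elim_inl, Sum.elim_inr] using e1
    · simpa only [Sum.elim_inl, Sum.elim_inr] using e2
  · rintro ⟨m, hm, x, hx, heq, e1, e2⟩
    refine ⟨fun i => ?_, fun i => ?_, m, hm,
      fun w => if h : w ∈ B then x (.inr (.inr ⟨w, h⟩)) else 0, ?_, ?_⟩
    · have h := congrFun e1 i
      rw [sum_smul_single R (fun i => x (.inl i))] at h
      simp only [Pi.smul_apply, smul_eq_mul] at h
      split_ifs at h with hi
      · have h3 := hx (.inl ⟨i, hi⟩)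
        simp only [hi, iff_true]
        intro h4
        rw [h4] at h
        omega
      · simp only [hi, iff_false, not_not]
        rcases Nat.mul_eq_zero.1 h with h | h
        · omega
        · exact h
    · have h := congrFun e2 i
      rw [sum_smul_single S (fun i => x (.inr (.inl i)))] at h
      simp only [Pi.smul_apply, smul_eq_mul] at h
      split_ifs at h with hi
      · have h3 := hx (.inr (.inl ⟨i, hi⟩))
        simp only [hi, iff_true]
        intro h4
        rw [h4] at h
        omega
      · simp only [hi, iff_false, not_not]
        rcases Nat.mul_eq_zero.1 h with h | h
        · omega
        · exact h
    · intro w hw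
      simpa [hw] using hx _
    · rw [← e1, ← e2] at heq
      rw [← Finset.sum_coe_sort B, ← Finset.sum_coe_sort B]
      simpa using heq

theorem definableCone_prodRel (hT : T.Finite) (c : ι → ℕ) : DefinableCone (prodRel T c) := by
  classical
  set 𝓑 : Set (List ((ι → ℕ) × Trans ι)) := {w | ∃ J : Finset ι,
    w.length ≤ (finite_badVertices hT c J).toFinset.card ∧
      ∀ p ∈ w, p.1 ∈ badVertices T c J ∧ p.2 ∈ T}
  have h𝓑 : 𝓑.Finite := by
    refine (Set.finite_iUnion fun J : Finset ι => Set.Finite.lists_le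
      ((finite_badVertices hT c J).prod hT) (finite_badVertices hT c J).toFinset.card).subset ?_
    rintro w ⟨J, h1, h2⟩
    exact Set.mem_iUnion.2 ⟨J, h1, h2⟩
  have key : satur (prodRel T c) = ⋃ k : Finset ι × Finset ι × h𝓑.toFinset.powerset,
      if walkCone k.1 k.2.1 k.2.2.1 ⊆ satur (prodRel T c) then walkCone k.1 k.2.1 k.2.2.1
        else ∅ := by
    ext ⟨r, s⟩
    simp only [Set.mem_iUnion]
    constructor
    · rintro ⟨m, hm, hmem⟩
      obtain ⟨J, B, hB, ⟨m', hm', n, hn, heq⟩, hall⟩ := exists_cone_prodRel hT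
        (r := m • r) (s := m • s) hmem
      have h0 : ∀ (x : ι → ℕ) i, (m • x) i ≠ 0 ↔ x i ≠ 0 := by
        intro x i
        simp only [Pi.smul_apply, smul_eq_mul, ne_eq, Nat.mul_eq_zero, not_or]
        exact ⟨fun h => h.2, fun h => ⟨by omega, h⟩⟩
      have hsub : walkCone (Finset.univ.filter fun i => r i ≠ 0)
          (Finset.univ.filter fun i => s i ≠ 0) B ⊆ satur (prodRel T c) := by
        rintro ⟨r', s'⟩ ⟨h1, h2, h3⟩
        refine hall r' s' (fun i => not_iff_not.1 ?_) (fun i => not_iff_not.1 ?_) h3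
        · rw [← ne_eq, ← ne_eq, h0, h1]; simp
        · rw [← ne_eq, ← ne_eq, h0, h2]; simp
      refine ⟨(Finset.univ.filter fun i => r i ≠ 0, Finset.univ.filter fun i => s i ≠ 0, ⟨B, ?_⟩), ?_⟩
      · rw [Finset.mem_powerset]
        intro w hw
        rw [Set.Finite.mem_toFinset]
        exact ⟨J, hB w hw⟩
      · rw [if_pos hsub]
        refine ⟨by simp, by simp, m' * m, Nat.mul_pos hm' hm, n, hn, ?_⟩
        simpa only [mul_smul] using heq
    · rintro ⟨k, hk⟩
      split_ifs at hk with h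
      · exact h hk
      · exact hk.elim
  unfold DefinableCone
  rw [key]
  refine .iUnion fun k => ?_
  split_ifs
  · exact isFinCones_walkCone _ _ _
  · exact .empty

end ConeProdRel

section Amalgamation

variable {ι : Type} {T : Set (Trans ι)}

/-- Pairs of increments that can be added to the endpoints of a run visiting the given
configurations. -/
def chainRel (T : Set (Trans ι)) (y : ι → ℕ) :
    List ((ι → ℕ) × Trans ι) → AddSubmonoid ((ι → ℕ) × (ι → ℕ))
  | [] => prodRel T y
  | p :: l => compRel (prodRel T p.1) (chainRel T y l)

theorem definableCone_chainRel [Fintype ι] (hT : T.Finite) (y : ι → ℕ) (l) :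
    DefinableCone (chainRel T y l) := by
  induction l with
  | nil => exact definableCone_prodRel hT y
  | cons p l ih => exact (definableCone_prodRel hT p.1).compRel ih

theorem reach_of_mem_chainRel {x y ε δ : ι → ℕ} {l} (h : Walk T (AddMonoidHom.id _) x l y)
    (hm : (ε, δ) ∈ chainRel T y l) : NReach T (x + ε) (y + δ) := by
  induction h generalizing ε with
  | nil => exact hm
  | @cons t z l v ht h ih =>
    obtain ⟨η, h1, h2⟩ := hm
    refine NReach.trans h1 ((NReach.trans ?_ (ih h2)))
    exact .single ⟨t, ht, z + η, by simp only [AddMonoidHom.id_apply]; ac_rfl,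
      by simp only [AddMonoidHom.id_apply]; ac_rfl⟩

theorem chainRel_absorb {x y u v d : ι → ℕ} {l} (h : Walk T (AddMonoidHom.id _) x l y)
    (huv : (u, v) ∈ prodRel T x) (hv : (v, d) ∈ chainRel T y l) : (u, d) ∈ chainRel T y l := by
  cases h with
  | nil => exact prodRel_trans huv hv
  | cons ht h =>
    obtain ⟨η, h1, h2⟩ := hv
    exact ⟨η, prodRel_trans huv h1, h2⟩

/-- The order on steps of a run used to compare runs. -/
def stepLE (p q : (ι → ℕ) × Trans ι) : Prop := p.1 ≤ q.1 ∧ p.2 = q.2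

theorem exists_mem_chainRel {x y x' d : ι → ℕ} {l l'} (h : Walk T (AddMonoidHom.id _) x l y)
    (h' : Walk T (AddMonoidHom.id _) x' l' (y + d)) (hll : List.SublistForall₂ stepLE l l') :
    ∃ v, NReach T x' (x + v) ∧ (v, d) ∈ chainRel T y l := by
  induction hll generalizing x x' with
  | nil =>
    cases h
    exact ⟨d, h'.reach, NReach.refl⟩
  | @cons p q l l' hpq hll ih =>
    obtain ⟨hle, heq⟩ := hpq
    cases h with
    | @cons t z _ _ ht h =>
    cases h' with
    | @cons t' z' _ _ ht' h' =>
    simp only at heq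
    subst heq
    obtain ⟨v, hv⟩ := exists_add_of_le hle
    simp only [AddMonoidHom.id_apply] at hv h h' ⊢
    have hz : z' = z + v := by
      rw [add_right_comm] at hv
      exact add_right_cancel hv
    subst hz
    obtain ⟨u, hu1, hu2⟩ := ih h h'
    refine ⟨v, ?_, v, NReach.refl, chainRel_absorb h (hu1.congr ?_ rfl) hu2⟩
    · exact NReach.refl.congr rfl (by ac_rfl)
    · ac_rfl
  | @cons_right q l l' hll ih =>
    cases h' with
    | @cons t' z' _ _ ht' h' =>
    obtain ⟨u, hu1, hu2⟩ := ih h h'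
    exact ⟨u, NReach.trans (.single ⟨t', ht', z', rfl, rfl⟩) hu1, hu2⟩

theorem mem_chainRel {x y ε δ : ι → ℕ} {l l'} (h : Walk T (AddMonoidHom.id _) x l y)
    (h' : Walk T (AddMonoidHom.id _) (x + ε) l' (y + δ))
    (hll : List.SublistForall₂ stepLE l l') : (ε, δ) ∈ chainRel T y l := by
  obtain ⟨v, h1, h2⟩ := exists_mem_chainRel h h' hll
  exact chainRel_absorb h h1 h2

theorem exists_finset_basis {α : Type*} {r : α → α → Prop} {s : Set α}
    (h : s.PartiallyWellOrderedOn r) : ∃ B : Finset α, (∀ b ∈ B, b ∈ s) ∧ ∀ x ∈ s, ∃ b ∈ B, r b x := by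
  by_contra! hcon
  obtain ⟨f, hf, hf'⟩ := exists_seq_of_forall_finset_exists (· ∈ s) (fun x y => ¬ r x y)
    (fun B hB => hcon B hB)
  obtain ⟨m, n, hmn, hr⟩ := Set.partiallyWellOrderedOn_iff_exists_lt.1 h f hf
  exact hf' m n hmn hr

instance : IsPreorder ((ι → ℕ) × Trans ι) stepLE where
  refl _ := ⟨le_rfl, rfl⟩
  trans _ _ _ h h' := ⟨h.1.trans h'.1, h.2.trans h'.2⟩

theorem partiallyWellOrderedOn_steps [Finite ι] (hT : T.Finite) :
    {l : List ((ι → ℕ) × Trans ι) | ∀ p ∈ l, p.2 ∈ T}.PartiallyWellOrderedOn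
      (List.SublistForall₂ stepLE) := by
  have h1 : (Set.univ : Set (ι → ℕ)).PartiallyWellOrderedOn (· ≤ ·) :=
    Set.partiallyWellOrderedOn_univ_iff.2 wellQuasiOrdered_le
  have h2 : T.PartiallyWellOrderedOn (· = ·) := hT.partiallyWellOrderedOn
  have := Set.PartiallyWellOrderedOn.partiallyWellOrderedOn_sublistForall₂ stepLE (h1.prod h2)
  simpa using this

/-- The intersection of a linear set with the image of a semilinear set under `R` is a finite union
of translates of nice submonoids. -/
def PostDec {M : Type} [AddCommMonoid M] (R : M → M → Prop) : Prop :=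
  ∀ S D : Set M, IsSemilinearSet S → IsLinearSet D → ∃ 𝓟 : Set (M × AddSubmonoid M),
    𝓟.Finite ∧ (∀ p ∈ 𝓟, NiceSubmonoid p.2) ∧
      {y | y ∈ D ∧ ∃ x ∈ S, R x y} = ⋃ p ∈ 𝓟, (fun v => p.1 + v) '' (p.2 : Set M)

theorem addMonoidHom_eq_combHom {M : Type} [AddCommMonoid M] {n : ℕ} (f : (Fin n → ℕ) →+ M) :
    f = combHom fun i => f (Pi.single i 1) := by
  ext i
  simp [Pi.single_apply]

theorem exists_post_decomposition [Fintype ι] (hT : T.Finite) {S D : Set (ι → ℕ)}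
    (hS : IsLinearSet S) (hD : IsLinearSet D) : ∃ 𝓟 : Set ((ι → ℕ) × AddSubmonoid (ι → ℕ)),
    𝓟.Finite ∧ (∀ p ∈ 𝓟, NiceSubmonoid p.2) ∧
      {y | y ∈ D ∧ ∃ x ∈ S, NReach T x y} = ⋃ p ∈ 𝓟, (fun v => p.1 + v) '' (p.2 : Set (ι → ℕ)) := by
  obtain ⟨a, m, f, rfl⟩ := isLinearSet_iff_exists_fin_addMonoidHom.1 hS
  obtain ⟨b, n, g, rfl⟩ := isLinearSet_iff_exists_fin_addMonoidHom.1 hD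
  set X : Set ((Fin m → ℕ) × (Fin n → ℕ) × List ((ι → ℕ) × Trans ι)) :=
    {p | Walk T (AddMonoidHom.id _) (a + f p.1) p.2.2 (b + g p.2.1)} with hX
  have hwqo : X.PartiallyWellOrderedOn (fun p q => p.1 ≤ q.1 ∧ p.2.1 ≤ q.2.1 ∧
      List.SublistForall₂ stepLE p.2.2 q.2.2) := by
    have h1 : (Set.univ : Set (Fin m → ℕ)).PartiallyWellOrderedOn (· ≤ ·) :=
      Set.partiallyWellOrderedOn_univ_iff.2 wellQuasiOrdered_le
    have h2 : (Set.univ : Set (Fin n → ℕ)).PartiallyWellOrderedOn (· ≤ ·) :=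
      Set.partiallyWellOrderedOn_univ_iff.2 wellQuasiOrdered_le
    refine (h1.prod (h2.prod (partiallyWellOrderedOn_steps hT))).mono ?_
    rintro ⟨p, q, l⟩ h
    exact ⟨trivial, trivial, Walk.mem_trans h⟩
  obtain ⟨B, hB, hBX⟩ := exists_finset_basis hwqo
  set P : (Fin m → ℕ) × (Fin n → ℕ) × List ((ι → ℕ) × Trans ι) → AddSubmonoid (ι → ℕ) := fun p =>
    (chainRel T (b + g p.2.1) p.2.2 ⊓ (AddMonoidHom.mrange f).prod (AddMonoidHom.mrange g)).map
      (AddMonoidHom.snd _ _) with hP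
  refine ⟨(fun p => (b + g p.2.1, P p)) '' B, B.finite_toSet.image _, ?_, ?_⟩
  · rintro _ ⟨p, -, rfl⟩
    refine DefinableCone.nice (((definableCone_chainRel hT _ _).inf (.prod ?_ ?_)).map _)
    · rw [addMonoidHom_eq_combHom f]; exact .of_comb _
    · rw [addMonoidHom_eq_combHom g]; exact .of_comb _
  · ext y
    simp only [Set.mem_ofPred_eq, Set.mem_iUnion, Set.mem_image]
    constructor
    · rintro ⟨⟨_, ⟨v, rfl⟩, rfl⟩, x, ⟨_, ⟨u, rfl⟩, rfl⟩, h⟩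
      obtain ⟨l, hl⟩ := exists_walk_of_reach h
      obtain ⟨⟨u₀, v₀, l₀⟩, hb, h1, h2, h3⟩ := hBX (u, v, l) hl
      obtain ⟨u', rfl⟩ := exists_add_of_le h1
      obtain ⟨v', rfl⟩ := exists_add_of_le h2
      refine ⟨_, ⟨_, hb, rfl⟩, g v', ⟨(f u', g v'), ⟨mem_chainRel (hB _ hb) ?_ h3, ⟨u', rfl⟩,
        ⟨v', rfl⟩⟩, rfl⟩, ?_⟩
      · simpa only [vadd_eq_add, map_add, add_assoc] using hl
      · simp only [vadd_eq_add, map_add, add_assoc]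
    · rintro ⟨_, ⟨⟨u₀, v₀, l₀⟩, hb, rfl⟩, _, ⟨⟨ε, δ⟩, ⟨h1, ⟨u, rfl⟩, ⟨v, rfl⟩⟩, rfl⟩, rfl⟩
      refine ⟨⟨_, ⟨v₀ + v, rfl⟩, ?_⟩, _, ⟨_, ⟨u₀ + u, rfl⟩, rfl⟩,
        (reach_of_mem_chainRel (hB _ hb) h1).congr ?_ rfl⟩
      · simp [add_assoc]
      · simp [add_assoc]

theorem postDec_nreach [Fintype ι] (hT : T.Finite) : PostDec (NReach T) := by
  rintro S D ⟨𝓢, h𝓢, hlin, rfl⟩ hD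
  choose! F hF using fun S (hS : S ∈ 𝓢) => exists_post_decomposition hT (hlin S hS) hD
  refine ⟨⋃ S ∈ 𝓢, F S, h𝓢.biUnion fun S hS => (hF S hS).1, ?_, ?_⟩
  · simp only [Set.mem_iUnion]
    rintro p ⟨S, hS, hp⟩
    exact (hF S hS).2.1 p hp
  · ext y
    have hF' : ∀ S ∈ 𝓢, (y ∈ D ∧ ∃ x ∈ S, NReach T x y) ↔
      ∃ p ∈ F S, y ∈ (fun v => p.1 + v) '' (p.2 : Set (ι → ℕ)) := by
      intro S hS
      have := Set.ext_iff.1 (hF S hS).2.2 y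
      simpa only [Set.mem_ofPred_eq, Set.mem_iUnion, exists_prop] using this
    simp only [Set.mem_ofPred_eq, Set.mem_iUnion, exists_prop]
    constructor
    · rintro ⟨hy, x, ⟨S, hS, hx⟩, h⟩
      obtain ⟨p, hp, hyp⟩ := (hF' S hS).1 ⟨hy, x, hx, h⟩
      exact ⟨p, ⟨S, hS, hp⟩, hyp⟩
    · rintro ⟨p, ⟨S, hS, hp⟩, hyp⟩
      obtain ⟨hy, x, hx, h⟩ := (hF' S hS).2 ⟨p, hp, hyp⟩
      exact ⟨hy, x, ⟨S, hS, hx⟩, h⟩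

theorem nreach_swap {x y : ι → ℕ} : NReach (Prod.swap '' T) x y ↔ NReach T y x := by
  have key : ∀ (T : Set (Trans ι)) (x y : ι → ℕ), NReach T x y → NReach (Prod.swap '' T) y x := by
    intro T x y h
    induction h with
    | refl => exact .refl
    | tail _ h ih =>
      obtain ⟨t, ht, z, rfl, rfl⟩ := h
      exact NReach.trans (.single ⟨_, ⟨t, ht, rfl⟩, z, rfl, rfl⟩) ih
  refine ⟨fun h => ?_, key T y x⟩
  have := key _ _ _ h
  rwa [Set.image_image, show (fun t : Trans ι => Prod.swap (Prod.swap t)) = id from rfl,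
    Set.image_id] at this

theorem postDec_nreach_flip [Fintype ι] (hT : T.Finite) : PostDec (flip (NReach T)) := by
  have : flip (NReach T) = NReach (Prod.swap '' T) := by
    ext x y
    exact nreach_swap.symm
  rw [this]
  exact postDec_nreach (hT.image _)

end Amalgamation

section Hulls

open scoped Pointwise

variable {ι : Type} [Fintype ι]

theorem isSemilinearSet_satur_mrange {κ : Type} [Fintype κ] (a : κ → ι → ℕ) :
    IsSemilinearSet {v : ι → ℕ | ∃ m : ℕ, 1 ≤ m ∧ ∃ n : κ → ℕ, m • v = ∑ i, n i • a i} ∧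
    ∃ F : Set (ι → ℕ), F.Finite ∧ ∀ v : ι → ℕ, (∃ m : ℕ, 1 ≤ m ∧ ∃ n : κ → ℕ,
      m • v = ∑ i, n i • a i) → ∃ e ∈ F, ∃ n : κ → ℕ, v = e + ∑ i, n i • a i := by
  classical
  set C := {v : ι → ℕ | ∃ m : ℕ, 1 ≤ m ∧ ∃ n : κ → ℕ, m • v = ∑ i, n i • a i} with hC
  have key : ∀ v ∈ C, ∃ e ∈ C ∩ Set.Iic (∑ i, a i), ∃ n : κ → ℕ, v = e + ∑ i, n i • a i := by
    rintro v ⟨m, hm, n, hn⟩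
    have h1 : m • v = m • (∑ i, (n i / m) • a i) + ∑ i, (n i % m) • a i := by
      rw [hn, Finset.smul_sum, ← Finset.sum_add_distrib]
      refine Finset.sum_congr rfl fun i _ => ?_
      rw [← mul_smul, ← add_smul, Nat.div_add_mod]
    have h2 : ∑ i, (n i / m) • a i ≤ v := by
      intro j
      have h := congrFun h1 j
      simp only [Pi.smul_apply, Pi.add_apply, smul_eq_mul] at h
      exact Nat.le_of_mul_le_mul_left (by omega) hm
    obtain ⟨e, he⟩ := exists_add_of_le h2
    have h3 : m • e = ∑ i, (n i % m) • a i := by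
      rw [he, smul_add] at h1
      exact add_left_cancel h1
    refine ⟨e, ⟨⟨m, hm, _, h3⟩, fun j => ?_⟩, _, he.trans (add_comm _ _)⟩
    have h := congrFun h3 j
    simp only [Pi.smul_apply, smul_eq_mul, Finset.sum_apply] at h
    refine Nat.le_of_mul_le_mul_left ?_ hm
    rw [h, Finset.sum_apply, Finset.mul_sum]
    exact Finset.sum_le_sum fun i _ => Nat.mul_le_mul_right _ (Nat.mod_lt _ hm).le
  have hfin : (C ∩ Set.Iic (∑ i, a i)).Finite := (Set.finite_Iic _).subset Set.inter_subset_right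
  refine ⟨?_, _, hfin, key⟩
  have : C = ⋃ e ∈ C ∩ Set.Iic (∑ i, a i), e +ᵥ (AddMonoidHom.mrange (combHom a) : Set (ι → ℕ)) := by
    ext v
    simp only [Set.mem_iUnion, Set.mem_vadd_set]
    constructor
    · intro hv
      obtain ⟨e, he, n, hn⟩ := key v hv
      exact ⟨e, he, _, ⟨n, rfl⟩, hn.symm⟩
    · rintro ⟨e, ⟨⟨m, hm, n, hn⟩, -⟩, _, ⟨n', rfl⟩, rfl⟩
      refine ⟨m, hm, n + m • n', ?_⟩
      rw [vadd_eq_add, smul_add, hn, combHom_apply, Finset.smul_sum, ← Finset.sum_add_distrib]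
      refine Finset.sum_congr rfl fun i _ => ?_
      simp [add_smul, mul_smul]
  rw [this]
  have hr : (AddMonoidHom.mrange (combHom a)).FG := by
    rw [AddMonoidHom.mrange_eq_map]
    exact (AddMonoid.FG.fg_top (M := κ → ℕ)).map _
  exact .biUnion hfin fun e _ => .vadd _ (IsSemilinearSet.of_fg hr)

/-- Every submonoid of `ℕ^ι` has a finite subset generating the same group. -/
theorem exists_finite_group_generators (P : AddSubmonoid (ι → ℕ)) :
    ∃ (n : ℕ) (p : Fin n → ι → ℕ), (∀ i, p i ∈ P) ∧
      ∀ v ∈ P, ∃ c d : Fin n → ℕ, v + ∑ i, c i • p i = ∑ i, d i • p i := by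
  set φ : (ι → ℕ) →+ (ι → ℤ) := (Nat.castAddMonoidHom ℤ).compLeft ι with hφ
  have hφi : Function.Injective φ := fun x y h => by
    ext i
    exact Int.ofNat_inj.1 (congrFun h i)
  obtain ⟨s', hs', hs⟩ := Submodule.fg_span_iff_fg_span_finset_subset (R := ℤ) (φ '' (P : Set (ι → ℕ)))
    |>.1 (IsNoetherian.noetherian _)
  choose q hq hqφ using fun x : s' => hs' x.2
  refine ⟨s'.card, fun i => q (s'.equivFin.symm i), fun i => hq _,
    fun v hv => ?_⟩
  have hvm : φ v ∈ Submodule.span ℤ (s' : Set (ι → ℤ)) := by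
    rw [← hs]; exact Submodule.subset_span ⟨v, hv, rfl⟩
  obtain ⟨f, -, hf⟩ := Submodule.mem_span_finset.1 hvm
  refine ⟨fun i => (-(f (s'.equivFin.symm i))).toNat, fun i => (f (s'.equivFin.symm i)).toNat, ?_⟩
  apply hφi
  have e1 : ∀ c : s' → ℕ, φ (∑ i, c (s'.equivFin.symm i) • q (s'.equivFin.symm i)) =
      ∑ i : s', (c i : ℤ) • i.1 := by
    intro c
    rw [map_sum, s'.equivFin.symm.sum_comp (fun i : s' => φ (c i • q i))]
    refine Finset.sum_congr rfl fun i _ => ?_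
    rw [map_nsmul, hqφ i, natCast_zsmul]
  rw [map_add, e1 fun i => (-(f i)).toNat, e1 fun i => (f i).toNat, ← hf, ← Finset.sum_coe_sort,
    ← Finset.sum_add_distrib]
  refine Finset.sum_congr rfl fun i _ => ?_
  rw [← add_smul]
  congr 1
  omega

theorem isSemilinearSet_group_inter (P : AddSubmonoid (ι → ℕ)) :
    IsSemilinearSet {v : ι → ℕ | ∃ p ∈ P, ∃ q ∈ P, v + q = p} := by
  obtain ⟨n, p, hp, hgen⟩ := exists_finite_group_generators P
  have h1 : IsSemilinearSet {x : (ι → ℕ) × (Fin n → ℕ) × (Fin n → ℕ) |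
      (AddMonoidHom.coprod (AddMonoidHom.id (ι → ℕ)) (AddMonoidHom.coprod (combHom p) 0)) x =
      (AddMonoidHom.coprod 0 (AddMonoidHom.coprod 0 (combHom p)) :
        (ι → ℕ) × (Fin n → ℕ) × (Fin n → ℕ) →+ (ι → ℕ)) x} := by
    have := isSemilinearSet_setOfPred_eq 0 0
      (AddMonoidHom.coprod (AddMonoidHom.id (ι → ℕ)) (AddMonoidHom.coprod (combHom p) 0))
      (AddMonoidHom.coprod 0 (AddMonoidHom.coprod 0 (combHom p)) :
        (ι → ℕ) × (Fin n → ℕ) × (Fin n → ℕ) →+ (ι → ℕ))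
    simpa only [zero_add] using this
  convert h1.image (AddMonoidHom.fst _ _) using 1
  ext v
  have hmem : ∀ c : Fin n → ℕ, ∑ i, c i • p i ∈ P := fun c =>
    P.sum_mem fun i _ => P.nsmul_mem (hp i) _
  simp only [Set.mem_ofPred_eq, Set.mem_image, Prod.exists, AddMonoidHom.coprod_apply,
    AddMonoidHom.id_apply, combHom_apply, AddMonoidHom.zero_apply, add_zero, zero_add,
    AddMonoidHom.coe_fst, exists_and_right, exists_eq_right]
  constructor
  · rintro ⟨x, hx, y, hy, h⟩
    obtain ⟨c, d, h1⟩ := hgen x hx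
    obtain ⟨c', d', h2⟩ := hgen y hy
    refine ⟨d' + c, d + c', ?_⟩
    simp only [Pi.add_apply, add_smul, Finset.sum_add_distrib]
    rw [← h1, ← h2, ← h]
    abel
  · rintro ⟨c, d, h⟩
    exact ⟨_, hmem d, _, hmem c, h⟩

/-- `L` is a semilinear superset of `P` such that translates of `L` containing a linear set whose
directions span those of `P` also witness points of the corresponding translate of `P`. -/
def IsHull (P : AddSubmonoid (ι → ℕ)) (L : Set (ι → ℕ)) : Prop :=
  IsSemilinearSet L ∧ (P : Set (ι → ℕ)) ⊆ L ∧
    ∀ (x b : ι → ℕ) (n : ℕ) (g : (Fin n → ℕ) →+ (ι → ℕ)), (∀ v, ∃ u ∈ L, x + g v = b + u) →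
      (∀ p ∈ P, ∃ N : ℕ, 1 ≤ N ∧ ∃ u u', N • p + g u = g u') →
        ∃ K : ℕ, 1 ≤ K ∧ ∀ k, 1 ≤ k → ∃ p ∈ P, x + (k * K) • g 1 = b + p

theorem NiceSubmonoid.exists_isHull {P : AddSubmonoid (ι → ℕ)} (hP : NiceSubmonoid P) :
    ∃ L, IsHull P L := by
  obtain ⟨κ, _, a, w, hw, ha1, ha2⟩ := hP
  obtain ⟨hsl, F, hF, hdec⟩ := isSemilinearSet_satur_mrange a
  refine ⟨_, (isSemilinearSet_group_inter P).inter hsl, fun p hp =>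
    ⟨⟨p, hp, 0, P.zero_mem, add_zero _⟩, ha1 p hp⟩, ?_⟩
  intro x b n g hg hspan
  -- directions have multiples in the generated monoid
  have hdir : ∀ e : Fin n → ℕ, ∃ m : ℕ, 1 ≤ m ∧ ∃ c : κ → ℕ, m • g e = ∑ i, c i • a i := by
    intro e
    have : ∀ j : ℕ, ∃ f ∈ F, ∃ c : κ → ℕ, x + j • g e = b + (f + ∑ i, c i • a i) := by
      intro j
      obtain ⟨u, ⟨-, hu⟩, h⟩ := hg (j • e)
      obtain ⟨f, hf, c, rfl⟩ := hdec u hu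
      exact ⟨f, hf, c, by rw [← h, map_nsmul]⟩
    choose f hf c hc using this
    have hwqo := hF.partiallyWellOrderedOn (r := (· = ·)) |>.prod
      (Set.partiallyWellOrderedOn_univ_iff.2 (wellQuasiOrdered_le (α := κ → ℕ)))
    obtain ⟨j, j', hjj, h1, h2⟩ := Set.partiallyWellOrderedOn_iff_exists_lt.1 hwqo
      (fun j => (f j, c j)) (fun j => ⟨hf j, trivial⟩)
    obtain ⟨d, hd⟩ := exists_add_of_le h2
    simp only at h1 hd
    refine ⟨j' - j, by omega, d, ?_⟩
    have e1 := hc j'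
    have e2 := hc j
    rw [← h1, hd] at e1
    have : x + j • g e + (j' - j) • g e = x + j • g e + ∑ i, d i • a i := by
      rw [add_assoc, ← add_smul, show j + (j' - j) = j' by omega, e1, e2]
      simp only [Pi.add_apply, add_smul, Finset.sum_add_distrib]
      ac_rfl
    exact add_left_cancel this
  have hsub : ∀ q ∈ P, ∃ K : ℕ, 1 ≤ K ∧ ∃ r ∈ P, K • g 1 = q + r := by
    intro q hq
    obtain ⟨N, hN, u, u', hu⟩ := hspan (q + w) (P.add_mem hq hw)
    have hle : u' ≤ (∑ i, u' i + 1) • (1 : Fin n → ℕ) := fun i => by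
      have := Finset.single_le_sum (f := u') (fun _ _ => Nat.zero_le _) (Finset.mem_univ i)
      simp only [Pi.smul_apply, Pi.one_apply, smul_eq_mul, mul_one]
      omega
    obtain ⟨e, he⟩ := exists_add_of_le hle
    obtain ⟨m, hm, c, hc⟩ := hdir (u + e)
    obtain ⟨m', hm', hmem⟩ := ha2 c
    rw [← hc] at hmem
    have h1 : (∑ i, u' i + 1) • g 1 = N • (q + w) + g (u + e) := by
      rw [← map_nsmul, he, map_add, ← hu, map_add, add_assoc]
    obtain ⟨i, hi⟩ : ∃ i, m' * m * N = i + 1 := ⟨m' * m * N - 1, by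
      have : 1 ≤ m' * m * N := Nat.mul_pos (Nat.mul_pos hm' hm) hN
      omega⟩
    obtain ⟨j, hj⟩ : ∃ j, m' * m * N = m' + j := by
      refine ⟨m' * m * N - m', ?_⟩
      have : m' * 1 ≤ m' * (m * N) := Nat.mul_le_mul_left _ (Nat.mul_pos hm hN)
      rw [mul_one, ← mul_assoc] at this
      omega
    have h2 : (m' * m * (∑ i, u' i + 1)) • g 1 =
        q + (m' • (m • g (u + e) + w) + i • q + j • w) := by
      rw [mul_smul, h1, smul_add, ← mul_smul, smul_add]
      nth_rewrite 1 [hi]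
      rw [hj]
      simp only [add_smul, smul_add, mul_smul, one_smul]
      abel
    exact ⟨_, Nat.mul_pos (Nat.mul_pos hm' hm) (Nat.succ_pos _), _,
      P.add_mem (P.add_mem hmem (P.nsmul_mem hq _)) (P.nsmul_mem hw _), h2⟩
  obtain ⟨u0, ⟨⟨p, hp, q, hq, hpq⟩, -⟩, hu0⟩ := hg 0
  obtain ⟨K, hK, r, hr, hKr⟩ := hsub q hq
  refine ⟨K, hK, fun k hk => ⟨p + r + (k - 1) • (q + r), P.add_mem (P.add_mem hp hr)
    (P.nsmul_mem (P.add_mem hq hr) _), ?_⟩⟩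
  rw [map_zero, add_zero] at hu0
  obtain ⟨k, rfl⟩ := Nat.exists_eq_add_of_le' hk
  rw [mul_smul, hKr, hu0, ← hpq, Nat.add_sub_cancel, add_smul, one_smul]
  abel

end Hulls

section Separators

variable {ι : Type} {R : (ι → ℕ) → (ι → ℕ) → Prop}

/-- The coordinatewise cast of natural vectors to rational ones. -/
def ratVec : (ι → ℕ) →+ (ι → ℚ) := (Nat.castAddMonoidHom ℚ).compLeft ι

theorem ratVec_injective : Function.Injective (ratVec (ι := ι)) := fun x y h => by
  ext i
  exact Nat.cast_injective (R := ℚ) (congrFun h i)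

/-- The rational span of the differences of elements of `X`. -/
def direction (X : Set (ι → ℕ)) : Submodule ℚ (ι → ℚ) :=
  Submodule.span ℚ {v | ∃ x ∈ X, ∃ y ∈ X, v = ratVec x - ratVec y}

theorem direction_mono {X Y : Set (ι → ℕ)} (h : X ⊆ Y) : direction X ≤ direction Y :=
  Submodule.span_mono fun _ ⟨x, hx, y, hy, e⟩ => ⟨x, h hx, y, h hy, e⟩

theorem exists_nsmul_of_mem_direction {n : ℕ} {x : ι → ℕ} {g : (Fin n → ℕ) →+ (ι → ℕ)}
    {w : ι → ℚ} (hw : w ∈ direction {y | ∃ v, x + g v = y}) :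
    ∃ N : ℕ, 1 ≤ N ∧ ∃ u u', N • w = ratVec (g u') - ratVec (g u) := by
  induction hw using Submodule.span_induction with
  | mem w hw =>
    obtain ⟨_, ⟨v, rfl⟩, _, ⟨v', rfl⟩, rfl⟩ := hw
    exact ⟨1, le_rfl, v', v, by rw [one_smul, map_add, map_add]; abel⟩
  | zero => exact ⟨1, le_rfl, 0, 0, by simp⟩
  | add w w' _ _ ih ih' =>
    obtain ⟨N, hN, u, v, e⟩ := ih
    obtain ⟨N', hN', u', v', e'⟩ := ih'
    refine ⟨N * N', Nat.mul_pos hN hN', N' • u + N • u', N' • v + N • v', ?_⟩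
    rw [smul_add, mul_comm N, mul_smul, e, mul_comm, mul_smul, e']
    simp only [map_add, map_nsmul, smul_sub]
    abel
  | smul q w _ ih =>
    obtain ⟨N, hN, u, v, e⟩ := ih
    have h1 : (q.den * N) • (q • w) = q.num • (N • w) := by
      rw [mul_comm, mul_smul, ← Nat.cast_smul_eq_nsmul ℚ q.den, ← mul_smul, mul_comm,
        Rat.mul_den_eq_num, ← Int.cast_smul_eq_zsmul ℚ q.num, smul_comm]
    obtain ⟨k, hk | hk⟩ := q.num.eq_nat_or_neg
    · refine ⟨q.den * N, Nat.mul_pos q.den_pos hN, k • u, k • v, ?_⟩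
      rw [h1, e, hk]
      simp only [map_nsmul, natCast_zsmul, smul_sub]
    · refine ⟨q.den * N, Nat.mul_pos q.den_pos hN, k • v, k • u, ?_⟩
      rw [h1, e, hk]
      simp only [map_nsmul, neg_smul, natCast_zsmul, smul_sub]
      abel

/-- `C ⊆ D` is a semilinear set covered by a translate of a hull of a submonoid, that translate of
the submonoid lying in `D` and in the image of `S` under `R`. -/
structure HullCover (R : (ι → ℕ) → (ι → ℕ) → Prop) (S D C : Set (ι → ℕ)) : Prop where
  semilinear : IsSemilinearSet C
  subset : C ⊆ D
  hull : ∃ b P L, IsHull P L ∧ (∀ x ∈ C, ∃ u ∈ L, x = b + u) ∧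
    ∀ p ∈ P, b + p ∈ D ∧ ∃ x ∈ S, R x (b + p)

theorem HullCover.exists_reach {S D E C : Set (ι → ℕ)} (h : HullCover R S E C) (hED : E ⊆ D)
    {n : ℕ} {x : ι → ℕ} {g : (Fin n → ℕ) →+ (ι → ℕ)} (hg : {y | ∃ v, x + g v = y} ⊆ C)
    (hdir : direction D ≤ direction {y | ∃ v, x + g v = y}) :
    ∃ K : ℕ, 1 ≤ K ∧ ∀ k, 1 ≤ k → ∃ s ∈ S, R s (x + (k * K) • g 1) := by
  obtain ⟨b, P, L, hL, hcov, hP⟩ := h.hull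
  obtain ⟨K, hK, h'⟩ := hL.2.2 x b n g (fun v => hcov _ (hg ⟨v, rfl⟩)) fun p hp => by
    have : ratVec p ∈ direction D := by
      refine Submodule.subset_span ⟨b + p, hED (hP p hp).1, b + 0, hED (hP 0 P.zero_mem).1, ?_⟩
      simp
    obtain ⟨N, hN, u, u', e⟩ := exists_nsmul_of_mem_direction (hdir this)
    refine ⟨N, hN, u, u', ratVec_injective ?_⟩
    rw [map_add, map_nsmul, e, sub_add_cancel]
  refine ⟨K, hK, fun k hk => ?_⟩
  obtain ⟨p, hp, e⟩ := h' k hk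
  rw [e]
  exact (hP p hp).2

variable [Fintype ι]

open scoped Pointwise in
theorem exists_hullCover (hR : PostDec R) {S D : Set (ι → ℕ)} (hS : IsSemilinearSet S)
    (hD : IsLinearSet D) : ∃ 𝓒 : Set (Set (ι → ℕ)), 𝓒.Finite ∧ (∀ C ∈ 𝓒, HullCover R S D C) ∧
      ∀ y ∈ D, (∃ x ∈ S, R x y) → y ∈ ⋃₀ 𝓒 := by
  obtain ⟨𝓟, hfin, hnice, heq⟩ := hR S D hS hD
  choose L hL using fun p : 𝓟 => (hnice p.1 p.2).exists_isHull
  have := hfin.to_subtype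
  refine ⟨Set.range fun p : 𝓟 => (p.1.1 +ᵥ L p) ∩ D, Set.finite_range _, ?_, ?_⟩
  · rintro _ ⟨p, rfl⟩
    refine ⟨((hL p).1.vadd _).inter hD.isSemilinearSet, Set.inter_subset_right,
      p.1.1, p.1.2, L p, hL p, ?_, ?_⟩
    · rintro _ ⟨⟨u, hu, rfl⟩, -⟩
      exact ⟨u, hu, rfl⟩
    · intro q hq
      have : p.1.1 + q ∈ {y | y ∈ D ∧ ∃ x ∈ S, R x y} := by
        rw [heq]
        exact Set.mem_biUnion p.2 ⟨q, hq, rfl⟩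
      exact this
  · intro y hy hx
    have : y ∈ {y | y ∈ D ∧ ∃ x ∈ S, R x y} := ⟨hy, hx⟩
    rw [heq] at this
    obtain ⟨p, hp, q, hq, rfl⟩ := Set.mem_iUnion₂.1 this
    exact ⟨_, ⟨⟨p, hp⟩, rfl⟩, ⟨q, (hL ⟨p, hp⟩).2.1 hq, rfl⟩, hy⟩

theorem exists_lower_rank_cover (htrans : ∀ x y z, R x y → R y z → R x z)
    (hR' : PostDec (flip R)) {S T D C : Set (ι → ℕ)} (hT : IsSemilinearSet T)
    (hST : ∀ x ∈ S, ∀ y ∈ T, ¬ R x y) (hC : HullCover R S D C) :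
    ∃ 𝓨 : Set (Set (ι → ℕ)), 𝓨.Finite ∧
      (∀ Y ∈ 𝓨, IsLinearSet Y ∧ Module.finrank ℚ (direction Y) < Module.finrank ℚ (direction D)) ∧
      ∀ x ∈ C, (∃ y ∈ T, R x y) → x ∈ ⋃₀ 𝓨 := by
  obtain ⟨𝓔, h𝓔, hlin, rfl⟩ := hC.semilinear
  choose 𝓒 h𝓒 hcov hmem using fun E : 𝓔 => exists_hullCover hR' hT (hlin E.1 E.2)
  choose 𝓨 h𝓨 hYlin hX using fun p : Σ E : 𝓔, 𝓒 E => (hcov p.1 p.2.1 p.2.2).semilinear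
  have := h𝓔.to_subtype
  have := fun E => (h𝓒 E).to_subtype
  refine ⟨⋃ p, 𝓨 p, Set.finite_iUnion h𝓨, ?_, ?_⟩
  · intro Y hY
    obtain ⟨p, hY⟩ := Set.mem_iUnion.1 hY
    refine ⟨hYlin p Y hY, ?_⟩
    have hYX : Y ⊆ p.2.1 := by
      rw [hX p]
      exact Set.subset_sUnion_of_mem hY
    have hXE := (hcov p.1 p.2.1 p.2.2).subset
    have hEC : p.1.1 ⊆ ⋃₀ 𝓔 := Set.subset_sUnion_of_mem p.1.2
    have hYD : Y ⊆ D := hYX.trans (hXE.trans (hEC.trans hC.subset))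
    by_contra hlt
    have heq := Submodule.eq_of_le_of_finrank_le (direction_mono hYD) (not_lt.1 hlt)
    obtain ⟨x, n, g, hg⟩ := isLinearSet_iff_exists_fin_addMonoidHom.1 (hYlin p Y hY)
    have hY' : Y = {y | ∃ v, x + g v = y} := by
      rw [hg]
      ext y
      simp [Set.mem_vadd_set]
    rw [hY'] at heq hYX
    obtain ⟨K, hK, h1⟩ := hC.exists_reach subset_rfl (hYX.trans (hXE.trans hEC)) heq.ge
    obtain ⟨K', hK', h2⟩ := (hcov p.1 p.2.1 p.2.2).exists_reach (hEC.trans hC.subset) hYX heq.ge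
    obtain ⟨s, hs, hs'⟩ := h1 K' hK'
    obtain ⟨t, ht, ht'⟩ := h2 K hK
    rw [mul_comm] at ht'
    exact hST s hs t ht (htrans _ _ _ hs' ht')
  · rintro x ⟨E, hE, hxE⟩ hx
    obtain ⟨X, hX', hxX⟩ := hmem ⟨E, hE⟩ x hxE hx
    have hxX : x ∈ ⋃₀ 𝓨 ⟨⟨E, hE⟩, ⟨X, hX'⟩⟩ := hX ⟨⟨E, hE⟩, ⟨X, hX'⟩⟩ ▸ hxX
    obtain ⟨Y, hY, hxY⟩ := hxX
    exact ⟨Y, Set.mem_iUnion.2 ⟨_, hY⟩, hxY⟩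

theorem exists_separator_of_cover (hrefl : ∀ x, R x x) (htrans : ∀ x y z, R x y → R y z → R x z)
    (hR : PostDec R) (hR' : PostDec (flip R)) (n : ℕ) : ∀ S T : Set (ι → ℕ), IsSemilinearSet S →
      IsSemilinearSet T → (∀ x ∈ S, ∀ y ∈ T, ¬ R x y) → (∃ 𝓓 : Set (Set (ι → ℕ)), 𝓓.Finite ∧
        (∀ D ∈ 𝓓, IsLinearSet D ∧ Module.finrank ℚ (direction D) < n) ∧ (S ∪ T)ᶜ ⊆ ⋃₀ 𝓓) →
      ∃ S', IsSemilinearSet S' ∧ S ⊆ S' ∧ (∀ y ∈ T, y ∉ S') ∧ ∀ x ∈ S', ∀ y, R x y → y ∈ S' := by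
  induction n with
  | zero =>
    rintro S T hS hT hST ⟨𝓓, -, h𝓓, hcov⟩
    refine ⟨S, hS, subset_rfl, fun y hy hy' => hST y hy' y hy (hrefl y), fun x hx y hxy => ?_⟩
    by_contra hy
    obtain ⟨D, hD, -⟩ := hcov (show y ∈ (S ∪ T)ᶜ from fun h => h.elim hy fun h => hST x hx y h hxy)
    exact absurd (h𝓓 D hD).2 (Nat.not_lt_zero _)
  | succ n ih =>
    rintro S T hS hT hST ⟨𝓓, h𝓓f, h𝓓, hcov⟩
    choose 𝓒 h𝓒 hC hmem using fun D : 𝓓 => exists_hullCover hR hS (h𝓓 D.1 D.2).1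
    have := h𝓓f.to_subtype
    have := fun D => (h𝓒 D).to_subtype
    set T' := T ∪ ⋃ D : 𝓓, D.1 \ ⋃₀ 𝓒 D with hT'def
    have hT' : IsSemilinearSet T' := hT.union <| .iUnion fun D =>
      (h𝓓 D.1 D.2).1.isSemilinearSet.sdiff
        (.sUnion (h𝓒 D) fun C hC' => (hC D C hC').semilinear)
    have hST' : ∀ x ∈ S, ∀ y ∈ T', ¬ R x y := by
      rintro x hx y (hy | hy) hxy
      · exact hST x hx y hy hxy
      · obtain ⟨D, hyD, hy⟩ := Set.mem_iUnion.1 hy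
        exact hy (hmem D y hyD ⟨x, hx, hxy⟩)
    choose 𝓨 h𝓨 hY hYmem using fun p : Σ D : 𝓓, 𝓒 D =>
      exists_lower_rank_cover htrans hR' hT' hST' (hC p.1 p.2.1 p.2.2)
    set N := ⋃₀ ⋃ p, 𝓨 p with hN
    have hNs : IsSemilinearSet N := .sUnion (Set.finite_iUnion h𝓨) fun Y hY' => by
      obtain ⟨p, hp⟩ := Set.mem_iUnion.1 hY'
      exact (hY p Y hp).1.isSemilinearSet
    have hsep : ∀ x ∈ S ∪ ((S ∪ T')ᶜ \ N), ∀ y ∈ T', ¬ R x y := by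
      rintro x (hx | ⟨hx, hxN⟩) y hy hxy
      · exact hST' x hx y hy hxy
      · obtain ⟨D, hD, hxD⟩ := hcov (show x ∈ (S ∪ T)ᶜ from fun h =>
          hx (h.imp id Or.inl))
        have hxC : x ∈ ⋃₀ 𝓒 ⟨D, hD⟩ := by
          by_contra hxC
          exact hx (Or.inr (Or.inr (Set.mem_iUnion.2 ⟨⟨D, hD⟩, hxD, hxC⟩)))
        obtain ⟨C, hC', hxC⟩ := hxC
        obtain ⟨Y, hY', hxY⟩ := hYmem ⟨⟨D, hD⟩, ⟨C, hC'⟩⟩ x hxC ⟨y, hy, hxy⟩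
        exact hxN ⟨Y, Set.mem_iUnion.2 ⟨_, hY'⟩, hxY⟩
    have hcov' : ∃ 𝓓 : Set (Set (ι → ℕ)), 𝓓.Finite ∧
        (∀ D ∈ 𝓓, IsLinearSet D ∧ Module.finrank ℚ (direction D) < n) ∧
          ((S ∪ ((S ∪ T')ᶜ \ N)) ∪ T')ᶜ ⊆ ⋃₀ 𝓓 := by
      refine ⟨⋃ p, 𝓨 p, Set.finite_iUnion h𝓨, fun Y hY' => ?_, fun x hx => ?_⟩
      · obtain ⟨p, hp⟩ := Set.mem_iUnion.1 hY'
        have := (hY p Y hp).2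
        have := (h𝓓 p.1.1 p.1.2).2
        exact ⟨(hY p Y hp).1, by omega⟩
      · by_contra hxN
        refine hx ?_
        by_cases h : x ∈ S ∪ T'
        · exact h.imp Or.inl id
        · exact Or.inl (Or.inr ⟨h, hxN⟩)
    obtain ⟨S', h1, h2, h3, h4⟩ := ih _ T' (hS.union ((hS.union hT').compl.sdiff hNs)) hT' hsep hcov'
    exact ⟨S', h1, Set.subset_union_left.trans h2, fun y hy => h3 y (Or.inl hy), h4⟩

theorem exists_separator (hrefl : ∀ x, R x x) (htrans : ∀ x y z, R x y → R y z → R x z)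
    (hR : PostDec R) (hR' : PostDec (flip R)) {s t : ι → ℕ} (hst : ¬ R s t) :
    ∃ S, IsSemilinearSet S ∧ s ∈ S ∧ t ∉ S ∧ ∀ x ∈ S, ∀ y, R x y → y ∈ S := by
  have hs : IsSemilinearSet ({s} : Set (ι → ℕ)) := .singleton s
  have ht : IsSemilinearSet ({t} : Set (ι → ℕ)) := .singleton t
  obtain ⟨𝓓, hf, hlin, heq⟩ := (hs.union ht).compl
  obtain ⟨S, h1, h2, h3, h4⟩ := exists_separator_of_cover hrefl htrans hR hR'
    (Fintype.card ι + 1) {s} {t} hs ht (by simpa using hst) ⟨𝓓, hf, fun D hD => ⟨hlin D hD, by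
      have := Submodule.finrank_le (direction D)
      rw [Module.finrank_fintype_fun_eq_card] at this
      omega⟩, heq.le⟩
  exact ⟨S, h1, h2 rfl, h3 t rfl, h4⟩

/-- Unreachable configurations of a net are separated by semilinear inductive invariants. -/
theorem exists_semilinear_invariant {T : Set (Trans ι)} (hT : T.Finite) {s t : ι → ℕ}
    (hst : ¬ NReach T s t) :
    ∃ S, IsSemilinearSet S ∧ s ∈ S ∧ t ∉ S ∧ ∀ x ∈ S, ∀ y, NStep T x y → y ∈ S := by
  obtain ⟨S, h1, h2, h3, h4⟩ := exists_separator (fun x => .refl) (fun x y z h h' => h.trans h')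
    (postDec_nreach hT) (postDec_nreach_flip hT) hst
  exact ⟨S, h1, h2, h3, fun x hx y hxy => h4 x hx y (.single hxy)⟩

end Separators

section Lives

/-- A representation of a linear set of vectors: a base and a list of periods. -/
abbrev Lin : Type := Vec × List Vec

/-- The deliveries made by a balloon: pairs of an emptied balloon place and a target place. -/
abbrev Hist : Type := List (ℕ × ℕ)

/-- The submonoid generated by the periods of a linear set. -/
def Lin.periodic (ℓ : Lin) : AddSubmonoid Vec := AddSubmonoid.closure {v | v ∈ ℓ.2}

theorem mem_closure_list_iff {vs : List Vec} : ∀ {u : Vec},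
    u ∈ AddSubmonoid.closure {v | v ∈ vs} ↔ ∃ cs : List ℕ, cs.length = vs.length ∧
      u = (List.zipWith (fun (c : ℕ) (v : Vec) => c • v) cs vs).sum := by
  induction vs with
  | nil =>
    intro u
    have : {v : Vec | v ∈ ([] : List Vec)} = ∅ := by ext; simp
    rw [this, AddSubmonoid.closure_empty, AddSubmonoid.mem_bot]
    exact ⟨fun h => ⟨[], rfl, by simpa using h⟩, fun ⟨cs, h, h'⟩ => by simpa using h'⟩
  | cons a vs ih =>
    intro u
    have : {v : Vec | v ∈ a :: vs} = {a} ∪ {v | v ∈ vs} := by ext; simp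
    rw [this, AddSubmonoid.closure_union, AddSubmonoid.mem_sup]
    constructor
    · rintro ⟨_, hy, z, hz, rfl⟩
      obtain ⟨c, rfl⟩ := AddSubmonoid.mem_closure_singleton.1 hy
      obtain ⟨cs, h, rfl⟩ := ih.1 hz
      exact ⟨c :: cs, by simp [h], by simp⟩
    · rintro ⟨_ | ⟨c, cs⟩, h, rfl⟩
      · simp at h
      · exact ⟨c • a, AddSubmonoid.mem_closure_singleton.2 ⟨c, rfl⟩, _,
          ih.2 ⟨cs, by simpa using h, rfl⟩, by simp⟩

theorem memSL_iff {k : Vec} {L : SemilinRep} :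
    memSL k L ↔ ∃ ℓ ∈ L, ∃ u ∈ Lin.periodic ℓ, k = ℓ.1 + u := by
  constructor
  · rintro ⟨ℓ, hℓ, cs, h, rfl⟩
    exact ⟨ℓ, hℓ, _, mem_closure_list_iff.2 ⟨cs, h, rfl⟩, rfl⟩
  · rintro ⟨ℓ, hℓ, u, hu, rfl⟩
    obtain ⟨cs, h, rfl⟩ := mem_closure_list_iff.1 hu
    exact ⟨ℓ, hℓ, cs, h, rfl⟩

/-- The tokens produced by the deliveries `h` of a balloon with contents `k`. -/
def delivered (h : Hist) : Vec →+ Vec := Finsupp.liftAddHom fun π =>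
  match h.lookup π with
  | some p => Finsupp.singleAddHom p
  | none => 0

/-- The contents remaining after the deliveries `h`. -/
def undelivered (h : Hist) : Vec →+ Vec := Finsupp.filterAddHom fun π => h.lookup π = none

/-- Record a delivery, unless the balloon place is already empty. -/
def Hist.push (h : Hist) (π p : ℕ) : Hist :=
  if h.lookup π = none then h ++ [(π, p)] else h

theorem delivered_single (h : Hist) (π n : ℕ) : delivered h (Finsupp.single π n) =
    match h.lookup π with
    | some p => Finsupp.single p n
    | none => 0 := by
  rw [delivered, Finsupp.liftAddHom_apply_single]
  cases h.lookup π <;> rfl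

theorem undelivered_apply (h : Hist) (k : Vec) (π : ℕ) :
    undelivered h k π = if h.lookup π = none then k π else 0 := rfl

@[simp] theorem delivered_nil (k : Vec) : delivered [] k = 0 := by
  induction k using Finsupp.induction_linear with
  | zero => simp
  | add f g hf hg => rw [map_add, hf, hg, add_zero]
  | single π n => rw [delivered_single]; rfl

@[simp] theorem undelivered_nil (k : Vec) : undelivered [] k = k := by
  ext π
  simp [undelivered_apply]

theorem Hist.lookup_push (h : Hist) (π p π' : ℕ) : (h.push π p).lookup π' =
    if h.lookup π = none ∧ π' = π then some p else h.lookup π' := by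
  unfold Hist.push
  split_ifs with h1 h2 h2
  · obtain ⟨-, rfl⟩ := h2
    rw [List.lookup_append, h1]
    simp
  · have : π' ≠ π := fun e => h2 ⟨h1, e⟩
    rw [List.lookup_append, List.lookup_cons, beq_false_of_ne this]
    simp
  · exact absurd h2.1 h1
  · rfl

theorem Hist.prefix_push (h : Hist) (π p : ℕ) : h <+: h.push π p := by
  unfold Hist.push
  split_ifs
  · exact List.prefix_append _ _
  · exact List.prefix_rfl

theorem Hist.length_push_le (h : Hist) (π p : ℕ) : (h.push π p).length ≤ h.length + 1 := by
  unfold Hist.push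
  split_ifs <;> simp

theorem delivered_push (h : Hist) (π p : ℕ) (k : Vec) : delivered (h.push π p) k =
    delivered h k + Finsupp.single p (undelivered h k π) := by
  induction k using Finsupp.induction_linear with
  | zero => simp
  | add f g hf hg =>
    simp only [map_add, hf, hg, Finsupp.add_apply, Finsupp.single_add]
    abel
  | single π' n =>
    rw [delivered_single, delivered_single, Hist.lookup_push, undelivered_apply]
    by_cases h1 : h.lookup π = none
    · by_cases h2 : π' = π
      · subst h2
        simp [h1]
      · simp [h1, h2]
    · simp [h1]

theorem undelivered_push (h : Hist) (π p : ℕ) (k : Vec) :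
    undelivered (h.push π p) k = Finsupp.erase π (undelivered h k) := by
  ext π'
  rw [undelivered_apply, Hist.lookup_push]
  by_cases h2 : π' = π
  · subst h2
    rw [Finsupp.erase_same]
    by_cases h1 : h.lookup π' = none <;> simp [h1]
  · have h3 : ¬ (h.lookup π = none ∧ π' = π) := fun e => h2 e.2
    rw [if_neg h3, Finsupp.erase_ne h2, undelivered_apply]

theorem delivered_mono {h h' : Hist} (hh : h <+: h') (k : Vec) :
    delivered h k ≤ delivered h' k := by
  obtain ⟨t, rfl⟩ := hh
  induction k using Finsupp.induction_linear with
  | zero => simp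
  | add f g hf hg =>
    rw [map_add, map_add]
    exact add_le_add hf hg
  | single π n =>
    rw [delivered_single, delivered_single, List.lookup_append]
    cases h.lookup π <;> simp

/-- The life of a balloon, contents omitted: not yet inflated, present with a given balloon state,
or burst. The linear set its contents were chosen from and its deliveries are recorded. -/
inductive Life : Type
  | none : Life
  | act (s : ℕ) (ℓ : Lin) (h : Hist) : Life
  | done (ℓ : Lin) (h : Hist) : Life

/-- The deliveries made. -/
def Life.hist : Life → Hist
  | .none => []
  | .act _ _ h => h
  | .done _ h => h

/-- The linear set the contents were chosen from. -/
def Life.lin : Life → Lin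
  | .none => (0, [])
  | .act _ ℓ _ => ℓ
  | .done ℓ _ => ℓ

/-- The present balloon, as a multiset, given the periodic part `u` of the initial contents. -/
def Life.bag (u : Vec) : Life → Multiset Balloon
  | .none => 0
  | .act s ℓ h => {(s, undelivered h (ℓ.1 + u))}
  | .done _ _ => 0

/-- The tokens delivered by a balloon, given the periodic part `u` of its initial contents. -/
def Life.gain (u : Vec) (l : Life) : Vec := delivered l.hist (l.lin.1 + u)

/-- The effect of an operation on the life of a balloon. -/
inductive LifeStep : VOp → Life → Life → Prop
  | delta (d l) : LifeStep (.delta d) l l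
  | inflate (s) {L : SemilinRep} {ℓ : Lin} (hℓ : ℓ ∈ L) :
      LifeStep (.inflate s L) .none (.act s ℓ [])
  | deflate (s s' π p ℓ) (h : Hist) :
      LifeStep (.deflate s s' π p) (.act s ℓ h) (.act s' ℓ (h.push π p))
  | burst (s ℓ h) : LifeStep (.burst s) (.act s ℓ h) (.done ℓ h)

/-- The direct effect of an operation on the places. -/
def VOp.weight : VOp → ℕ → ℤ
  | .delta d => d
  | _ => 0

/-- A configuration with identified balloons: the state, the sum of the direct effects on the
places so far, and the lives of the balloons. -/
structure LConf (ι : Type) where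
  q : ℕ
  w : ℕ → ℤ
  L : ι → Life

variable {ι : Type} [Fintype ι]

/-- The number of tokens in the place `p`, given the periodic parts of the contents of balloons. -/
def LConf.tokens (A : LConf ι) (κ : ι → Vec) (p : ℕ) : ℤ :=
  A.w p + ∑ x, ((A.L x).gain (κ x) p : ℤ)

/-- A step between configurations with identified balloons. -/
def LStep [DecidableEq ι] (V : VASSB) (κ : ι → Vec) (A A' : LConf ι) : Prop :=
  (∃ e ∈ V.edges, A.q = e.1 ∧ A'.q = e.2.2 ∧ A'.w = A.w + e.2.1.weight ∧
    ∃ a l, LifeStep e.2.1 (A.L a) l ∧ A'.L = Function.update A.L a l) ∧ ∀ p, 0 ≤ A'.tokens κ p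

/-- The initial configuration with identified balloons. -/
def LConf.start (ι : Type) (s : VConfig) : LConf ι := ⟨s.q, fun p => s.m p, fun _ => .none⟩

theorem sum_update_life [DecidableEq ι] {M : Type*} [AddCommMonoid M] (F : ι → Life → M)
    (L : ι → Life) (a : ι) (l : Life) :
    ∑ x, F x (Function.update L a l x) + F a (L a) = ∑ x, F x (L x) + F a l := by
  rw [← Finset.add_sum_erase _ _ (Finset.mem_univ a), ← Finset.add_sum_erase _ (fun x => F x (L x))
    (Finset.mem_univ a), Function.update_self, Finset.sum_congr rfl fun x hx =>
      show F x (Function.update L a l x) = F x (L x) by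
        rw [Function.update_of_ne (Finset.ne_of_mem_erase hx)]]
  ac_rfl

theorem LifeStep.ne_none {o : VOp} {l l' : Life} (h : LifeStep o l l') (hl : l ≠ .none) :
    l' ≠ .none := by
  cases h <;> simp_all

theorem LStep.ne_none [DecidableEq ι] {V : VASSB} {κ : ι → Vec} {A A' : LConf ι} (h : LStep V κ A A') {x : ι}
    (hx : A.L x ≠ .none) : A'.L x ≠ .none := by
  obtain ⟨⟨e, -, -, -, -, a, l, hl, hL⟩, -⟩ := h
  rw [hL]
  rcases eq_or_ne x a with rfl | hxa
  · rw [Function.update_self]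
    exact hl.ne_none hx
  · rwa [Function.update_of_ne hxa]

theorem LConf.tokens_congr {A : LConf ι} {κ κ' : ι → Vec} (h : ∀ x, A.L x ≠ .none → κ x = κ' x) :
    A.tokens κ = A.tokens κ' := by
  funext p
  unfold LConf.tokens
  congr 1
  refine Finset.sum_congr rfl fun x _ => ?_
  by_cases hx : A.L x = .none
  · simp [hx, Life.gain, Life.hist]
  · rw [h x hx]

theorem lreach_congr [DecidableEq ι] {V : VASSB} {κ κ' : ι → Vec} {A B : LConf ι}
    (h : Relation.ReflTransGen (LStep V κ) A B) (hκ : ∀ x, B.L x ≠ .none → κ x = κ' x) :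
    Relation.ReflTransGen (LStep V κ') A B := by
  induction h with
  | refl => exact .refl
  | tail _ h ih =>
    refine .tail (ih fun x hx => hκ x (h.ne_none hx)) ⟨h.1, fun p => ?_⟩
    rw [← LConf.tokens_congr hκ]
    exact h.2 p

/-- `A` with contents `κ` represents the configuration `C`. -/
structure Represents (κ : ι → Vec) (A : LConf ι) (C : VConfig) : Prop where
  q : C.q = A.q
  m : ∀ p, (C.m p : ℤ) = A.tokens κ p
  bag : C.bag = ∑ x, (A.L x).bag (κ x)
  periodic : ∀ x, κ x ∈ (A.L x).lin.periodic

theorem represents_start {s : VConfig} (hs : IsSemi s) :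
    Represents (0 : ι → Vec) (.start ι s) s :=
  ⟨rfl, fun p => by simp [LConf.tokens, LConf.start, Life.gain, Life.hist],
    by simp [LConf.start, Life.bag, show s.bag = 0 from hs], fun x => zero_mem _⟩

theorem Represents.step [DecidableEq ι] {V : VASSB} {κ : ι → Vec} {A : LConf ι} {C C' : VConfig}
    (h : Represents κ A C) (hstep : VStep V C C')
    (hfree : ∃ a, A.L a = .none) : ∃ κ' A', (∀ x, A.L x ≠ .none → κ x = κ' x) ∧
      LStep V κ' A A' ∧ Represents κ' A' C' ∧
      ∃ a, ∀ x, A'.L x ≠ .none → A.L x ≠ .none ∨ x = a := by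
  obtain ⟨e, he, hq, hq', hop⟩ := hstep
  -- it suffices to find the balloon and its new life
  suffices ∃ (κ' : ι → Vec) (a : ι) (l : Life), (∀ x, A.L x ≠ .none → κ x = κ' x) ∧ LifeStep e.2.1 (A.L a) l ∧
      (∀ x, κ' x ∈ (Function.update A.L a l x).lin.periodic) ∧
      (∀ p, (C'.m p : ℤ) + (A.L a).gain (κ' a) p =
        C.m p + e.2.1.weight p + l.gain (κ' a) p) ∧
      C'.bag + (A.L a).bag (κ' a) = C.bag + l.bag (κ' a) by
    obtain ⟨κ', a, l, h1, h2, h3, h4, h5⟩ := this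
    have htok : ∀ p, (C'.m p : ℤ) = LConf.tokens
        ⟨e.2.2, A.w + e.2.1.weight, Function.update A.L a l⟩ κ' p := by
      intro p
      have e1 := h.m p
      have e2 := sum_update_life (fun x l => ((l.gain (κ' x) p : ℕ) : ℤ)) A.L a l
      have e3 := h4 p
      rw [LConf.tokens_congr h1] at e1
      simp only [LConf.tokens, Pi.add_apply] at e1 ⊢
      linarith
    refine ⟨κ', ⟨e.2.2, A.w + e.2.1.weight, Function.update A.L a l⟩, h1,
      ⟨⟨e, he, h.q ▸ hq, rfl, rfl, a, l, h2, rfl⟩, fun p => ?_⟩, ⟨hq', htok, ?_, h3⟩, a, ?_⟩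
    · rw [← htok]
      positivity
    · have e2 := sum_update_life (fun x l => l.bag (κ' x)) A.L a l
      have e3 : C.bag = ∑ x, (A.L x).bag (κ' x) := by
        rw [h.bag]
        refine Finset.sum_congr rfl fun x _ => ?_
        by_cases hx : A.L x = .none
        · rw [hx]; rfl
        · rw [h1 x hx]
      rw [e3, ← e2] at h5
      exact add_right_cancel h5
    · intro x hx
      by_contra! hcon
      exact hx (by simp only [Function.update_of_ne hcon.2, hcon.1])
  have hper : ∀ a l, (A.L a).lin = l.lin → ∀ x, κ x ∈ (Function.update A.L a l x).lin.periodic := by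
    intro a l hl x
    rcases eq_or_ne x a with rfl | hx
    · rw [Function.update_self, ← hl]
      exact h.periodic x
    · rw [Function.update_of_ne hx]
      exact h.periodic x
  have hfind : ∀ b ∈ C.bag, ∃ a s ℓ h, A.L a = .act s ℓ h ∧
      b = (s, undelivered h (ℓ.1 + κ a)) := by
    intro b hb
    rw [h.bag, Multiset.mem_sum] at hb
    obtain ⟨a, -, ha⟩ := hb
    cases hL : A.L a with
    | none => simp [hL, Life.bag] at ha
    | done => simp [hL, Life.bag] at ha
    | act s ℓ h =>
      rw [hL] at ha
      exact ⟨a, s, ℓ, h, hL, Multiset.mem_singleton.1 ha⟩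
  obtain ⟨q, op, q'⟩ := e
  cases op with
  | delta d =>
    obtain ⟨hm, hn⟩ := hop
    obtain ⟨a, ha⟩ := hfree
    refine ⟨κ, a, A.L a, fun _ _ => rfl, .delta _ _, hper a _ rfl, fun p => ?_, ?_⟩
    · rw [hm]; rfl
    · rw [hn]
  | inflate s L =>
    obtain ⟨hm, k, hk, hn⟩ := hop
    obtain ⟨ℓ, hℓ, u, hu, rfl⟩ := memSL_iff.1 hk
    obtain ⟨a, ha⟩ := hfree
    refine ⟨Function.update κ a u, a, .act s ℓ [], fun x hx => ?_, ?_, fun x => ?_, fun p => ?_, ?_⟩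
    · rw [Function.update_of_ne (by rintro rfl; exact hx ha)]
    · rw [ha]
      exact .inflate s hℓ
    · rcases eq_or_ne x a with rfl | hx
      · rw [Function.update_self, Function.update_self]
        exact hu
      · rw [Function.update_of_ne hx, Function.update_of_ne hx]
        exact h.periodic x
    · rw [hm, ha]
      simp [Life.gain, Life.hist, VOp.weight]
    · rw [hn, ha, Function.update_self]
      simp [Life.bag]
  | deflate s s' π p =>
    obtain ⟨k, n0, hn, hm, hn'⟩ := hop
    obtain ⟨a, σ, ℓ, h', hL, hb⟩ := hfind (s, k) (by rw [hn]; simp)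
    obtain ⟨rfl, rfl⟩ := Prod.mk.inj hb
    refine ⟨κ, a, .act s' ℓ (h'.push π p), fun _ _ => rfl, hL ▸ .deflate _ _ _ _ _ _,
      hper _ _ (by rw [hL]; rfl), fun p' => ?_, ?_⟩
    · rw [hL, hm]
      simp only [Life.gain, Life.hist, Life.lin, delivered_push, Finsupp.add_apply, VOp.weight,
        Pi.zero_apply]
      push_cast
      ring
    · rw [hL, hn', hn]
      simp only [Life.bag, undelivered_push]
      abel
  | burst s =>
    obtain ⟨hm, k, n0, hn, hn'⟩ := hop
    obtain ⟨a, σ, ℓ, h', hL, hb⟩ := hfind (s, k) (by rw [hn]; simp)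
    obtain ⟨rfl, rfl⟩ := Prod.mk.inj hb
    refine ⟨κ, a, .done ℓ h', fun _ _ => rfl, hL ▸ .burst _ _ _,
      hper _ _ (by rw [hL]; rfl), fun p' => ?_, ?_⟩
    · rw [hL, hm]
      simp [Life.gain, Life.hist, Life.lin, VOp.weight]
    · rw [hL, hn', hn]
      simp [Life.bag]

end Lives

section

theorem exists_represents {V : VASSB} {s C : VConfig} (hs : IsSemi s) (h : VReach V s C) :
    ∃ n, ∀ (ι : Type) [Fintype ι] [DecidableEq ι], n ≤ Fintype.card ι →
      ∃ (κ : ι → Vec) (A : LConf ι), Relation.ReflTransGen (LStep V κ) (.start ι s) A ∧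
        Represents κ A C ∧ ∃ U : Finset ι, U.card ≤ n ∧ ∀ x, A.L x ≠ .none → x ∈ U := by
  induction h with
  | refl =>
    exact ⟨0, fun ι _ _ _ => ⟨0, _, .refl, represents_start hs, ∅, le_rfl, fun x hx =>
      absurd rfl hx⟩⟩
  | tail _ hstep ih =>
    obtain ⟨n, ih⟩ := ih
    refine ⟨n + 1, fun ι _ _ hn => ?_⟩
    obtain ⟨κ, A, hA, hrep, U, hU, hU'⟩ := ih ι (by omega)
    have hfree : ∃ a, A.L a = .none := by
      by_contra! hcon
      have : Finset.univ ⊆ U := fun x _ => hU' x (hcon x)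
      have := Finset.card_le_card this
      rw [Finset.card_univ] at this
      omega
    obtain ⟨κ', A', h1, h2, h3, a, ha⟩ := hrep.step hstep hfree
    refine ⟨κ', A', (lreach_congr hA h1).tail h2, h3, insert a U,
      (Finset.card_insert_le _ _).trans (by omega), fun x hx => ?_⟩
    rcases ha x hx with h | rfl
    · exact Finset.mem_insert_of_mem (hU' x h)
    · exact Finset.mem_insert_self _ _

end

section Ramsey

theorem exists_pairwise_meet_or_disjoint {ι : Type} [DecidableEq ι] (S : Finset ℕ) (N : ℕ)
    (a b : ι → ℕ) (st : ι → ℕ → ℕ) : ∀ (k : ℕ) (Y : Finset ι), (S.card + 1) * N * k ≤ Y.card →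
    (∀ y ∈ Y, a y ≤ b y) → (∀ y ∈ Y, ∀ t, a y ≤ t → t ≤ b y → st y t ∈ S) →
    (∃ Z ⊆ Y, N ≤ Z.card ∧ ∀ x ∈ Z, ∀ y ∈ Z, ∃ u, (a x ≤ u ∧ u ≤ b x) ∧ (a y ≤ u ∧ u ≤ b y) ∧
      st x u = st y u) ∨
    ∃ Z ⊆ Y, k ≤ Z.card ∧ ∀ x ∈ Z, ∀ y ∈ Z, x ≠ y → b x < a y ∨ b y < a x := by
  intro k
  induction k with
  | zero => exact fun Y _ _ _ => .inr ⟨∅, by simp, by simp, by simp⟩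
  | succ k ih =>
    intro Y hY hab hst
    rcases Nat.eq_zero_or_pos N with rfl | hN
    · exact .inl ⟨∅, by simp, by simp, by simp⟩
    have hYne : Y.Nonempty := by
      rw [← Finset.card_pos]
      exact lt_of_lt_of_le (by positivity) hY
    obtain ⟨y₀, hy₀, hmin⟩ := Finset.exists_min_image Y b hYne
    rcases le_or_gt (S.card * N) (Y.filter fun y => a y ≤ b y₀).card with hC | hC
    · left
      have hmap : ∀ y ∈ Y.filter (fun y => a y ≤ b y₀), st y (b y₀) ∈ S := fun y hy => by
        rw [Finset.mem_filter] at hy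
        exact hst y hy.1 _ hy.2 (hmin y hy.1)
      obtain ⟨s, -, hs⟩ := Finset.exists_le_card_fiber_of_mul_le_card_of_maps_to hmap
        ⟨_, hst y₀ hy₀ _ (hab y₀ hy₀) le_rfl⟩ hC
      refine ⟨_, (Finset.filter_subset _ _).trans (Finset.filter_subset _ _), hs, ?_⟩
      intro x hx y hy
      simp only [Finset.mem_filter] at hx hy
      exact ⟨b y₀, ⟨hx.1.2, hmin x hx.1.1⟩, ⟨hy.1.2, hmin y hy.1.1⟩, hx.2.trans hy.2.symm⟩
    · have hcard := Finset.card_filter_add_card_filter_not (s := Y) (fun y => a y ≤ b y₀)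
      have hk : (S.card + 1) * N * k ≤ (Y.filter fun y => ¬ a y ≤ b y₀).card := by
        have : (S.card + 1) * N * (k + 1) = (S.card + 1) * N * k + S.card * N + N := by ring
        omega
      rcases ih _ hk (fun y hy => hab y (Finset.mem_of_mem_filter y hy))
        (fun y hy => hst y (Finset.mem_of_mem_filter y hy)) with ⟨Z, hZ, h⟩ | ⟨Z, hZ, hZk, h⟩
      · exact .inl ⟨Z, hZ.trans (Finset.filter_subset _ _), h⟩
      · have hlt : ∀ y ∈ Z, b y₀ < a y := fun y hy => by
          have := hZ hy
          rw [Finset.mem_filter] at this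
          omega
        have hnot : y₀ ∉ Z := fun hc => by
          have := hlt _ hc
          have := hab _ hy₀
          omega
        refine .inr ⟨insert y₀ Z, Finset.insert_subset hy₀ (hZ.trans (Finset.filter_subset _ _)),
          ?_, ?_⟩
        · rw [Finset.card_insert_of_notMem hnot]
          omega
        · intro x hx y hy hxy
          rw [Finset.mem_insert] at hx hy
          rcases hx with rfl | hx <;> rcases hy with rfl | hy
          · exact absurd rfl hxy
          · exact .inl (hlt _ hy)
          · exact .inr (hlt _ hx)
          · exact h x hx y hy hxy

theorem exists_level_interval {p : ℕ → ℕ} {n i : ℕ} (hp : ∀ s t, s ≤ t → t ≤ n → p s ≤ p t)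
    (hstep : ∀ t < n, p (t + 1) ≤ p t + 1) (h0 : p 0 ≤ i) (hn : i ≤ p n) :
    ∃ a b, a ≤ b ∧ ∀ t, t ≤ n ∧ p t = i ↔ a ≤ t ∧ t ≤ b := by
  have hex : ∃ t, t ≤ n ∧ i ≤ p t := ⟨n, le_rfl, hn⟩
  have ha := Nat.find_spec hex
  have hmin := fun m (hm : m < Nat.find hex) => Nat.find_min hex hm
  generalize Nat.find hex = a at ha hmin
  have hpa : p a = i := by
    rcases a with _ | a
    · omega
    · have h1 := hmin a (by omega)
      have h2 := hstep a (by omega)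
      omega
  have hb : p (Nat.findGreatest (fun t => p t ≤ i) n) ≤ i :=
    Nat.findGreatest_spec (P := fun t => p t ≤ i) (Nat.zero_le n) h0
  refine ⟨a, Nat.findGreatest (fun t => p t ≤ i) n, Nat.le_findGreatest ha.1 hpa.le, fun t =>
    ⟨fun ⟨h1, h2⟩ => ⟨?_, Nat.le_findGreatest h1 h2.le⟩, fun ⟨h1, h2⟩ => ?_⟩⟩
  · by_contra hlt
    exact hmin t (by omega) ⟨h1, h2.ge⟩
  · have h3 : Nat.findGreatest (fun t => p t ≤ i) n ≤ n := Nat.findGreatest_le n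
    have h4 := hp a t h1 (h2.trans h3)
    have h5 := hp t _ h2 h3
    exact ⟨h2.trans h3, by omega⟩

theorem exists_subset_pairwise {ι : Type} {g : ℕ → ℕ} {good : ℕ → ι → ι → Prop} {Y₀ : Finset ι}
    (h : ∀ i N, ∀ Y ⊆ Y₀, g N ≤ Y.card → ∃ Z ⊆ Y, N ≤ Z.card ∧
      ∀ x ∈ Z, ∀ y ∈ Z, x ≠ y → good i x y) :
    ∀ j N, ∀ Y ⊆ Y₀, g^[j] N ≤ Y.card → ∃ Z ⊆ Y, N ≤ Z.card ∧
      ∀ i < j, ∀ x ∈ Z, ∀ y ∈ Z, x ≠ y → good i x y := by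
  intro j
  induction j with
  | zero => exact fun N Y _ hN => ⟨Y, subset_rfl, hN, by simp⟩
  | succ j ih =>
    intro N Y hY hN
    obtain ⟨Z, hZ, hZN, hZg⟩ := ih (g N) Y hY hN
    obtain ⟨W, hW, hWN, hWg⟩ := h j N Z (hZ.trans hY) hZN
    refine ⟨W, hW.trans hZ, hWN, fun i hi x hx y hy hxy => ?_⟩
    rcases Nat.lt_succ_iff_lt_or_eq.1 hi with hi | rfl
    · exact hZg i hi x (hW hx) y (hW hy) hxy
    · exact hWg x hx y hy hxy

/-- Two counters that take turns in the lead, and that meet with `E` on every level where they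
draw, can be relabelled at times satisfying `E` so that one of them always leads. -/
theorem exists_switch {p q : ℕ → ℕ} {E : ℕ → Prop} {n r : ℕ} (h0 : p 0 = q 0)
    (hp : ∀ s t, s ≤ t → t ≤ n → p s ≤ p t) (hq : ∀ s t, s ≤ t → t ≤ n → q s ≤ q t)
    (hstep : ∀ t < n, (p (t + 1) = p t ∧ q (t + 1) ≤ q t + 1) ∨
      (q (t + 1) = q t ∧ p (t + 1) ≤ p t + 1))
    (hpr : p n ≤ r) (hqr : q n ≤ r)
    (hgood : ∀ t ≤ n, p t = q t → p t < r → ∃ u ≤ n, p u = p t ∧ q u = p t ∧ E u) :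
    ∀ m ≤ n, ∃ sw : ℕ → Bool, (∀ t < m, sw t ≠ sw (t + 1) → E t) ∧
      ∀ t ≤ m, (sw t = false → q t ≤ p t) ∧ (sw t = true → p t ≤ q t) := by
  intro m
  induction m with
  | zero =>
    refine fun _ => ⟨fun _ => false, by simp, fun t ht => ?_⟩
    obtain rfl : t = 0 := by omega
    simp [h0]
  | succ m ih =>
    intro hm
    obtain ⟨sw, hE, hsw⟩ := ih (by omega)
    have key : ∀ (b : Bool) (u : ℕ), u ≤ m → (sw u ≠ b → E u) →
        (∀ t, u < t → t ≤ m + 1 → (b = false → q t ≤ p t) ∧ (b = true → p t ≤ q t)) →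
        ∃ sw : ℕ → Bool, (∀ t < m + 1, sw t ≠ sw (t + 1) → E t) ∧
          ∀ t ≤ m + 1, (sw t = false → q t ≤ p t) ∧ (sw t = true → p t ≤ q t) := by
      intro b u hu hb hv
      refine ⟨fun t => if t ≤ u then sw t else b, fun t ht hne => ?_, fun t ht => ?_⟩
      · rcases lt_trichotomy t u with h | rfl | h
        · simp only [h.le, Nat.succ_le_of_lt h, if_true] at hne
          exact hE t (by omega) hne
        · simp only [le_refl, if_true, show ¬ (t + 1 ≤ t) by omega, if_false] at hne
          exact hb hne
        · simp only [show ¬ (t ≤ u) by omega, show ¬ (t + 1 ≤ u) by omega, if_false] at hne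
          exact absurd rfl hne
      · by_cases h : t ≤ u
        · simp only [h, if_true]
          exact hsw t (by omega)
        · simp only [h, if_false]
          exact hv t (by omega) ht
    have hmr : p (m + 1) ≤ r := (hp _ _ hm le_rfl).trans hpr
    have hmr' : q (m + 1) ≤ r := (hq _ _ hm le_rfl).trans hqr
    have h1 := hp m (m + 1) (by omega) hm
    have h2 := hq m (m + 1) (by omega) hm
    have h3 := hstep m (by omega)
    have h4 := hsw m le_rfl
    have h6 : ∀ t, m < t → t ≤ m + 1 → t = m + 1 := by omega
    by_cases h5 : (sw m = false → q (m + 1) ≤ p (m + 1)) ∧ (sw m = true → p (m + 1) ≤ q (m + 1))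
    · exact key (sw m) m le_rfl (fun h => absurd rfl h) fun t ht ht' => h6 t ht ht' ▸ h5
    · have hd : p m = q m ∧ p m < r ∧ (p m < p (m + 1) ∨ q m < q (m + 1)) := by
        cases hs : sw m <;> simp [hs] at h4 h5 <;> omega
      obtain ⟨u, hu, hpu, hqu, hEu⟩ := hgood m (by omega) hd.1 hd.2.1
      have hum : u ≤ m := by
        by_contra hc
        have := hp (m + 1) u (by omega) hu
        have := hq (m + 1) u (by omega) hu
        omega
      refine key (!sw m) u hum (fun _ => hEu) fun t ht ht' => ?_
      rcases Nat.lt_or_eq_of_le ht' with ht' | rfl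
      · have := hp u t ht.le (by omega)
        have := hq u t ht.le (by omega)
        have := hp t m (by omega) (by omega)
        have := hq t m (by omega) (by omega)
        exact ⟨fun _ => by omega, fun _ => by omega⟩
      · cases hs : sw m <;> simp [hs] at h4 h5 ⊢ <;> omega

end Ramsey

section Merge

theorem LifeStep.hist_mono {o : VOp} {l l' : Life} (h : LifeStep o l l') :
    l.hist <+: l'.hist := by
  cases h with
  | delta => exact List.prefix_rfl
  | inflate => exact List.prefix_rfl
  | deflate => exact Hist.prefix_push _ _ _
  | burst => exact List.prefix_rfl

theorem LifeStep.length_hist_le {o : VOp} {l l' : Life} (h : LifeStep o l l') :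
    l'.hist.length ≤ l.hist.length + 1 := by
  cases h with
  | delta => exact Nat.le_succ _
  | inflate => exact Nat.le_succ _
  | deflate => exact Hist.length_push_le _ _ _
  | burst => exact Nat.le_succ _

theorem LifeStep.eq_of_done {o : VOp} {l' : Life} {ℓ : Lin} {h : Hist}
    (hl : LifeStep o (.done ℓ h) l') : l' = .done ℓ h := by
  cases hl
  rfl

theorem LifeStep.lin_eq {o : VOp} {l l' : Life} (h : LifeStep o l l') (hl : l ≠ .none) :
    l'.lin = l.lin := by
  cases h <;> simp_all [Life.lin]

/-- Finite sets containing the balloon states, the linear sets and the delivery histories that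
occur in the runs of `V`. -/
structure Bounds (V : VASSB) (S : Finset ℕ) (Ls : Set Lin) (Hs : Set Hist) (r : ℕ) : Prop where
  inflate : ∀ {q s L q'}, (q, VOp.inflate s L, q') ∈ V.edges → s ∈ S ∧ ∀ ℓ ∈ L, ℓ ∈ Ls
  deflate : ∀ {q s s' π p q'}, (q, VOp.deflate s s' π p, q') ∈ V.edges →
    s' ∈ S ∧ ∀ h ∈ Hs, Hist.push h π p ∈ Hs
  nil : [] ∈ Hs
  length_le : ∀ h ∈ Hs, h.length ≤ r

/-- A life within the given bounds. -/
def Life.Within (S : Finset ℕ) (Ls : Set Lin) (Hs : Set Hist) : Life → Prop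
  | .none => True
  | .act s ℓ h => s ∈ S ∧ ℓ ∈ Ls ∧ h ∈ Hs
  | .done ℓ h => ℓ ∈ Ls ∧ h ∈ Hs

theorem Bounds.step {V : VASSB} {S : Finset ℕ} {Ls : Set Lin} {Hs : Set Hist} {r : ℕ}
    (B : Bounds V S Ls Hs r) {e : VEdge} (he : e ∈ V.edges) {l l' : Life}
    (hl : LifeStep e.2.1 l l') (h : l.Within S Ls Hs) : l'.Within S Ls Hs := by
  obtain ⟨q, o, q'⟩ := e
  cases hl with
  | delta => exact h
  | inflate s hℓ => exact ⟨(B.inflate he).1, (B.inflate he).2 _ hℓ, B.nil⟩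
  | deflate => exact ⟨(B.deflate he).1, h.2.1, (B.deflate he).2 _ h.2.2⟩
  | burst => exact h.2

theorem exists_seq_of_reflTransGen {α : Type*} {R : α → α → Prop} {a b : α}
    (h : Relation.ReflTransGen R a b) :
    ∃ (f : ℕ → α) (n : ℕ), f 0 = a ∧ f n = b ∧ ∀ t < n, R (f t) (f (t + 1)) := by
  induction h with
  | refl => exact ⟨fun _ => a, 0, rfl, rfl, by simp⟩
  | @tail b c _ hbc ih =>
    obtain ⟨f, n, h0, hn, hf⟩ := ih
    refine ⟨fun t => if t ≤ n then f t else c, n + 1, by simpa using h0, by simp, fun t ht => ?_⟩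
    rcases Nat.lt_or_eq_of_le (Nat.lt_succ_iff.1 ht) with h | rfl
    · simpa [h.le, Nat.succ_le_of_lt h] using hf t h
    · simpa [hn] using hbc

theorem reflTransGen_of_seq {α : Type*} {R : α → α → Prop} {f : ℕ → α} {n : ℕ}
    (hf : ∀ t < n, R (f t) (f (t + 1))) : Relation.ReflTransGen R (f 0) (f n) := by
  induction n with
  | zero => exact .refl
  | succ n ih => exact (ih fun t ht => hf t (by omega)).tail (hf n (by omega))

variable {ι : Type} [Fintype ι] [DecidableEq ι] {V : VASSB} {κ : ι → Vec}

theorem LStep.life {A A' : LConf ι} (h : LStep V κ A A') :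
    ∃ e ∈ V.edges, ∃ a, (∀ x, x ≠ a → A'.L x = A.L x) ∧ LifeStep e.2.1 (A.L a) (A'.L a) := by
  obtain ⟨⟨e, he, -, -, -, a, l, hl, hL⟩, -⟩ := h
  refine ⟨e, he, a, fun x hx => by rw [hL, Function.update_of_ne hx], ?_⟩
  rwa [hL, Function.update_self]

theorem LStep.life_rel {A A' : LConf ι} (h : LStep V κ A A') {R : Life → Life → Prop}
    (hrefl : ∀ l, R l l) (hR : ∀ e ∈ V.edges, ∀ l l', LifeStep e.2.1 l l' → R l l') (x : ι) :
    R (A.L x) (A'.L x) := by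
  obtain ⟨e, he, a, h1, h2⟩ := h.life
  rcases eq_or_ne x a with rfl | hx
  · exact hR e he _ _ h2
  · rw [h1 x hx]
    exact hrefl _

theorem life_rel_of_seq {f : ℕ → LConf ι} {n : ℕ} (hf : ∀ t < n, LStep V κ (f t) (f (t + 1)))
    {R : Life → Life → Prop} (hrefl : ∀ l, R l l) (htrans : ∀ {a b c}, R a b → R b c → R a c)
    (hR : ∀ e ∈ V.edges, ∀ l l', LifeStep e.2.1 l l' → R l l') (x : ι) {s t : ℕ} (hst : s ≤ t)
    (ht : t ≤ n) : R ((f s).L x) ((f t).L x) := by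
  induction t, hst using Nat.le_induction with
  | base => exact hrefl _
  | succ t _ ih => exact htrans (ih (by omega)) ((hf t (by omega)).life_rel hrefl hR x)

theorem sum_le_sum_of_pair {F G : ι → ℤ} {x y : ι} (hxy : x ≠ y)
    (h : ∀ z, z ≠ x → z ≠ y → F z = G z) (h' : F x + F y ≤ G x + G y) : ∑ z, F z ≤ ∑ z, G z := by
  have hy : y ∈ Finset.univ.erase x := by simp [hxy.symm]
  rw [← Finset.add_sum_erase _ F (Finset.mem_univ x), ← Finset.add_sum_erase _ F hy,
    ← Finset.add_sum_erase _ G (Finset.mem_univ x), ← Finset.add_sum_erase _ G hy,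
    Finset.sum_congr rfl fun z hz => h z (Finset.ne_of_mem_erase (Finset.mem_of_mem_erase hz))
      (Finset.ne_of_mem_erase hz)]
  linarith

/-- Move all contents of `y` to `x`. -/
def moveTo (κ : ι → Vec) (x y : ι) : ι → Vec :=
  Function.update (Function.update κ x (κ x + κ y)) y 0

theorem moveTo_swap {ι : Type} [DecidableEq ι] (κ : ι → Vec) {x y : ι} (hxy : x ≠ y) (z : ι) :
    moveTo κ x y (Equiv.swap x y z) = moveTo κ y x z := by
  unfold moveTo
  rcases eq_or_ne z x with rfl | hzx
  · simp
  · rcases eq_or_ne z y with rfl | hzy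
    · simp [hxy, hxy.symm, add_comm]
    · rw [Equiv.swap_apply_of_ne_of_ne hzx hzy]
      simp [hzx, hzy]

theorem tokens_le_moveTo {A : LConf ι} {x y : ι} (hxy : x ≠ y)
    (h : (A.L y).hist <+: (A.L x).hist) (p : ℕ) :
    A.tokens κ p ≤ A.tokens (moveTo κ x y) p := by
  unfold LConf.tokens
  refine add_le_add le_rfl (sum_le_sum_of_pair hxy (fun z hzx hzy => ?_) ?_)
  · simp [moveTo, hzx, hzy]
  · have := delivered_mono h (κ y) p
    simp only [moveTo, Function.update_self, Function.update_of_ne hxy, Life.gain, map_add,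
      Finsupp.add_apply, map_zero, Finsupp.zero_apply]
    push_cast
    have : ((delivered (A.L y).hist (κ y) p : ℕ) : ℤ) ≤ (delivered (A.L x).hist (κ y) p : ℕ) :=
      by exact_mod_cast this
    linarith

theorem tokens_moveTo {A : LConf ι} {x y : ι} (hxy : x ≠ y)
    (h : (A.L y).hist = (A.L x).hist) : A.tokens (moveTo κ x y) = A.tokens κ := by
  funext p
  refine le_antisymm ?_ (tokens_le_moveTo hxy (h ▸ List.prefix_rfl) p)
  unfold LConf.tokens
  refine add_le_add le_rfl (sum_le_sum_of_pair hxy (fun z hzx hzy => ?_) ?_)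
  · simp [moveTo, hzx, hzy]
  · simp only [moveTo, Function.update_self, Function.update_of_ne hxy, Life.gain, map_add,
      Finsupp.add_apply, map_zero, Finsupp.zero_apply, h]
    push_cast
    linarith

/-- Rename the balloons. -/
def LConf.rename (A : LConf ι) (σ : Equiv.Perm ι) : LConf ι := ⟨A.q, A.w, A.L ∘ σ⟩

theorem tokens_rename {ι : Type} [Fintype ι] (A : LConf ι) (σ : Equiv.Perm ι) (κ : ι → Vec) :
    (A.rename σ).tokens κ = A.tokens (κ ∘ σ.symm) := by
  funext p
  unfold LConf.tokens LConf.rename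
  congr 1
  rw [← Equiv.sum_comp σ fun x => (((A.L x).gain ((κ ∘ σ.symm) x) p : ℕ) : ℤ)]
  simp

theorem LStep.rename {A A' : LConf ι} (h : LStep V κ A A') (σ : Equiv.Perm ι) {κ' : ι → Vec}
    (hκ' : ∀ p, 0 ≤ (A'.rename σ).tokens κ' p) : LStep V κ' (A.rename σ) (A'.rename σ) := by
  obtain ⟨⟨e, he, hq, hq', hw, a, l, hl, hL⟩, -⟩ := h
  refine ⟨⟨e, he, hq, hq', hw, σ.symm a, l, by simpa [LConf.rename] using hl, ?_⟩, hκ'⟩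
  simp only [LConf.rename, hL]
  exact Function.update_comp_equiv _ _ _ _

theorem exists_merge {f : ℕ → LConf ι} {n : ℕ} (hf : ∀ t < n, LStep V κ (f t) (f (t + 1)))
    {x y : ι} (hxy : x ≠ y) (h0 : (f 0).L x = (f 0).L y) (hn : (f n).L x = (f n).L y)
    (h00 : (f 0).L x = .none)
    (hgood : ∀ t ≤ n, ((f t).L x).hist.length = ((f t).L y).hist.length →
      ((f t).L x).hist.length < ((f n).L x).hist.length →
      ∃ u ≤ n, ((f u).L x).hist.length = ((f t).L x).hist.length ∧ (f u).L x = (f u).L y) :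
    Relation.ReflTransGen (LStep V (moveTo κ x y)) (f 0) (f n) := by
  have hpre : ∀ z, ∀ {s t}, s ≤ t → t ≤ n → ((f s).L z).hist <+: ((f t).L z).hist := fun z s t =>
    life_rel_of_seq hf (R := fun l l' => l.hist <+: l'.hist) (fun _ => List.prefix_rfl)
      List.IsPrefix.trans (fun _ _ _ _ h => h.hist_mono) z
  obtain ⟨sw, hE, hsw⟩ := exists_switch (p := fun t => ((f t).L x).hist.length)
    (q := fun t => ((f t).L y).hist.length) (E := fun t => (f t).L x = (f t).L y) (n := n)
    (r := ((f n).L x).hist.length) (by simp only [h0])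
    (fun s t hst ht => (hpre x hst ht).length_le) (fun s t hst ht => (hpre y hst ht).length_le)
    (fun t ht => by
      obtain ⟨e, -, a, h1, h2⟩ := (hf t ht).life
      rcases eq_or_ne a x with rfl | hax
      · exact .inr ⟨by simp only [h1 y hxy.symm], h2.length_hist_le⟩
      · refine .inl ⟨by simp only [h1 x hax.symm], ?_⟩
        rcases eq_or_ne a y with rfl | hay
        · exact h2.length_hist_le
        · simp only [h1 y hay.symm]
          exact Nat.le_succ _)
    le_rfl (by simp only [hn]; exact le_rfl)
    (fun t ht h1 h2 => by
      obtain ⟨u, hu, h3, h4⟩ := hgood t ht h1 h2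
      exact ⟨u, hu, h3, by simp only [← h4, h3], h4⟩) n le_rfl
  let σ : Bool → Equiv.Perm ι := fun b => if b then Equiv.swap x y else 1
  have hσ : ∀ t, (f t).L x = (f t).L y → ∀ b, (f t).rename (σ b) = f t := by
    intro t ht b
    cases b
    · rfl
    · have : (f t).L ∘ Equiv.swap x y = (f t).L := by
        funext z
        rcases eq_or_ne z x with rfl | hzx
        · simp [ht]
        · rcases eq_or_ne z y with rfl | hzy
          · simp [ht]
          · simp [Equiv.swap_apply_of_ne_of_ne hzx hzy]
      simp [σ, LConf.rename, this]
  have htok : ∀ t ≤ n, ∀ p, (f t).tokens κ p ≤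
      ((f t).rename (σ (sw t))).tokens (moveTo κ x y) p := by
    intro t ht p
    rw [tokens_rename]
    have hx := hpre x ht le_rfl
    have hy := hpre y ht le_rfl
    rw [← hn] at hy
    cases hs : sw t
    · exact tokens_le_moveTo hxy (List.prefix_of_prefix_length_le hy hx ((hsw t ht).1 hs)) p
    · have : moveTo κ x y ∘ (σ true).symm = moveTo κ y x := by
        funext z
        simp [σ, moveTo_swap κ hxy]
      rw [this]
      exact tokens_le_moveTo hxy.symm (List.prefix_of_prefix_length_le hx hy ((hsw t ht).2 hs)) p
  have hpos : ∀ t < n, ∀ p, 0 ≤ (f (t + 1)).tokens κ p := fun t ht => (hf t ht).2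
  have := reflTransGen_of_seq (R := LStep V (moveTo κ x y))
    (f := fun t => (f t).rename (σ (sw t))) (n := n) fun t ht => by
      have h1 : (f t).rename (σ (sw t)) = (f t).rename (σ (sw (t + 1))) := by
        by_cases h : sw t = sw (t + 1)
        · rw [h]
        · rw [hσ t (hE t ht h), hσ t (hE t ht h)]
      rw [h1]
      exact (hf t ht).rename _ fun p => (hpos t ht p).trans (htok (t + 1) ht p)
  simpa only [hσ 0 h0, hσ n hn] using this

end Merge

section Few

/-- The balloon state. -/
def Life.state : Life → ℕ
  | .act s _ _ => s
  | _ => 0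

variable {ι : Type} [Fintype ι] [DecidableEq ι] {V : VASSB} {κ : ι → Vec}

theorem exists_few_contents {S : Finset ℕ} {Ls : Set Lin} {Hs : Set Hist} {r : ℕ}
    (B : Bounds V S Ls Hs r) (hLs : Ls.Finite) (hHs : Hs.Finite) {s : VConfig} {A : LConf ι}
    (h : Relation.ReflTransGen (LStep V κ) (.start ι s) A)
    (hA : ∀ x, A.L x = .none ∨ ∃ ℓ h, A.L x = .done ℓ h)
    (hper : ∀ x, κ x ∈ (A.L x).lin.periodic) :
    ∃ κ' : ι → Vec, Relation.ReflTransGen (LStep V κ') (.start ι s) A ∧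
      A.tokens κ' = A.tokens κ ∧ (∀ x, κ' x ∈ (A.L x).lin.periodic) ∧
      (Finset.univ.filter fun x => κ' x ≠ 0).card ≤
        Ls.ncard * Hs.ncard * (fun N => (S.card + 1) * N * N)^[r] 2 := by
  classical
  generalize hc : (Finset.univ.filter fun x => κ x ≠ 0).card = c
  induction c using Nat.strong_induction_on generalizing κ with
  | _ c ih =>
  subst hc
  by_cases hle : (Finset.univ.filter fun x => κ x ≠ 0).card ≤
      Ls.ncard * Hs.ncard * (fun N => (S.card + 1) * N * N)^[r] 2
  · exact ⟨κ, h, rfl, hper, hle⟩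
  obtain ⟨f, n, hf0, hfn, hf⟩ := exists_seq_of_reflTransGen h
  have hwithin : ∀ t ≤ n, ∀ x, ((f t).L x).Within S Ls Hs := fun t ht x =>
    life_rel_of_seq hf (R := fun l l' => l.Within S Ls Hs → l'.Within S Ls Hs) (fun _ h => h)
      (fun h h' h'' => h' (h h'')) (fun e he l l' hl hw => B.step he hl hw) x (Nat.zero_le t) ht
      (by rw [hf0]; trivial)
  have hpre : ∀ z, ∀ {s t}, s ≤ t → t ≤ n → ((f s).L z).hist <+: ((f t).L z).hist := fun z s t =>
    life_rel_of_seq hf (R := fun l l' => l.hist <+: l'.hist) (fun _ => List.prefix_rfl)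
      List.IsPrefix.trans (fun _ _ _ _ h => h.hist_mono) z
  have hlin : ∀ z, ∀ {s t}, s ≤ t → t ≤ n → (f s).L z ≠ .none →
      (f t).L z ≠ .none ∧ ((f t).L z).lin = ((f s).L z).lin := fun z s t =>
    life_rel_of_seq hf (R := fun l l' => l ≠ .none → l' ≠ .none ∧ l'.lin = l.lin)
      (fun _ h => ⟨h, rfl⟩) (fun h h' h'' => ⟨(h' (h h'').1).1,
        (h' (h h'').1).2.trans (h h'').2⟩) (fun _ _ _ _ h h' => ⟨h.ne_none h', h.lin_eq h'⟩) z
  have hdone : ∀ z, ∀ {s t}, s ≤ t → t ≤ n → ∀ ℓ h, (f s).L z = .done ℓ h →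
      (f t).L z = .done ℓ h := fun z s t =>
    life_rel_of_seq hf (R := fun l l' => ∀ ℓ h, l = .done ℓ h → l' = .done ℓ h)
      (fun _ _ _ h => h) (fun h h' _ _ h'' => h' _ _ (h _ _ h''))
      (fun _ _ _ _ h _ _ h' => (h' ▸ h).eq_of_done) z
  -- many balloons with nonzero contents share their linear set and their deliveries
  have hfin : ∀ x ∈ Finset.univ.filter (fun x => κ x ≠ 0), ∃ ℓ h, A.L x = .done ℓ h := by
    intro x hx
    refine (hA x).resolve_left fun hnone => ?_
    have h1 := hper x
    rw [hnone] at h1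
    have h2 : {v : Vec | v ∈ (Life.none.lin).2} = ∅ := by ext; simp [Life.lin]
    rw [Lin.periodic, h2, AddSubmonoid.closure_empty, AddSubmonoid.mem_bot] at h1
    exact (Finset.mem_filter.1 hx).2 h1
  have hmaps : ∀ x ∈ Finset.univ.filter (fun x => κ x ≠ 0),
      ((A.L x).lin, (A.L x).hist) ∈ hLs.toFinset ×ˢ hHs.toFinset := by
    intro x hx
    obtain ⟨ℓ, h', hx'⟩ := hfin x hx
    have := hwithin n le_rfl x
    rw [hfn, hx'] at this
    rw [hx', Finset.mem_product, Set.Finite.mem_toFinset, Set.Finite.mem_toFinset]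
    exact this
  obtain ⟨⟨ℓ, h'⟩, -, hcard⟩ := Finset.exists_lt_card_fiber_of_mul_lt_card_of_maps_to
    (n := (fun N => (S.card + 1) * N * N)^[r] 2) hmaps (by
      rw [Finset.card_product, ← Set.ncard_eq_toFinset_card _ hLs,
        ← Set.ncard_eq_toFinset_card _ hHs]
      omega)
  generalize hY₀ : (Finset.univ.filter (fun x => κ x ≠ 0)).filter
    (fun x => ((A.L x).lin, (A.L x).hist) = (ℓ, h')) = Y₀ at hcard
  have hY : ∀ y ∈ Y₀, κ y ≠ 0 ∧ A.L y = .done ℓ h' := by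
    intro y hy
    rw [← hY₀, Finset.mem_filter] at hy
    obtain ⟨ℓ₁, h₁, hy'⟩ := hfin y hy.1
    have h3 := hy.2
    rw [hy'] at h3
    obtain ⟨rfl, rfl⟩ := Prod.mk.inj h3
    exact ⟨(Finset.mem_filter.1 hy.1).2, hy'⟩
  -- a life at a proper intermediate level is determined by the balloon state
  have hact : ∀ y ∈ Y₀, ∀ t ≤ n, ((f t).L y).hist.length ≠ 0 →
      ((f t).L y).hist.length < h'.length → ((f t).L y).state ∈ S ∧ (f t).L y =
        .act ((f t).L y).state ℓ (h'.take ((f t).L y).hist.length) := by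
    intro y hy t ht h1 h2
    have hw := hwithin t ht y
    have hp := hpre y ht le_rfl
    have hl := hlin y ht le_rfl
    have hd := hdone y ht le_rfl
    rw [hfn, (hY y hy).2] at hp hl hd
    cases hL : (f t).L y with
    | none => simp [hL, Life.hist] at h1
    | done ℓ₁ h₁ =>
      obtain ⟨rfl, rfl⟩ := Life.done.inj (hd ℓ₁ h₁ hL)
      simp [hL, Life.hist] at h2
    | act s₁ ℓ₁ h₁ =>
      rw [hL] at hw hp hl
      have h3 : ℓ = ℓ₁ := (hl (by simp)).2
      subst h3
      refine ⟨hw.1, ?_⟩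
      exact congrArg (Life.act s₁ ℓ) (List.prefix_iff_eq_take.1 hp)
  have hstep1 : ∀ y, ∀ t < n, ((f (t + 1)).L y).hist.length ≤ ((f t).L y).hist.length + 1 :=
    fun y t ht => (hf t ht).life_rel (R := fun l l' => l'.hist.length ≤ l.hist.length + 1)
      (fun _ => Nat.le_succ _) (fun _ _ _ _ h => h.length_hist_le) y
  have hzero : ∀ y, (f 0).L y = .none := fun y => by rw [hf0]; rfl
  have hend : ∀ y ∈ Y₀, (f n).L y = .done ℓ h' := fun y hy => by rw [hfn]; exact (hY y hy).2
  obtain ⟨Z, hZ, hZ2, hZg⟩ := exists_subset_pairwise (g := fun N => (S.card + 1) * N * N) (Y₀ := Y₀)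
    (good := fun i x y => ∀ t ≤ n, ((f t).L x).hist.length = i → ((f t).L y).hist.length = i →
      ∃ u ≤ n, ((f u).L x).hist.length = i ∧ (f u).L x = (f u).L y) (by
    intro i N Y hYY hN
    by_cases hi : i ≠ 0 ∧ i < h'.length
    · have hpair : ∀ y : ι, ∃ a b : ℕ, y ∈ Y → a ≤ b ∧
          ∀ t, t ≤ n ∧ ((f t).L y).hist.length = i ↔ a ≤ t ∧ t ≤ b := by
        intro y
        by_cases hy : y ∈ Y
        · obtain ⟨a, b, hab⟩ := exists_level_interval (p := fun t => ((f t).L y).hist.length)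
            (n := n) (i := i) (fun s t hst ht => (hpre y hst ht).length_le) (hstep1 y)
            (by simp [hzero, Life.hist])
            (by simp only [hend y (hYY hy)]; exact hi.2.le)
          exact ⟨a, b, fun _ => hab⟩
        · exact ⟨0, 0, fun h => absurd h hy⟩
      choose a b hab using hpair
      have hact' : ∀ y ∈ Y, ∀ t, a y ≤ t → t ≤ b y → t ≤ n ∧ ((f t).L y).hist.length = i ∧
          ((f t).L y).state ∈ S ∧ (f t).L y = .act ((f t).L y).state ℓ (h'.take i) := by
        intro y hy t h1 h2
        obtain ⟨h3, h4⟩ := ((hab y hy).2 t).2 ⟨h1, h2⟩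
        have := hact y (hYY hy) t h3 (by omega) (by omega)
        rw [h4] at this
        exact ⟨h3, h4, this⟩
      rcases exists_pairwise_meet_or_disjoint S N a b (fun y t => ((f t).L y).state) N Y hN
        (fun y hy => (hab y hy).1) (fun y hy t h1 h2 => (hact' y hy t h1 h2).2.2.1) with
        ⟨Z, hZ, hZN, hg⟩ | ⟨Z, hZ, hZN, hg⟩
      · refine ⟨Z, hZ, hZN, fun x hx y hy hxy t ht h1 h2 => ?_⟩
        obtain ⟨u, hux, huy, hu⟩ := hg x hx y hy
        have e1 := hact' x (hZ hx) u hux.1 hux.2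
        have e2 := hact' y (hZ hy) u huy.1 huy.2
        exact ⟨u, e1.1, e1.2.1, by rw [e1.2.2.2, e2.2.2.2, hu]⟩
      · refine ⟨Z, hZ, hZN, fun x hx y hy hxy t ht h1 h2 => ?_⟩
        have e1 := ((hab x (hZ hx)).2 t).1 ⟨ht, h1⟩
        have e2 := ((hab y (hZ hy)).2 t).1 ⟨ht, h2⟩
        have := hg x hx y hy hxy
        omega
    · have hNg : N ≤ (S.card + 1) * N * N := by
        rcases Nat.eq_zero_or_pos N with rfl | hN0
        · simp
        · exact Nat.le_mul_of_pos_left N (by positivity)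
      refine ⟨Y, subset_rfl, hNg.trans hN, fun x hx y hy hxy t ht h1 h2 => ?_⟩
      rcases eq_or_ne i 0 with rfl | hi0
      · exact ⟨0, Nat.zero_le _, by simp [hzero, Life.hist], by simp [hzero]⟩
      · have h3 := (hpre x ht le_rfl).length_le
        rw [hend x (hYY hx)] at h3
        refine ⟨n, le_rfl, ?_, by rw [hend x (hYY hx), hend y (hYY hy)]⟩
        rw [hend x (hYY hx)]
        have : (Life.done ℓ h').hist.length = h'.length := rfl
        omega) r 2 Y₀ subset_rfl hcard.le
  obtain ⟨x, hx, y, hy, hxy⟩ := Finset.one_lt_card.1 hZ2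
  have hx' := hY x (hZ hx)
  have hy' := hY y (hZ hy)
  have hmerge := exists_merge hf hxy (by rw [hzero, hzero])
    (by rw [hend x (hZ hx), hend y (hZ hy)]) (hzero x) (fun t ht h1 h2 => by
      refine hZg _ (lt_of_lt_of_le h2 ?_) x hx y hy hxy t ht rfl h1.symm
      have := hwithin n le_rfl x
      rw [hend x (hZ hx)] at this ⊢
      exact B.length_le _ this.2)
  rw [hf0, hfn] at hmerge
  have hlt : (Finset.univ.filter fun z => moveTo κ x y z ≠ 0).card <
      (Finset.univ.filter fun z => κ z ≠ 0).card := by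
    refine Finset.card_lt_card (Finset.ssubset_iff_of_subset (fun z hz => ?_) |>.2
      ⟨y, by simp [hy'.1], fun hc => (Finset.mem_filter.1 hc).2 (by simp [moveTo])⟩)
    simp only [Finset.mem_filter, Finset.mem_univ, true_and] at hz ⊢
    intro hz0
    rcases eq_or_ne z y with rfl | hzy
    · exact hy'.1 hz0
    · rcases eq_or_ne z x with rfl | hzx
      · exact hx'.1 hz0
      · simp [moveTo, hzy, hzx, hz0] at hz
  obtain ⟨κ', h1, h2, h3, h4⟩ := ih _ hlt hmerge (fun z => by
    rcases eq_or_ne z y with rfl | hzy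
    · simp [moveTo]
    · rcases eq_or_ne z x with rfl | hzx
      · simp only [moveTo, Function.update_of_ne hxy, Function.update_self]
        refine add_mem (hper z) ?_
        have := hper y
        rwa [hy'.2, ← hx'.2] at this
      · simp only [moveTo, Function.update_of_ne hzy, Function.update_of_ne hzx]
        exact hper z) rfl
  exact ⟨κ', h1, h2.trans (tokens_moveTo hxy (by rw [hx'.2, hy'.2])), h3, h4⟩

end Few

section MultisetNets

variable {α : Type*}

/-- A step of a Petri net whose transitions are pairs of multisets of places. -/
def MStep (T : Set (Multiset α × Multiset α)) (M M' : Multiset α) : Prop :=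
  ∃ t ∈ T, ∃ z, M = z + t.1 ∧ M' = z + t.2

/-- Reachability in a Petri net. -/
def MReach (T : Set (Multiset α × Multiset α)) : Multiset α → Multiset α → Prop :=
  Relation.ReflTransGen (MStep T)

variable {T : Set (Multiset α × Multiset α)}

theorem MReach.of_mem {t : Multiset α × Multiset α} (h : t ∈ T) : MReach T t.1 t.2 :=
  .single ⟨t, h, 0, by simp, by simp⟩

theorem MReach.add_left {M M' : Multiset α} (h : MReach T M M') (z : Multiset α) :
    MReach T (z + M) (z + M') := by
  refine Relation.ReflTransGen.lift (z + ·) (fun a b hab => ?_) _ _ h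
  obtain ⟨t, ht, w, rfl, rfl⟩ := hab
  exact ⟨t, ht, z + w, by simp only [add_assoc], by simp only [add_assoc]⟩

theorem MReach.trans_eq {a b b' c a' c' : Multiset α} (h : MReach T a b) (h' : MReach T b' c)
    (hb : b = b') (ha : a' = a) (hc : c' = c) : MReach T a' c' := by
  subst hb ha hc
  exact h.trans h'

theorem MReach.add_right {M M' : Multiset α} (h : MReach T M M') (z : Multiset α) :
    MReach T (M + z) (M' + z) := by
  simpa only [add_comm z] using h.add_left z

/-- A catalyst `c` that turns each place `a` of `w` into `f a` turns `w` into `f w`. -/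
theorem MReach.bind {c w : Multiset α} {f : α → Multiset α}
    (h : ∀ a ∈ w, MReach T (c + {a}) (c + f a)) : MReach T (c + w) (c + w.bind f) := by
  induction w using Multiset.induction_on with
  | empty => exact .refl
  | cons a w ih =>
    rw [Multiset.cons_bind, ← Multiset.singleton_add, add_comm {a} w, ← add_assoc]
    refine ((ih fun b hb => h b (Multiset.mem_cons_of_mem hb)).add_right {a}).trans ?_
    rw [add_right_comm, ← add_assoc]
    exact (h a (Multiset.mem_cons_self a w)).add_right _

end MultisetNets

section BalloonNet

/-- The places of the net simulating a VASSB. A balloon occupies a slot `j`; the periodic part of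
the contents of a balloon in a slot `j ≥ 1` is present explicitly. -/
inductive Tok : Type
  | pl (p : ℕ) : Tok
  | ctl (q : ℕ) : Tok
  | fr (j : ℕ) : Tok
  | sb (j s : ℕ) (ℓ : Lin) (h : Hist) : Tok
  | dn (j : ℕ) (ℓ : Lin) (h : Hist) : Tok
  | ex (j π : ℕ) : Tok

/-- Tokens in the places of the VASSB. -/
def plv (v : Vec) : Multiset Tok := (Finsupp.toMultiset v).map .pl

/-- Periodic contents of the balloon in slot `j`. -/
def exv (j : ℕ) (v : Vec) : Multiset Tok := (Finsupp.toMultiset v).map (.ex j)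

/-- The token for the free slot `j`, if `j` is a proper slot. -/
def frm (j : ℕ) : Multiset Tok := if j = 0 then 0 else {.fr j}

/-- The transitions of the net simulating a VASSB. -/
inductive NetT (V : VASSB) (K : ℕ) (S : Finset ℕ) (Ls : Set Lin) (Hs : Set Hist) :
    Multiset Tok × Multiset Tok → Prop
  | delta {q q' d} (he : (q, .delta d, q') ∈ V.edges) : NetT V K S Ls Hs
      ({.ctl q} + plv (d.mapRange (fun n => (-n).toNat) rfl),
        {.ctl q'} + plv (d.mapRange Int.toNat rfl))
  | inflate {j q q' s L ℓ} (hj : j ≤ K) (he : (q, .inflate s L, q') ∈ V.edges) (hℓ : ℓ ∈ L) :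
      NetT V K S Ls Hs ({.ctl q} + frm j, {.ctl q'} + {.sb j s ℓ []})
  | deflate {j q q' s s' π p ℓ h} (hj : j ≤ K) (he : (q, .deflate s s' π p, q') ∈ V.edges)
      (hℓ : ℓ ∈ Ls) (hh : h ∈ Hs) : NetT V K S Ls Hs ({.ctl q} + {.sb j s ℓ h},
        {.ctl q'} + {.sb j s' ℓ (h.push π p)} + plv (Finsupp.single p (undelivered h ℓ.1 π)))
  | burst {j q q' s ℓ h} (hj : j ≤ K) (he : (q, .burst s, q') ∈ V.edges) (hℓ : ℓ ∈ Ls)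
      (hh : h ∈ Hs) : NetT V K S Ls Hs ({.ctl q} + {.sb j s ℓ h}, {.ctl q'} + {.dn j ℓ h})
  | fill {j s ℓ v} (hj : 1 ≤ j) (hj' : j ≤ K) (hs : s ∈ S) (hℓ : ℓ ∈ Ls) (hv : v ∈ ℓ.2) :
      NetT V K S Ls Hs ({.sb j s ℓ []}, {.sb j s ℓ []} + exv j v)
  | deliver {j s ℓ h π p} (hj : 1 ≤ j) (hj' : j ≤ K) (hs : s ∈ S) (hℓ : ℓ ∈ Ls) (hh : h ∈ Hs)
      (hp : h.lookup π = some p) :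
      NetT V K S Ls Hs ({.sb j s ℓ h} + {.ex j π}, {.sb j s ℓ h} + {.pl p})
  | trash {j ℓ h π v} (hj : 1 ≤ j) (hj' : j ≤ K) (hℓ : ℓ ∈ Ls) (hh : h ∈ Hs) (hv : v ∈ ℓ.2)
      (hπ : v π ≠ 0) (hp : h.lookup π = none) :
      NetT V K S Ls Hs ({.dn j ℓ h} + {.ex j π}, {.dn j ℓ h})
  | dropFree {j} (hj : 1 ≤ j) (hj' : j ≤ K) : NetT V K S Ls Hs ({.fr j}, 0)
  | dropDone {j ℓ h} (hj : j ≤ K) (hℓ : ℓ ∈ Ls) (hh : h ∈ Hs) :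
      NetT V K S Ls Hs ({.dn j ℓ h}, 0)

/-- The net simulating a VASSB. -/
abbrev netSet (V : VASSB) (K : ℕ) (S : Finset ℕ) (Ls : Set Lin) (Hs : Set Hist) :
    Set (Multiset Tok × Multiset Tok) := {t | NetT V K S Ls Hs t}

/-- The initial marking of the net. -/
def netStart (K : ℕ) (s : VConfig) : Multiset Tok :=
  {.ctl s.q} + plv s.m + (Finset.Icc 1 K).val.map .fr

/-- The final marking of the net. -/
def netEnd (s : VConfig) : Multiset Tok := {.ctl s.q} + plv s.m

theorem plv_add (u v : Vec) : plv (u + v) = plv u + plv v := by simp [plv]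

theorem exv_add (j : ℕ) (u v : Vec) : exv j (u + v) = exv j u + exv j v := by simp [exv]

@[simp] theorem exv_zero (j : ℕ) : exv j 0 = 0 := by simp [exv]

variable {V : VASSB} {K : ℕ} {S : Finset ℕ} {Ls : Set Lin} {Hs : Set Hist}

theorem net_fill {j s : ℕ} {ℓ : Lin} (hj : 1 ≤ j) (hj' : j ≤ K) (hs : s ∈ S) (hℓ : ℓ ∈ Ls)
    {u : Vec} (hu : u ∈ ℓ.periodic) : MReach (netSet V K S Ls Hs) {.sb j s ℓ []} ({.sb j s ℓ []} + exv j u) := by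
  induction hu using AddSubmonoid.closure_induction with
  | mem v hv => exact MReach.of_mem (NetT.fill hj hj' hs hℓ hv)
  | zero =>
    rw [exv_zero, add_zero]
    exact .refl
  | add u v _ _ h1 h2 =>
    rw [exv_add, ← add_assoc]
    exact h2.trans (h1.add_right (exv j v))

theorem mem_exv {j : ℕ} {v : Vec} {t : Tok} : t ∈ exv j v ↔ ∃ π, v π ≠ 0 ∧ t = .ex j π := by
  simp only [exv, Multiset.mem_map, Finsupp.mem_toMultiset, Finsupp.mem_support_iff]
  exact ⟨fun ⟨π, h, h'⟩ => ⟨π, h, h'.symm⟩, fun ⟨π, h, h'⟩ => ⟨π, h, h'.symm⟩⟩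

theorem net_deliver {j s π p : ℕ} {ℓ : Lin} {h : Hist} (hj : 1 ≤ j) (hj' : j ≤ K) (hs : s ∈ S)
    (hℓ : ℓ ∈ Ls) (hh : h ∈ Hs) (hp : h.lookup π = some p) (n : ℕ) :
    MReach (netSet V K S Ls Hs) ({.sb j s ℓ h} + exv j (Finsupp.single π n))
      ({.sb j s ℓ h} + plv (Finsupp.single p n)) := by
  have h1 : plv (Finsupp.single p n) = (exv j (Finsupp.single π n)).bind fun _ => {.pl p} := by
    simp [plv, exv, Finsupp.toMultiset_single, Multiset.nsmul_singleton]
  rw [h1]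
  refine MReach.bind fun a ha => ?_
  obtain ⟨π', h2, rfl⟩ := mem_exv.1 ha
  obtain rfl : π = π' := by
    by_contra hne
    exact h2 (Finsupp.single_eq_of_ne' hne)
  exact MReach.of_mem (NetT.deliver hj hj' hs hℓ hh hp)

theorem exists_period_of_mem_periodic {ℓ : Lin} {u : Vec} (hu : u ∈ ℓ.periodic) {π : ℕ}
    (h : u π ≠ 0) : ∃ v ∈ ℓ.2, v π ≠ 0 := by
  induction hu using AddSubmonoid.closure_induction with
  | mem v hv => exact ⟨v, hv, h⟩
  | zero => exact absurd rfl h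
  | add u v _ _ h1 h2 =>
    by_cases hu : u π = 0
    · exact h2 fun hv => h (by rw [Finsupp.add_apply, hu, hv])
    · exact h1 hu

theorem net_trash {j : ℕ} {ℓ : Lin} {h : Hist} (hj : 1 ≤ j) (hj' : j ≤ K)
    (hℓ : ℓ ∈ Ls) (hh : h ∈ Hs) {u : Vec} (hu : u ∈ ℓ.periodic) :
    MReach (netSet V K S Ls Hs) ({.dn j ℓ h} + exv j (undelivered h u)) {.dn j ℓ h} := by
  have := MReach.bind (T := netSet V K S Ls Hs) (c := {.dn j ℓ h})
    (w := exv j (undelivered h u)) (f := fun _ => 0) fun a ha => by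
      obtain ⟨π, h2, rfl⟩ := mem_exv.1 ha
      rw [undelivered_apply] at h2
      split_ifs at h2 with h3
      · obtain ⟨v, hv, hv'⟩ := exists_period_of_mem_periodic hu h2
        rw [add_zero]
        exact MReach.of_mem (NetT.trash hj hj' hℓ hh hv hv' h3)
      · exact absurd rfl h2
  simpa using this

/-- The tokens for a balloon in slot `j` whose contents have the periodic part `u`. -/
def lifeTok (j : ℕ) (u : Vec) : Life → Multiset Tok
  | .none => frm j
  | .act s ℓ h => {.sb j s ℓ h} + exv j (undelivered h u)
  | .done _ _ => 0

theorem net_lifeStep {r : ℕ} (B : Bounds V S Ls Hs r) {q q' : ℕ} {o : VOp}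
    (he : (q, o, q') ∈ V.edges) {l l' : Life} (hl : LifeStep o l l') (hw : l.Within S Ls Hs)
    {j : ℕ} {u : Vec} (hj : j ≤ K) (hju : j = 0 ↔ u = 0)
    (hu : l' ≠ .none → u ∈ l'.lin.periodic) {m m' : Vec}
    (hm : ∀ p, (m' p : ℤ) + l.gain u p = m p + o.weight p + l'.gain u p) :
    MReach (netSet V K S Ls Hs) ({.ctl q} + plv m + lifeTok j u l) ({.ctl q'} + plv m' + lifeTok j u l') := by
  cases hl with
  | delta d =>
    have h1 : m = (m - d.mapRange (fun n => (-n).toNat) rfl) +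
        d.mapRange (fun n => (-n).toNat) rfl := by
      ext p
      have : (m' p : ℤ) = m p + d p := by
        have := hm p
        simp only [VOp.weight] at this
        omega
      simp only [Finsupp.add_apply, Finsupp.tsub_apply, Finsupp.mapRange_apply]
      omega
    have h2 : m' = (m - d.mapRange (fun n => (-n).toNat) rfl) + d.mapRange Int.toNat rfl := by
      ext p
      have : (m' p : ℤ) = m p + d p := by
        have := hm p
        simp only [VOp.weight] at this
        omega
      simp only [Finsupp.add_apply, Finsupp.tsub_apply, Finsupp.mapRange_apply]
      omega
    rw [h2, h1, plv_add, plv_add, ← h1]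
    refine MReach.add_right ?_ _
    have := (MReach.of_mem (T := netSet V K S Ls Hs) (NetT.delta he)).add_left
      (plv (m - d.mapRange (fun n => (-n).toNat) rfl))
    simpa only [add_left_comm] using this
  | inflate s hℓ =>
    rename_i L ℓ
    obtain rfl : m' = m := by
      ext p
      have := hm p
      simp only [VOp.weight, Life.gain, Life.hist, delivered_nil] at this
      simpa using this
    simp only [lifeTok, undelivered_nil]
    have h1 := (MReach.of_mem (T := netSet V K S Ls Hs) (NetT.inflate hj he hℓ)).add_left
      (plv m')
    have h2 : MReach (netSet V K S Ls Hs) {.sb j s ℓ []} ({.sb j s ℓ []} + exv j u) := by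
      rcases Nat.eq_zero_or_pos j with h0 | h0
      · rw [hju.1 h0, exv_zero, add_zero]
        exact .refl
      · exact net_fill h0 hj (B.inflate he).1 ((B.inflate he).2 _ hℓ) (hu (by simp))
    have h3 := h2.add_left ({.ctl q'} + plv m')
    rw [add_comm {Tok.ctl q}, add_assoc]
    refine h1.trans ?_
    rw [← add_assoc, add_comm (plv m')]
    exact h3
  | deflate s s' π p ℓ h =>
    have h0 : m' = m + Finsupp.single p (undelivered h ℓ.1 π) +
        Finsupp.single p (undelivered h u π) := by
      ext p'
      have := hm p'
      simp only [VOp.weight, Life.gain, Life.hist, Life.lin, delivered_push, map_add,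
        Finsupp.add_apply, Pi.zero_apply] at this ⊢
      push_cast at this
      omega
    have h1 : undelivered h u =
        undelivered (h.push π p) u + Finsupp.single π (undelivered h u π) := by
      rw [undelivered_push, add_comm, Finsupp.single_add_erase]
    have h2 : MReach (netSet V K S Ls Hs) ({.sb j s' ℓ (h.push π p)} + exv j (Finsupp.single π (undelivered h u π)))
        ({.sb j s' ℓ (h.push π p)} + plv (Finsupp.single p (undelivered h u π))) := by
      by_cases h3 : undelivered h u π = 0
      · simp only [h3, Finsupp.single_zero, exv_zero, add_zero, plv]
        exact .refl
      · have h4 : h.lookup π = none := by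
          by_contra h4
          exact h3 (by rw [undelivered_apply, if_neg h4])
        have h5 : u ≠ 0 := by
          rintro rfl
          simp at h3
        refine net_deliver ?_ hj (B.deflate he).1 hw.2.1 ((B.deflate he).2 _ hw.2.2) ?_ _
        · rw [Nat.one_le_iff_ne_zero]
          exact fun h => h5 (hju.1 h)
        · rw [Hist.lookup_push, if_pos ⟨h4, rfl⟩]
    simp only [lifeTok]
    generalize hn : undelivered h u π = n at *
    rw [h0, h1, exv_add, plv_add, plv_add]
    have h6 := (MReach.of_mem (T := netSet V K S Ls Hs)
      (NetT.deflate hj he hw.2.1 hw.2.2)).add_left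
        (plv m + exv j (undelivered (h.push π p) u) + exv j (Finsupp.single π n))
    have h7 := h2.add_left (plv m + exv j (undelivered (h.push π p) u) + {.ctl q'} +
      plv (Finsupp.single p (undelivered h ℓ.1 π)))
    exact h6.trans_eq h7 (by dsimp only; ac_rfl) (by dsimp only; ac_rfl) (by ac_rfl)
  | burst s ℓ h =>
    obtain rfl : m' = m := by
      ext p
      have := hm p
      simp only [VOp.weight, Life.gain, Life.hist, Life.lin, Pi.zero_apply] at this
      omega
    simp only [lifeTok, add_zero]
    have h1 := (MReach.of_mem (T := netSet V K S Ls Hs)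
      (NetT.burst hj he hw.2.1 hw.2.2)).add_left (plv m' + exv j (undelivered h u))
    have h2 : MReach (netSet V K S Ls Hs) ({.dn j ℓ h} + exv j (undelivered h u)) {.dn j ℓ h} := by
      rcases Nat.eq_zero_or_pos j with h0 | h0
      · rw [hju.1 h0, map_zero, exv_zero, add_zero]
        exact .refl
      · exact net_trash h0 hj hw.2.1 hw.2.2 (hu (by simp))
    have h3 := (h2.trans_eq (MReach.of_mem (NetT.dropDone hj hw.2.1 hw.2.2)) rfl rfl rfl).add_left
      ({.ctl q'} + plv m')
    rw [add_zero] at h3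
    exact h1.trans_eq h3 (by dsimp only; ac_rfl) (by dsimp only; ac_rfl) (by ac_rfl)

end BalloonNet

section NetCompleteness

variable {V : VASSB} {K : ℕ} {S : Finset ℕ} {Ls : Set Lin} {Hs : Set Hist} {r : ℕ}
  {ι : Type} [Fintype ι]

/-- The marking representing a configuration with identified balloons. -/
def LConf.marking (sl : ι → ℕ) (κ : ι → Vec) (A : LConf ι) (m : Vec) : Multiset Tok :=
  {.ctl A.q} + plv m + ∑ x, lifeTok (sl x) (κ x) (A.L x)

theorem VOp.exists_weight (o : VOp) : ∃ w : ZVec, ∀ p, o.weight p = w p := by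
  cases o with
  | delta d => exact ⟨d, fun _ => rfl⟩
  | _ => exact ⟨0, fun _ => rfl⟩

variable [DecidableEq ι]

theorem net_reach (B : Bounds V S Ls Hs r) {κ : ι → Vec} {s : VConfig} {A : LConf ι}
    (h : Relation.ReflTransGen (LStep V κ) (.start ι s) A) {sl : ι → ℕ} (hsl : ∀ x, sl x ≤ K)
    (hsl0 : ∀ x, sl x = 0 ↔ κ x = 0) (hper : ∀ x, A.L x ≠ .none → κ x ∈ (A.L x).lin.periodic) :
    ∃ m : Vec, (∀ p, (m p : ℤ) = A.tokens κ p) ∧ (∀ x, (A.L x).Within S Ls Hs) ∧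
      MReach (netSet V K S Ls Hs) ((LConf.start ι s).marking sl κ s.m) (A.marking sl κ m) := by
  induction h with
  | refl =>
    exact ⟨s.m, fun p => by simp [LConf.tokens, LConf.start, Life.gain, Life.hist],
      fun x => trivial, .refl⟩
  | @tail A A' _ hstep ih =>
    obtain ⟨⟨e, he, hq, hq', hw, a, l, hl, hL⟩, hpos⟩ := hstep
    have hper' : ∀ x, A.L x ≠ .none → κ x ∈ (A.L x).lin.periodic := by
      intro x hx
      rcases eq_or_ne x a with rfl | hxa
      · have h1 := hper x
        rw [hL, Function.update_self, hl.lin_eq hx] at h1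
        exact h1 (hl.ne_none hx)
      · have h1 := hper x
        rw [hL, Function.update_of_ne hxa] at h1
        exact h1 hx
    obtain ⟨m, hm, hwit, hreach⟩ := ih hper'
    obtain ⟨w, hw'⟩ := e.2.1.exists_weight
    have htok : ∀ p, A'.tokens κ p + (A.L a).gain (κ a) p =
        m p + w p + l.gain (κ a) p := by
      intro p
      have e2 := sum_update_life (fun x l => ((l.gain (κ x) p : ℕ) : ℤ)) A.L a l
      rw [hm]
      simp only [LConf.tokens, hw, hL, Pi.add_apply, hw'] at e2 ⊢
      linarith
    let c : Vec → ZVec := fun v => v.mapRange (fun n : ℕ => (n : ℤ)) rfl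
    let m' : Vec :=
      (c m + w + c (l.gain (κ a)) - c ((A.L a).gain (κ a))).mapRange Int.toNat rfl
    have hm' : ∀ p, (m' p : ℤ) = A'.tokens κ p := by
      intro p
      have h1 := htok p
      have h2 := hpos p
      simp only [m', c, Finsupp.mapRange_apply, Finsupp.add_apply, Finsupp.sub_apply]
      omega
    refine ⟨m', hm', fun x => ?_, hreach.trans ?_⟩
    · rw [hL]
      rcases eq_or_ne x a with rfl | hxa
      · rw [Function.update_self]
        exact B.step he hl (hwit x)
      · rw [Function.update_of_ne hxa]
        exact hwit x
    · have h1 := net_lifeStep B (q := e.1) (q' := e.2.2) (o := e.2.1) he hl (hwit a) (hsl a)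
        (hsl0 a) (u := κ a)
        (fun hl' => by
          have h1 := hper a
          rw [hL, Function.update_self] at h1
          exact h1 hl') (m := m) (m' := m') (fun p => by rw [hm', htok, hw'])
      have h2 := h1.add_right (∑ x ∈ Finset.univ.erase a, lifeTok (sl x) (κ x) (A.L x))
      have h3 : ∑ x ∈ Finset.univ.erase a, lifeTok (sl x) (κ x) (A.L x) =
          ∑ x ∈ Finset.univ.erase a, lifeTok (sl x) (κ x) (A'.L x) :=
        Finset.sum_congr rfl fun x hx => by
          rw [hL, Function.update_of_ne (Finset.ne_of_mem_erase hx)]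
      have h4 : l = A'.L a := by rw [hL, Function.update_self]
      rw [add_assoc, Finset.add_sum_erase _ (fun x => lifeTok (sl x) (κ x) (A.L x))
        (Finset.mem_univ a), h3, h4, add_assoc _ (lifeTok _ _ (A'.L a)),
        Finset.add_sum_erase _ (fun x => lifeTok (sl x) (κ x) (A'.L x)) (Finset.mem_univ a), ← hq,
        ← hq'] at h2
      exact h2

theorem net_dropFree {J : Multiset ℕ} (hJ : ∀ j ∈ J, 1 ≤ j ∧ j ≤ K) :
    MReach (netSet V K S Ls Hs) (J.map .fr) 0 := by
  have := MReach.bind (T := netSet V K S Ls Hs) (c := 0) (w := J.map .fr) (f := fun _ => 0)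
    fun a ha => by
      obtain ⟨j, hj, rfl⟩ := Multiset.mem_map.1 ha
      exact (MReach.of_mem (NetT.dropFree (hJ j hj).1 (hJ j hj).2)).add_left 0
  simpa using this

theorem net_complete (B : Bounds V S Ls Hs r) (hLs : Ls.Finite) (hHs : Hs.Finite)
    (hK : Ls.ncard * Hs.ncard * (fun N => (S.card + 1) * N * N)^[r] 2 ≤ K) {s s' : VConfig}
    (hs : IsSemi s) (hs' : IsSemi s') (h : VReach V s s') :
    MReach (netSet V K S Ls Hs) (netStart K s) (netEnd s') := by
  obtain ⟨n, hn⟩ := exists_represents hs h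
  obtain ⟨κ, A, hA, hrep, -⟩ := hn (Fin n) (by simp)
  have hfin : ∀ x, A.L x = .none ∨ ∃ ℓ h, A.L x = .done ℓ h := by
    intro x
    cases hx : A.L x with
    | none => exact .inl rfl
    | done ℓ h => exact .inr ⟨ℓ, h, rfl⟩
    | act σ ℓ h =>
      exfalso
      have h1 := hrep.bag
      rw [show s'.bag = 0 from hs'] at h1
      have h2 : (σ, undelivered h (ℓ.1 + κ x)) ∈ ∑ x, (A.L x).bag (κ x) := by
        rw [Multiset.mem_sum]
        refine ⟨x, Finset.mem_univ x, ?_⟩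
        rw [hx]
        exact Multiset.mem_singleton_self _
      rw [← h1] at h2
      simp at h2
  obtain ⟨κ', hA', htok, hper, hcard⟩ := exists_few_contents B hLs hHs hA hfin hrep.periodic
  have hcard' := hcard.trans hK
  let Y := Finset.univ.filter (κ' · ≠ 0)
  let sl : Fin n → ℕ := fun x => if hx : x ∈ Y then Y.equivFin ⟨x, hx⟩ + 1 else 0
  have hsl : ∀ x, sl x ≤ K := by
    intro x
    simp only [sl]
    split_ifs with hx
    · exact (Y.equivFin ⟨x, hx⟩).isLt.trans_le hcard'
    · exact Nat.zero_le _
  have hsl0 : ∀ x, sl x = 0 ↔ κ' x = 0 := by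
    intro x
    simp only [sl]
    split_ifs with hx
    · simpa [Y] using hx
    · simpa [Y] using hx
  have hinj : Set.InjOn sl Y := by
    intro x hx y hy hxy
    simp only [sl, dif_pos (Finset.mem_coe.1 hx), dif_pos (Finset.mem_coe.1 hy),
      Nat.add_right_cancel_iff, Fin.val_inj, EmbeddingLike.apply_eq_iff_eq] at hxy
    exact congrArg Subtype.val hxy
  obtain ⟨m, hm, -, hreach⟩ := net_reach B hA' hsl hsl0 fun x _ => hper x
  have hend : A.marking sl κ' m = netEnd s' := by
    unfold LConf.marking netEnd
    have h1 : m = s'.m := by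
      ext p
      have h1 := hm p
      rw [htok, ← hrep.m] at h1
      exact_mod_cast h1
    rw [h1, hrep.q, Finset.sum_eq_zero, add_zero]
    intro x _
    rcases hfin x with hx | ⟨ℓ, h, hx⟩
    · have h2 := hper x
      rw [hx] at h2 ⊢
      have h3 : κ' x = 0 := by simpa [Life.lin, Lin.periodic] using h2
      simp [lifeTok, frm, (hsl0 x).2 h3]
    · rw [hx]
      rfl
  rw [hend] at hreach
  -- drop the unused slots
  have hsub : (Y.val.map sl) ≤ (Finset.Icc 1 K).val := by
    rw [Multiset.le_iff_subset (Multiset.Nodup.map_on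
      (fun x hx y hy hxy => hinj hx hy hxy) Y.nodup)]
    intro j hj
    obtain ⟨x, hx, rfl⟩ := Multiset.mem_map.1 hj
    rw [Finset.mem_val, Finset.mem_Icc]
    refine ⟨?_, hsl x⟩
    rw [Nat.one_le_iff_ne_zero, Ne, hsl0]
    simpa [Y] using hx
  obtain ⟨J, hJ⟩ := Multiset.le_iff_exists_add.1 hsub
  have hstart : netStart K s = (LConf.start (Fin n) s).marking sl κ' s.m + J.map .fr := by
    unfold netStart LConf.marking
    rw [hJ, Multiset.map_add, add_assoc _ (∑ x, _)]
    congr 2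
    rw [Multiset.map_map]
    have h1 : ∀ x, lifeTok (sl x) (κ' x) ((LConf.start (Fin n) s).L x) =
        if κ' x ≠ 0 then {Tok.fr (sl x)} else 0 := by
      intro x
      simp only [lifeTok, LConf.start, frm, hsl0, ite_not]
    simp only [h1]
    rw [← Finset.sum_filter]
    rw [← Multiset.sum_map_singleton (Multiset.map (Tok.fr ∘ sl) Y.val), Multiset.map_map]
    rfl
  rw [hstart]
  have h5 := (net_dropFree (V := V) (S := S) (Ls := Ls) (Hs := Hs) (J := J) (K := K) fun j hj => by
    have : j ∈ (Finset.Icc 1 K).val := by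
      rw [hJ]
      exact Multiset.mem_add.2 (.inr hj)
    simpa using this).add_left ((LConf.start (Fin n) s).marking sl κ' s.m)
  rw [add_zero] at h5
  exact h5.trans hreach

end NetCompleteness

section NetSoundness

/-- The sum over a marking of a function on the places. -/
def Tok.sum {β : Type*} [AddCommMonoid β] (g : Tok → β) : Multiset Tok →+ β :=
  Multiset.sumAddMonoidHom.comp (Multiset.mapAddMonoidHom g)

/-- The periodic contents present in slot `j`. -/
def Tok.content (j : ℕ) : Tok → Vec
  | .ex j' π => if j' = j then Finsupp.single π 1 else 0
  | _ => 0

/-- The linear sets of the balloons in slot `j`. -/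
def Tok.own (j : ℕ) : Tok → Multiset Lin
  | .sb j' _ ℓ _ => if j' = j then {ℓ} else 0
  | .dn j' ℓ _ => if j' = j then {ℓ} else 0
  | _ => 0

/-- The occupation of slot `j`. -/
def Tok.slot (j : ℕ) : Tok → ℕ
  | .fr j' => if j' = j then 1 else 0
  | .sb j' _ _ _ => if j' = j then 1 else 0
  | .dn j' _ _ => if j' = j then 1 else 0
  | _ => 0

/-- The state of the VASSB. -/
def Tok.state : Tok → Multiset ℕ
  | .ctl q => {q}
  | _ => 0

/-- The tokens in the places of the VASSB, if the balloon in slot `j` was inflated with the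
periodic part `X j`. -/
def Tok.place (X : ℕ → Vec) : Tok → Vec
  | .pl p => Finsupp.single p 1
  | .sb j _ _ h => delivered h (X j)
  | .dn j _ h => delivered h (X j)
  | _ => 0

/-- The balloons, if the balloon in slot `j` was inflated with the periodic part `X j`. -/
def Tok.balloon (X : ℕ → Vec) : Tok → Multiset Balloon
  | .sb j s ℓ h => {(s, undelivered h (ℓ.1 + X j))}
  | _ => 0

section
variable {β : Type*} [AddCommMonoid β] (g : Tok → β)

@[simp] theorem Tok.sum_singleton (t : Tok) : Tok.sum g {t} = g t := by
  simp [Tok.sum]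

@[simp] theorem Tok.sum_cons (t : Tok) (M : Multiset Tok) :
    Tok.sum g (t ::ₘ M) = g t + Tok.sum g M := by
  simp [Tok.sum]

theorem Tok.sum_eq_zero {M : Multiset Tok} (h : ∀ t ∈ M, g t = 0) : Tok.sum g M = 0 := by
  refine Multiset.sum_eq_zero fun x hx => ?_
  obtain ⟨t, ht, rfl⟩ := Multiset.mem_map.1 hx
  exact h t ht

theorem Tok.sum_congr {g g' : Tok → β} {M : Multiset Tok} (h : ∀ t ∈ M, g t = g' t) :
    Tok.sum g M = Tok.sum g' M :=
  congrArg Multiset.sum (Multiset.map_congr rfl h)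

theorem mem_plv {v : Vec} {t : Tok} (h : t ∈ plv v) : ∃ p, t = .pl p := by
  obtain ⟨p, -, rfl⟩ := Multiset.mem_map.1 h
  exact ⟨p, rfl⟩

theorem Tok.sum_plv (h : ∀ p, g (.pl p) = 0) (v : Vec) : Tok.sum g (plv v) = 0 :=
  Tok.sum_eq_zero g fun t ht => by
    obtain ⟨p, rfl⟩ := mem_plv ht
    exact h p

theorem Tok.sum_exv (h : ∀ j π, g (.ex j π) = 0) (j : ℕ) (v : Vec) : Tok.sum g (exv j v) = 0 :=
  Tok.sum_eq_zero g fun t ht => by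
    obtain ⟨p, -, rfl⟩ := mem_exv.1 ht
    exact h j p

end

@[simp] theorem Tok.place_plv (X : ℕ → Vec) (v : Vec) : Tok.sum (Tok.place X) (plv v) = v := by
  induction v using Finsupp.induction_linear with
  | zero => simp [plv]
  | add u v hu hv => rw [plv_add, map_add, hu, hv]
  | single p n =>
    rw [plv, Finsupp.toMultiset_single, Multiset.map_nsmul, Multiset.map_singleton, map_nsmul,
      Tok.sum_singleton, Tok.place, Finsupp.smul_single, smul_eq_mul, mul_one]

theorem Tok.content_exv (j j' : ℕ) (v : Vec) :
    Tok.sum (Tok.content j) (exv j' v) = if j' = j then v else 0 := by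
  induction v using Finsupp.induction_linear with
  | zero => simp
  | add u v hu hv =>
    rw [exv_add, map_add, hu, hv]
    split_ifs <;> simp
  | single p n =>
    rw [exv, Finsupp.toMultiset_single, Multiset.map_nsmul, Multiset.map_singleton, map_nsmul,
      Tok.sum_singleton, Tok.content]
    split_ifs <;> simp

@[simp] theorem Tok.content_plv (j : ℕ) (v : Vec) : Tok.sum (Tok.content j) (plv v) = 0 :=
  Tok.sum_plv _ (fun _ => rfl) v
@[simp] theorem Tok.own_plv (j : ℕ) (v : Vec) : Tok.sum (Tok.own j) (plv v) = 0 :=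
  Tok.sum_plv _ (fun _ => rfl) v
@[simp] theorem Tok.slot_plv (j : ℕ) (v : Vec) : Tok.sum (Tok.slot j) (plv v) = 0 :=
  Tok.sum_plv _ (fun _ => rfl) v
@[simp] theorem Tok.state_plv (v : Vec) : Tok.sum Tok.state (plv v) = 0 :=
  Tok.sum_plv _ (fun _ => rfl) v
@[simp] theorem Tok.balloon_plv (X : ℕ → Vec) (v : Vec) :
    Tok.sum (Tok.balloon X) (plv v) = 0 :=
  Tok.sum_plv _ (fun _ => rfl) v
@[simp] theorem Tok.own_exv (j i : ℕ) (v : Vec) : Tok.sum (Tok.own j) (exv i v) = 0 :=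
  Tok.sum_exv _ (fun _ _ => rfl) i v
@[simp] theorem Tok.slot_exv (j i : ℕ) (v : Vec) : Tok.sum (Tok.slot j) (exv i v) = 0 :=
  Tok.sum_exv _ (fun _ _ => rfl) i v
@[simp] theorem Tok.state_exv (i : ℕ) (v : Vec) : Tok.sum Tok.state (exv i v) = 0 :=
  Tok.sum_exv _ (fun _ _ => rfl) i v
@[simp] theorem Tok.place_exv (X : ℕ → Vec) (i : ℕ) (v : Vec) :
    Tok.sum (Tok.place X) (exv i v) = 0 :=
  Tok.sum_exv _ (fun _ _ => rfl) i v
@[simp] theorem Tok.balloon_exv (X : ℕ → Vec) (i : ℕ) (v : Vec) :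
    Tok.sum (Tok.balloon X) (exv i v) = 0 :=
  Tok.sum_exv _ (fun _ _ => rfl) i v

theorem Tok.slot_eq_zero {j : ℕ} {M : Multiset Tok} (h : Tok.sum (Tok.slot j) M = 0) :
    ∀ t ∈ M, Tok.slot j t = 0 := by
  intro t ht
  have h1 := Multiset.sum_eq_zero_iff.1 h
  exact h1 _ (Multiset.mem_map_of_mem _ ht)

theorem Tok.place_update {j : ℕ} {M : Multiset Tok} (h : Tok.sum (Tok.slot j) M = 0)
    (X : ℕ → Vec) (u : Vec) :
    Tok.sum (Tok.place (Function.update X j u)) M = Tok.sum (Tok.place X) M := by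
  refine Tok.sum_congr fun t ht => ?_
  have := Tok.slot_eq_zero h t ht
  cases t <;> simp_all [Tok.slot, Tok.place]

theorem Tok.balloon_update {j : ℕ} {M : Multiset Tok} (h : Tok.sum (Tok.slot j) M = 0)
    (X : ℕ → Vec) (u : Vec) :
    Tok.sum (Tok.balloon (Function.update X j u)) M = Tok.sum (Tok.balloon X) M := by
  refine Tok.sum_congr fun t ht => ?_
  have := Tok.slot_eq_zero h t ht
  cases t <;> simp_all [Tok.slot, Tok.balloon]

theorem Tok.own_eq_zero {j : ℕ} {M : Multiset Tok} (h : Tok.sum (Tok.slot j) M = 0) :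
    Tok.sum (Tok.own j) M = 0 := by
  refine Tok.sum_eq_zero _ fun t ht => ?_
  have := Tok.slot_eq_zero h t ht
  cases t <;> simp_all [Tok.slot, Tok.own]

theorem Tok.fr_notMem {j : ℕ} {M : Multiset Tok} (h : Tok.sum (Tok.slot j) M = 0) :
    Tok.fr j ∉ M := fun hM => by
  have := Tok.slot_eq_zero h _ hM
  simp [Tok.slot] at this

/-- Every proper slot is used at most once, and unused slots are empty. -/
structure NetInv (M : Multiset Tok) : Prop where
  slot_le : ∀ j ≠ 0, Tok.sum (Tok.slot j) M ≤ 1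
  free : ∀ j, .fr j ∈ M → Tok.sum (Tok.content j) M = 0
  zero : Tok.sum (Tok.content 0) M = 0

variable {V : VASSB} {K : ℕ} {S : Finset ℕ} {Ls : Set Lin} {Hs : Set Hist}

theorem NetInv.step {M M' : Multiset Tok} (h : NetInv M) (hM : MStep (netSet V K S Ls Hs) M M') :
    NetInv M' := by
  obtain ⟨t, ht, z, rfl, rfl⟩ := hM
  have hsl := h.slot_le
  have hfr := h.free
  have hz := h.zero
  have hple : ∀ j v, Tok.fr j ∉ plv v := fun j v hj => by
    obtain ⟨p, hp⟩ := mem_plv hj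
    cases hp
  have hexv : ∀ j i v, Tok.fr j ∉ exv i v := fun j v i hj => by
    obtain ⟨p, -, hp⟩ := mem_exv.1 hj
    cases hp
  cases ht with
  | delta he =>
    simp only [map_add, Tok.sum_singleton, Tok.slot_plv, Tok.slot, Tok.content, Tok.content_plv,
      add_zero, Multiset.mem_add, Multiset.mem_singleton, hple, reduceCtorEq, or_false] at hsl hfr hz
    exact ⟨by simpa [Tok.slot, add_comm] using hsl, by simpa [Tok.content, hple] using hfr,
      by simpa [Tok.content] using hz⟩
  | @inflate j _ _ _ _ _ hj he hℓ =>
    rcases eq_or_ne j 0 with rfl | hj0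
    · simp only [map_add, Tok.sum_singleton, Tok.slot, Tok.content, frm, if_true,
        add_zero, Multiset.mem_add, Multiset.mem_singleton, reduceCtorEq, or_false] at hsl hfr hz
      constructor
      · intro i hi
        simpa [Tok.slot, hi.symm] using hsl i hi
      · simpa [Tok.slot, Tok.content]
      · simpa [Tok.slot, Tok.content]
    · simp only [map_add, Tok.sum_singleton, Tok.slot, Tok.content, frm, if_neg hj0,
        add_zero, Multiset.mem_add, Multiset.mem_singleton, reduceCtorEq] at hsl hfr hz
      constructor
      · simpa [Tok.slot, add_comm] using hsl
      · intro i hi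
        simp only [Multiset.mem_add, Multiset.mem_singleton, reduceCtorEq, or_false] at hi
        simpa [Tok.content] using hfr i (.inl hi)
      · simpa [Tok.content]
  | deflate =>
    simp only [map_add, Tok.sum_singleton, Tok.slot, Tok.content,
      add_zero, Multiset.mem_add, Multiset.mem_singleton, reduceCtorEq, or_false] at hsl hfr hz
    exact ⟨by simpa [Tok.slot, add_comm] using hsl, by simpa [Tok.content, hple] using hfr,
      by simpa [Tok.content] using hz⟩
  | burst =>
    simp only [map_add, Tok.sum_singleton, Tok.slot, Tok.content,
      add_zero, Multiset.mem_add, Multiset.mem_singleton, reduceCtorEq, or_false] at hsl hfr hz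
    exact ⟨by simpa [Tok.slot, add_comm] using hsl, by simpa [Tok.content, hple] using hfr,
      by simpa [Tok.content] using hz⟩
  | @fill j s ℓ v hj =>
    simp only [map_add, Tok.sum_singleton, Tok.slot, Tok.content,
      add_zero, Multiset.mem_add, Multiset.mem_singleton, reduceCtorEq, or_false] at hsl hfr hz
    constructor
    · simpa [Tok.slot, Tok.content, add_comm] using hsl
    · intro i hi
      simp only [Multiset.mem_add, Multiset.mem_singleton, reduceCtorEq, or_false, hexv] at hi
      have h1 := hfr i hi
      have h2 : i ≠ j := by
        rintro rfl
        have h2 := hsl i (by omega)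
        rw [if_pos rfl] at h2
        exact Tok.fr_notMem (by omega) hi
      simpa [Tok.content, Tok.content_exv, h2.symm]
    · have : j ≠ 0 := by omega
      simpa [Tok.content, Tok.content_exv, this]
  | deliver =>
    simp only [map_add, Tok.sum_singleton, Tok.slot, Tok.content, zero_add,
      add_zero, Multiset.mem_add, Multiset.mem_singleton, reduceCtorEq, or_false] at hsl hfr hz
    constructor
    · simpa [Tok.slot, Tok.content, add_comm] using hsl
    · intro i hi
      simp only [Multiset.mem_add, Multiset.mem_singleton, reduceCtorEq, or_false] at hi
      simpa [Tok.content] using (add_eq_zero.1 (hfr i hi)).1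
    · simpa [Tok.content] using (add_eq_zero.1 hz).1
  | trash =>
    simp only [map_add, Tok.sum_singleton, Tok.slot, Tok.content, zero_add,
      add_zero, Multiset.mem_add, Multiset.mem_singleton, reduceCtorEq, or_false] at hsl hfr hz
    constructor
    · simpa [Tok.slot, Tok.content, add_comm] using hsl
    · intro i hi
      simp only [Multiset.mem_add, Multiset.mem_singleton, reduceCtorEq, or_false] at hi
      simpa [Tok.content] using (add_eq_zero.1 (hfr i hi)).1
    · simpa [Tok.content] using (add_eq_zero.1 hz).1
  | dropFree =>
    simp only [map_add, Tok.sum_singleton, Tok.slot, Tok.content,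
      add_zero, Multiset.mem_add] at hsl hfr hz
    simp only [add_zero]
    exact ⟨fun i hi => (Nat.le_add_right _ _).trans (hsl i hi), fun i hi => hfr i (.inl hi), hz⟩
  | dropDone =>
    simp only [map_add, Tok.sum_singleton, Tok.slot, Tok.content,
      add_zero, Multiset.mem_add] at hsl hfr hz
    simp only [add_zero]
    exact ⟨fun i hi => (Nat.le_add_right _ _).trans (hsl i hi), fun i hi => hfr i (.inl hi), hz⟩

/-- The balloons in the slots can be assigned contents `X` compatible with the marking such that the
configuration obtained reaches `sf`. -/
structure NetSound (V : VASSB) (sf : VConfig) (X : ℕ → Vec) (M : Multiset Tok) : Prop where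
  zero : X 0 = 0
  own : ∀ j, ∀ ℓ ∈ Tok.sum (Tok.own j) M, ∃ u ∈ ℓ.periodic, X j = Tok.sum (Tok.content j) M + u
  content : ∀ j, Tok.sum (Tok.content j) M ≠ 0 → Tok.sum (Tok.own j) M ≠ 0
  reach : ∀ C : VConfig, Tok.sum Tok.state M = {C.q} → C.m = Tok.sum (Tok.place X) M →
    C.bag = Tok.sum (Tok.balloon X) M → VReach V C sf

theorem eq_of_add_singleton_eq_singleton {α : Type*} {A : Multiset α} {a b : α}
    (h : A + {a} = {b}) : A = 0 ∧ a = b := by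
  have h1 := congrArg Multiset.card h
  simp only [Multiset.card_add, Multiset.card_singleton, Nat.add_eq_right,
    Multiset.card_eq_zero] at h1
  subst h1
  simpa using h

theorem NetSound.step {sf : VConfig} {M M' : Multiset Tok} (h : NetInv M)
    (hM : MStep (netSet V K S Ls Hs) M M') (hX : ∃ X, NetSound V sf X M') :
    ∃ X, NetSound V sf X M := by
  obtain ⟨t, ht, z, rfl, rfl⟩ := hM
  obtain ⟨X, hX0, hown, hcon, hre⟩ := hX
  cases ht with
  | @delta q q' d he =>
    refine ⟨X, hX0, ?_, ?_, fun C hC hm hb => ?_⟩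
    · simpa [Tok.own, Tok.content] using hown
    · simpa [Tok.own, Tok.content] using hcon
    · simp only [map_add, Tok.sum_singleton, Tok.state, Tok.place, Tok.balloon, Tok.state_plv,
        Tok.place_plv, Tok.balloon_plv, add_zero, zero_add] at hC hm hb hre
      obtain ⟨h1, h2⟩ := eq_of_add_singleton_eq_singleton hC
      refine Relation.ReflTransGen.head
        (b := ⟨q', Tok.sum (Tok.place X) z + d.mapRange Int.toNat rfl, C.bag⟩)
        ⟨_, he, h2.symm, rfl, fun p => ?_, rfl⟩ (hre _ (by rw [h1, zero_add]) rfl hb)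
      rw [hm]
      simp only [Finsupp.add_apply, Finsupp.mapRange_apply]
      omega
  | @inflate j q q' s L ℓ hj he hℓ =>
    have hctl : ∀ u ∈ Lin.periodic ℓ, X j = u → ∀ C : VConfig, Tok.sum Tok.state z + {q} = {C.q} →
        C.m = Tok.sum (Tok.place X) z → C.bag = Tok.sum (Tok.balloon X) z → VReach V C sf := by
      intro u hu hXu C hC hm hb
      simp only [map_add, Tok.sum_singleton, Tok.state, Tok.place, Tok.balloon, delivered_nil,
        undelivered_nil, add_zero, zero_add] at hre
      obtain ⟨h1, h2⟩ := eq_of_add_singleton_eq_singleton hC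
      refine Relation.ReflTransGen.head (b := ⟨q', C.m, C.bag + {(s, ℓ.1 + u)}⟩)
        ⟨_, he, h2.symm, rfl, rfl, ℓ.1 + u, memSL_iff.2 ⟨ℓ, hℓ, u, hu, rfl⟩, rfl⟩
        (hre _ (by rw [h1, zero_add]) hm ?_)
      rw [hb, hXu]
    rcases eq_or_ne j 0 with rfl | hj0
    · have hz := h.zero
      simp only [frm, if_true] at hz ⊢
      refine ⟨X, hX0, fun i ℓ' hi => ?_, fun i hi => ?_, fun C hC hm hb => ?_⟩
      · simpa [Tok.content] using hown i ℓ' (by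
          simp only [map_add, Tok.sum_singleton, Tok.own, add_zero] at hi ⊢
          exact Multiset.mem_add.2 (.inl (by simpa using hi)))
      · have h1 : i ≠ 0 := by
          rintro rfl
          exact hi hz
        have := hcon i
        simp [Tok.own, Tok.content, h1.symm] at this hi ⊢
        exact this hi
      · exact hctl 0 (zero_mem _) hX0 C (by simpa [Tok.state] using hC)
          (by simpa [Tok.place] using hm) (by simpa [Tok.balloon] using hb)
    · have hz := h.free j
      have hsl := h.slot_le j hj0
      simp only [frm, if_neg hj0, map_add, Tok.sum_singleton, Tok.content, Tok.slot, if_true,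
        add_zero, zero_add] at hz hsl ⊢
      have hz' := hz (by simp)
      obtain ⟨u, hu, hXu⟩ := hown j ℓ (by simp [Tok.own])
      simp only [map_add, Tok.sum_singleton, Tok.content, add_zero, hz', zero_add] at hXu
      have hsl' : Tok.sum (Tok.slot j) z = 0 := by omega
      refine ⟨X, hX0, fun i ℓ' hi => ?_, fun i hi => ?_, fun C hC hm hb => ?_⟩
      · simpa [Tok.content] using hown i ℓ' (by
          simp only [map_add, Tok.sum_singleton, Tok.own, add_zero] at hi ⊢
          exact Multiset.mem_add.2 (.inl (by simpa using hi)))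
      · have h1 : j ≠ i := by
          rintro rfl
          exact hi (by simpa [Tok.content] using hz')
        have := hcon i
        simp [Tok.own, Tok.content, h1] at this hi ⊢
        exact this hi
      · exact hctl u hu hXu C (by
          simpa only [map_add, Tok.sum_singleton, Tok.state, add_zero] using hC)
          (by simpa [Tok.place] using hm) (by simpa [Tok.balloon] using hb)
  | @deflate j q q' s s' π p ℓ h' hj he hℓ hh =>
    refine ⟨X, hX0, ?_, ?_, fun C hC hm hb => ?_⟩
    · simpa [Tok.own, Tok.content, or_comm] using hown
    · simpa only [map_add, Tok.sum_singleton, Tok.own, Tok.content, add_zero, zero_add,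
        Tok.own_plv, Tok.content_plv] using hcon
    · simp only [map_add, Tok.sum_singleton, Tok.state, Tok.place, Tok.balloon, Tok.state_plv,
        Tok.place_plv, Tok.balloon_plv, add_zero, zero_add] at hC hm hb hre
      obtain ⟨h1, h2⟩ := eq_of_add_singleton_eq_singleton hC
      rw [← map_add] at hb
      refine Relation.ReflTransGen.head (b := ⟨q', _, _⟩)
        ⟨_, he, h2.symm, rfl, undelivered h' (ℓ.1 + X j), _, hb, rfl, rfl⟩
        (hre _ (by rw [h1, zero_add]) ?_ ?_)
      · dsimp only
        rw [hm, delivered_push, map_add, Finsupp.add_apply, Finsupp.single_add]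
        abel
      · dsimp only
        rw [← map_add, undelivered_push]
  | @burst j q q' s ℓ h' hj he hℓ hh =>
    refine ⟨X, hX0, ?_, ?_, fun C hC hm hb => ?_⟩
    · simpa [Tok.own, Tok.content] using hown
    · simpa [Tok.own, Tok.content] using hcon
    · simp only [map_add, Tok.sum_singleton, Tok.state, Tok.place, Tok.balloon,
        add_zero, zero_add] at hC hm hb hre
      obtain ⟨h1, h2⟩ := eq_of_add_singleton_eq_singleton hC
      rw [← map_add] at hb
      exact Relation.ReflTransGen.head (b := ⟨q', C.m, _⟩)
        ⟨_, he, h2.symm, rfl, rfl, undelivered h' (ℓ.1 + X j), _, hb, rfl⟩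
        (hre _ (by rw [h1, zero_add]) hm rfl)
  | @fill j s ℓ v hj hj' hs hℓ hv =>
    have hsl := h.slot_le j (by omega)
    simp only [map_add, Tok.sum_singleton, Tok.slot, if_true] at hsl
    refine ⟨X, hX0, fun i ℓ' hi => ?_, fun i hi => ?_, ?_⟩
    · obtain ⟨u, hu, hXu⟩ := hown i ℓ' (by simpa [or_comm] using hi)
      simp only [map_add, Tok.sum_singleton, Tok.content, Tok.content_exv, add_zero, zero_add]
        at hXu ⊢
      rcases eq_or_ne j i with rfl | hij
      · have h1 := Tok.own_eq_zero (j := j) (M := z) (by omega)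
        simp only [map_add, h1, Tok.sum_singleton, Tok.own, if_true, zero_add,
          Multiset.mem_singleton] at hi
        subst hi
        rw [if_pos rfl, add_assoc] at hXu
        exact ⟨_, add_mem (AddSubmonoid.subset_closure hv) hu, hXu⟩
      · rw [if_neg hij, add_zero] at hXu
        exact ⟨u, hu, hXu⟩
    · have := hcon i
      simp only [map_add, Tok.sum_singleton, Tok.content, Tok.content_exv, Tok.own_exv, add_zero,
        zero_add] at this hi ⊢
      refine this fun h1 => hi ?_
      exact (add_eq_zero.1 h1).1
    · simpa [add_comm] using hre
  | @deliver j s ℓ h' π p hj hj' hs hℓ hh hp =>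
    have hsl := h.slot_le j (by omega)
    simp only [map_add, Tok.sum_singleton, Tok.slot, if_true, add_zero] at hsl
    have hz : Tok.sum (Tok.slot j) z = 0 := by omega
    have h1 := Tok.own_eq_zero hz
    refine ⟨Function.update X j (X j + Finsupp.single π 1), ?_, fun i ℓ' hi => ?_, fun i hi => ?_,
      ?_⟩
    · rw [Function.update_of_ne (by omega), hX0]
    · simp only [map_add, Tok.sum_singleton, Tok.own, Tok.content, add_zero, zero_add] at hi hown ⊢
      obtain ⟨u, hu, hXu⟩ := hown i ℓ' hi
      rcases eq_or_ne i j with rfl | hij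
      · rw [Function.update_self, if_pos rfl, hXu]
        exact ⟨u, hu, add_right_comm _ _ _⟩
      · rw [Function.update_of_ne hij, if_neg hij.symm, add_zero]
        exact ⟨u, hu, hXu⟩
    · simp only [map_add, Tok.sum_singleton, Tok.own, Tok.content, add_zero, zero_add] at hi hcon ⊢
      rcases eq_or_ne j i with rfl | hij
      · simp
      · rw [if_neg hij, add_zero] at hi
        exact hcon i hi
    · simp only [map_add, Tok.sum_singleton, Tok.place_update hz, Tok.balloon_update hz, Tok.state,
        Tok.place, Tok.balloon, Function.update_self, add_zero] at hre ⊢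
      have h2 : delivered h' (Finsupp.single π 1) = Finsupp.single p 1 := by
        rw [delivered_single, hp]
      have h3 : undelivered h' (Finsupp.single π 1) = 0 := by
        ext π'
        rw [undelivered_apply]
        split_ifs with h4
        · refine Finsupp.single_eq_of_ne' ?_
          rintro rfl
          rw [hp] at h4
          cases h4
        · rfl
      simpa only [h2, h3, add_zero, add_assoc] using hre
  | @trash j ℓ h' π v hj hj' hℓ hh hv hπ hp =>
    have hsl := h.slot_le j (by omega)
    simp only [map_add, Tok.sum_singleton, Tok.slot, if_true, add_zero] at hsl
    have hz : Tok.sum (Tok.slot j) z = 0 := by omega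
    have h1 := Tok.own_eq_zero hz
    refine ⟨Function.update X j (X j + Finsupp.single π 1), ?_, fun i ℓ' hi => ?_, fun i hi => ?_,
      ?_⟩
    · rw [Function.update_of_ne (by omega), hX0]
    · simp only [map_add, Tok.sum_singleton, Tok.own, Tok.content, add_zero, zero_add] at hi hown ⊢
      obtain ⟨u, hu, hXu⟩ := hown i ℓ' hi
      rcases eq_or_ne i j with rfl | hij
      · rw [Function.update_self, if_pos rfl, hXu]
        exact ⟨u, hu, add_right_comm _ _ _⟩
      · rw [Function.update_of_ne hij, if_neg hij.symm, add_zero]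
        exact ⟨u, hu, hXu⟩
    · simp only [map_add, Tok.sum_singleton, Tok.own, Tok.content, add_zero, zero_add] at hi hcon ⊢
      rcases eq_or_ne j i with rfl | hij
      · simp
      · rw [if_neg hij, add_zero] at hi
        exact hcon i hi
    · simp only [map_add, Tok.sum_singleton, Tok.place_update hz, Tok.balloon_update hz, Tok.state,
        Tok.place, Tok.balloon, Function.update_self, add_zero] at hre ⊢
      have h2 : delivered h' (Finsupp.single π 1) = 0 := by
        rw [delivered_single, hp]
      simpa only [h2, add_zero] using hre
  | @dropFree j hj hj' =>
    refine ⟨X, hX0, ?_, ?_, ?_⟩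
    · simpa [Tok.own, Tok.content] using hown
    · simpa [Tok.own, Tok.content] using hcon
    · simpa [Tok.state, Tok.place, Tok.balloon] using hre
  | @dropDone j ℓ h' hj hℓ hh =>
    simp only [add_zero] at hown hcon hre
    rcases eq_or_ne j 0 with rfl | hj0
    · have hz := h.zero
      simp only [map_add, Tok.sum_singleton, Tok.content, add_zero] at hz
      refine ⟨X, hX0, fun i ℓ' hi => ?_, fun i hi => ?_, ?_⟩
      · rcases eq_or_ne i 0 with rfl | hi0
        · exact ⟨0, zero_mem _, by simp [hX0, hz, Tok.content]⟩
        · simpa [Tok.content] using hown i ℓ' (by simpa [Tok.own, hi0.symm] using hi)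
      · have := hcon i (by simpa [Tok.content] using hi)
        simp only [map_add]
        exact fun h1 => this (add_eq_zero.1 h1).1
      · simpa [Tok.state, Tok.place, Tok.balloon, hX0] using hre
    · have hsl := h.slot_le j hj0
      simp only [map_add, Tok.sum_singleton, Tok.slot, if_true] at hsl
      have hz : Tok.sum (Tok.slot j) z = 0 := by omega
      have h1 := Tok.own_eq_zero hz
      have h2 : Tok.sum (Tok.content j) z = 0 := by
        by_contra h2
        exact hcon j h2 h1
      refine ⟨Function.update X j 0, ?_, fun i ℓ' hi => ?_, fun i hi => ?_, ?_⟩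
      · rw [Function.update_of_ne hj0.symm, hX0]
      · rcases eq_or_ne i j with rfl | hij
        · exact ⟨0, zero_mem _, by simp [h2, Tok.content]⟩
        · rw [Function.update_of_ne hij]
          simpa [Tok.content] using hown i ℓ' (by simpa [Tok.own, hij.symm] using hi)
      · have := hcon i (by simpa [Tok.content] using hi)
        simp only [map_add]
        exact fun h1 => this (add_eq_zero.1 h1).1
      · simp only [map_add, Tok.sum_singleton, Tok.place_update hz, Tok.balloon_update hz,
          Tok.state, Tok.place, Tok.balloon, Function.update_self, add_zero, map_zero]
        exact hre

theorem net_sound {s s' : VConfig} (hs : IsSemi s) (hs' : IsSemi s')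
    (h : MReach (netSet V K S Ls Hs) (netStart K s) (netEnd s')) : VReach V s s' := by
  have hinv : NetInv (netStart K s) := by
    have hc : ∀ j, Tok.sum (Tok.content j) (netStart K s) = 0 := fun j => by
      have : Tok.sum (Tok.content j) ((Finset.Icc 1 K).val.map .fr) = 0 :=
        Tok.sum_eq_zero _ fun t ht => by
          obtain ⟨i, -, rfl⟩ := Multiset.mem_map.1 ht
          rfl
      simp [netStart, this, Tok.content]
    refine ⟨fun j _ => ?_, fun j _ => hc j, hc 0⟩
    have : Tok.sum (Tok.slot j) ((Finset.Icc 1 K).val.map .fr) =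
        ∑ i ∈ Finset.Icc 1 K, if i = j then 1 else 0 := by
      simp only [Tok.sum, AddMonoidHom.comp_apply, Multiset.coe_mapAddMonoidHom, Multiset.map_map]
      rfl
    simp only [netStart, map_add, Tok.sum_singleton, Tok.slot_plv, this, Finset.sum_ite_eq',
      Tok.slot]
    split_ifs <;> simp
  have hfin : ∃ X, NetSound V s' X (netEnd s') := by
    refine ⟨0, rfl, fun j ℓ hℓ => ?_, fun j hj => ?_, fun C h1 h2 h3 => ?_⟩
    · simp [netEnd, Tok.own] at hℓ
    · simp [netEnd, Tok.content] at hj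
    · have : C = s' := by
        obtain ⟨q, m, b⟩ := C
        obtain ⟨q', m', b'⟩ := s'
        obtain rfl : b' = 0 := hs'
        simp_all [netEnd, Tok.state, Tok.place, Tok.balloon]
      rw [this]
      exact .refl
  have key : ∀ M, MReach (netSet V K S Ls Hs) M (netEnd s') → NetInv M →
      ∃ X, NetSound V s' X M := by
    intro M hM
    induction hM using Relation.ReflTransGen.head_induction_on with
    | refl => exact fun _ => hfin
    | head hstep _ ih => exact fun hinv => NetSound.step hinv hstep (ih (hinv.step hstep))
  obtain ⟨X, hX⟩ := key _ h hinv
  have h0 : ∀ {β : Type} [AddCommMonoid β] (g : Tok → β), (∀ j, g (.fr j) = 0) →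
      Tok.sum g ((Finset.Icc 1 K).val.map .fr) = 0 := fun g hg =>
    Tok.sum_eq_zero _ fun t ht => by
      obtain ⟨i, -, rfl⟩ := Multiset.mem_map.1 ht
      exact hg i
  refine hX.reach s ?_ ?_ ?_
  · simp [netStart, h0 Tok.state fun _ => rfl, Tok.state]
  · simp [netStart, h0 (Tok.place X) fun _ => rfl, Tok.place]
  · rw [show s.bag = 0 from hs]
    simp [netStart, h0 (Tok.balloon X) fun _ => rfl, Tok.balloon]

end NetSoundness

section ResidualKernel

variable {ι : Type}

/-- The vectors which are accepted after the digit vector `β` has been read. -/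
def residual (A : Set (ι → ℕ)) (β : ι → ℕ) : Set (ι → ℕ) := {v | 2 • v + β ∈ A}

/-- `A` belongs to a finite family of sets closed under binary residuals. -/
def HasFiniteKernel (A : Set (ι → ℕ)) : Prop :=
  ∃ F : Set (Set (ι → ℕ)), F.Finite ∧ A ∈ F ∧ ∀ X ∈ F, ∀ β : ι → ℕ, β ≤ 1 → residual X β ∈ F

theorem HasFiniteKernel.empty : HasFiniteKernel (∅ : Set (ι → ℕ)) :=
  ⟨{∅}, Set.finite_singleton _, rfl, fun X hX β _ => by
    rw [Set.mem_singleton_iff.1 hX]; rfl⟩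

theorem HasFiniteKernel.union {A B : Set (ι → ℕ)} (hA : HasFiniteKernel A)
    (hB : HasFiniteKernel B) : HasFiniteKernel (A ∪ B) := by
  obtain ⟨F, hF, hAF, hFr⟩ := hA
  obtain ⟨G, hG, hBG, hGr⟩ := hB
  refine ⟨Set.image2 (· ∪ ·) F G, hF.image2 _ hG, ⟨A, hAF, B, hBG, rfl⟩, ?_⟩
  rintro _ ⟨X, hX, Y, hY, rfl⟩ β hβ
  exact ⟨residual X β, hFr X hX β hβ, residual Y β, hGr Y hY β hβ, rfl⟩

theorem exists_double_add_subset_sum [DecidableEq (ι → ℕ)] (t : Finset (ι → ℕ)) {m : ι → ℕ}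
    (hm : m ∈ AddSubmonoid.closure (t : Set (ι → ℕ))) :
    ∃ m' ∈ AddSubmonoid.closure (t : Set (ι → ℕ)), ∃ u ⊆ t, m = 2 • m' + ∑ x ∈ u, x := by
  induction hm using AddSubmonoid.closure_induction_left with
  | zero => exact ⟨0, zero_mem _, ∅, by simp, by simp⟩
  | add_left x hx y _ ih =>
    obtain ⟨m', hm', u, hu, rfl⟩ := ih
    by_cases hxu : x ∈ u
    · refine ⟨m' + x, add_mem hm' (AddSubmonoid.subset_closure hx), u.erase x,
        (Finset.erase_subset _ _).trans hu, ?_⟩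
      rw [← Finset.add_sum_erase u (fun x => x) hxu]
      simp only [smul_add, two_smul]
      abel
    · refine ⟨m', hm', insert x u, Finset.insert_subset hx hu, ?_⟩
      rw [Finset.sum_insert hxu]
      abel

theorem HasFiniteKernel.of_isLinearSet [Finite ι] {A : Set (ι → ℕ)} (hA : IsLinearSet A) :
    HasFiniteKernel A := by
  classical
  have := Fintype.ofFinite ι
  obtain ⟨a, t, rfl⟩ := isLinearSet_iff.1 hA
  set P := AddSubmonoid.closure (t : Set (ι → ℕ)) with hP
  set B : ι → ℕ := a + ∑ x ∈ t, x
  let mk (C : Set (ι → ℕ)) : Set (ι → ℕ) := {x | ∃ c ∈ C, ∃ m ∈ P, x = c + m}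
  refine ⟨mk '' 𝒫 (Set.Iic B), ((Set.finite_Icc 0 B).subset fun x hx => ⟨zero_le, hx⟩).finite_subsets.image mk, ⟨{a}, ?_, ?_⟩, ?_⟩
  · rintro x rfl
    exact Set.mem_Iic.2 le_self_add
  · ext x
    simp only [mk, Set.mem_singleton_iff, exists_eq_left, Set.mem_vadd_set, vadd_eq_add,
      SetLike.mem_coe, Set.mem_ofPred_eq]
    exact ⟨fun ⟨m, h, e⟩ => ⟨m, h, e.symm⟩, fun ⟨m, h, e⟩ => ⟨m, h, e.symm⟩⟩
  · rintro _ ⟨C, hC, rfl⟩ β hβ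
    refine ⟨{c' | c' ≤ B ∧ ∃ c ∈ C, ∃ u ⊆ t, 2 • c' + β = c + ∑ x ∈ u, x}, fun c h => h.1, ?_⟩
    ext v
    simp only [mk, residual, Set.mem_ofPred_eq]
    constructor
    · rintro ⟨c', ⟨-, c, hc, u, hu, e⟩, m, hm, rfl⟩
      refine ⟨c, hc, ∑ x ∈ u, x + 2 • m, add_mem (sum_mem fun x hx =>
        AddSubmonoid.subset_closure (hu hx)) (nsmul_mem hm 2), ?_⟩
      rw [smul_add, add_right_comm, e, add_assoc]
    · rintro ⟨c, hc, m, hm, e⟩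
      obtain ⟨m', hm', u, hu, rfl⟩ := exists_double_add_subset_sum t hm
      have hle : m' ≤ v := fun i => by
        have h1 := congrFun e i
        have h2 : β i ≤ 1 := hβ i
        change m' i ≤ v i
        simp only [Pi.add_apply, Pi.smul_apply, smul_eq_mul] at h1
        omega
      obtain ⟨c', rfl⟩ := exists_add_of_le hle
      have e' : 2 • c' + β = c + ∑ x ∈ u, x := by
        have : 2 • m' + (2 • c' + β) = 2 • m' + (c + ∑ x ∈ u, x) := by
          rw [← add_assoc, ← smul_add, e]; abel
        exact add_left_cancel this
      refine ⟨c', ⟨fun i => ?_, c, hc, u, hu, e'⟩, m', hm', add_comm _ _⟩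
      have h1 := congrFun e' i
      have h2 : c i ≤ (a + ∑ x ∈ t, x) i := hC hc i
      have h3 : (∑ x ∈ u, x) i ≤ (∑ x ∈ t, x) i :=
        (Finset.sum_le_sum_of_subset hu : ∑ x ∈ u, x ≤ ∑ x ∈ t, x) i
      simp only [Pi.add_apply, Pi.smul_apply, smul_eq_mul, B] at h1 h2 ⊢
      omega

theorem HasFiniteKernel.of_isSemilinearSet [Finite ι] {A : Set (ι → ℕ)} (hA : IsSemilinearSet A) :
    HasFiniteKernel A := by
  obtain ⟨F, hF, hlin, rfl⟩ := hA
  induction F, hF using Set.Finite.induction_on with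
  | empty => simpa using HasFiniteKernel.empty
  | @insert a F _ _ ih =>
    rw [Set.sUnion_insert]
    exact (HasFiniteKernel.of_isLinearSet (hlin a (Set.mem_insert _ _))).union
      (ih fun t ht => hlin t (Set.mem_insert_of_mem _ ht))

end ResidualKernel

section SeparationCertificate

/-! ### Vectors as lists -/

/-- The list of the first `d` values of `f`. -/
def tabulate (d : ℕ) (f : ℕ → ℕ) : List ℕ := (List.range d).map f

def listVec (d : ℕ) (l : List ℕ) : Fin d → ℕ := fun i => l.getD i 0

def vecList {d : ℕ} (v : Fin d → ℕ) : List ℕ := tabulate d fun i => if h : i < d then v ⟨i, h⟩ else 0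

theorem tabulate_eq_vecList (d : ℕ) (f : ℕ → ℕ) : tabulate d f = vecList fun i : Fin d => f i :=
  List.map_congr_left fun i hi => by simp [List.mem_range.1 hi]

@[simp]
theorem listVec_vecList {d : ℕ} (v : Fin d → ℕ) : listVec d (vecList v) = v := by
  funext i
  simp [listVec, vecList, tabulate]

theorem vecList_injective {d : ℕ} : Function.Injective (vecList (d := d)) :=
  Function.LeftInverse.injective listVec_vecList

def listAdd (d : ℕ) (a b : List ℕ) : List ℕ := tabulate d fun i => a.getD i 0 + b.getD i 0

def listParity (d : ℕ) (a : List ℕ) : List ℕ := tabulate d fun i => a.getD i 0 % 2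

def listHalf (d : ℕ) (a : List ℕ) : List ℕ := tabulate d fun i => a.getD i 0 / 2

def listCount (d : ℕ) (l : List ℕ) : List ℕ := tabulate d fun i => (l.filter (· = i)).length

def parityVec {d : ℕ} (v : Fin d → ℕ) : Fin d → ℕ := fun i => v i % 2

def halfVec {d : ℕ} (v : Fin d → ℕ) : Fin d → ℕ := fun i => v i / 2

def countVec (d : ℕ) (l : List ℕ) : Fin d → ℕ := fun i => l.count (i : ℕ)

theorem listAdd_eq (d : ℕ) (a b : List ℕ) :
    listAdd d a b = vecList (listVec d a + listVec d b) := tabulate_eq_vecList _ _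

theorem listParity_eq (d : ℕ) (a : List ℕ) :
    listParity d a = vecList (parityVec (listVec d a)) := tabulate_eq_vecList _ _

theorem listHalf_eq (d : ℕ) (a : List ℕ) :
    listHalf d a = vecList (halfVec (listVec d a)) := tabulate_eq_vecList _ _

theorem listCount_eq (d : ℕ) (l : List ℕ) : listCount d l = vecList (countVec d l) := by
  rw [listCount, tabulate_eq_vecList]
  congr 1
  funext i
  rw [countVec, List.count_eq_length_filter]
  simp only [beq_eq_decide]

theorem tabulate_zero (d : ℕ) : tabulate d (fun _ => 0) = vecList (0 : Fin d → ℕ) :=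
  tabulate_eq_vecList _ _

theorem two_smul_halfVec_add_parityVec {d : ℕ} (v : Fin d → ℕ) :
    2 • halfVec v + parityVec v = v := by
  funext i
  simp only [halfVec, parityVec, Pi.add_apply, Pi.smul_apply, smul_eq_mul]
  omega

theorem parityVec_le {d : ℕ} (v : Fin d → ℕ) : parityVec v ≤ 1 := fun i => by
  simp only [parityVec, Pi.one_apply]
  omega

theorem parityVec_add {d : ℕ} (z v : Fin d → ℕ) :
    parityVec (z + v) = parityVec (parityVec z + v) := by
  funext i
  simp only [parityVec, Pi.add_apply]
  omega

theorem halfVec_add {d : ℕ} (z v : Fin d → ℕ) :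
    halfVec (z + v) = halfVec z + halfVec (parityVec z + v) := by
  funext i
  simp only [halfVec, parityVec, Pi.add_apply]
  omega

/-- All lists of `d` binary digits. -/
def bitLists (d : ℕ) : List (List ℕ) :=
  d.rec [[]] fun _ l => l.flatMap fun β => [0 :: β, 1 :: β]

theorem mem_bitLists {d : ℕ} {β : List ℕ} :
    β ∈ bitLists d ↔ β.length = d ∧ ∀ x ∈ β, x ≤ 1 := by
  induction d generalizing β with
  | zero => simp +contextual [bitLists]
  | succ d ih =>
    change β ∈ (bitLists d).flatMap (fun β => [0 :: β, 1 :: β]) ↔ _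
    cases β with
    | nil => simp
    | cons b β =>
      simp only [List.mem_flatMap, ih, List.mem_cons, List.cons.injEq, List.not_mem_nil, or_false,
        List.length_cons, Nat.add_right_cancel_iff, forall_eq_or_imp]
      constructor
      · rintro ⟨_, h, ⟨rfl, rfl⟩ | ⟨rfl, rfl⟩⟩ <;> simp [h.1] <;> exact h.2
      · rintro ⟨h1, h2, h3⟩
        exact ⟨β, ⟨h1, h3⟩, by rcases Nat.le_one_iff_eq_zero_or_eq_one.1 h2 with rfl | rfl <;> simp⟩

theorem vecList_mem_bitLists {d : ℕ} {b : Fin d → ℕ} (hb : b ≤ 1) : vecList b ∈ bitLists d := by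
  refine mem_bitLists.2 ⟨by simp [vecList, tabulate], fun x hx => ?_⟩
  obtain ⟨i, hi, rfl⟩ := List.mem_map.1 hx
  rw [dif_pos (List.mem_range.1 hi)]
  exact hb _

theorem listVec_le_one {d : ℕ} {β : List ℕ} (hβ : β ∈ bitLists d) : listVec d β ≤ 1 := fun i => by
  have h := mem_bitLists.1 hβ
  have hi : (i : ℕ) < β.length := h.1 ▸ i.2
  change β.getD i 0 ≤ 1
  rw [List.getD_eq_getElem _ _ hi]
  exact h.2 _ (List.getElem_mem hi)

/-! ### Digit automata -/

/-- Transition tables of automata reading digit vectors. -/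
abbrev DigitTable := List ((ℕ × List ℕ) × ℕ)

def DigitTable.next (D : DigitTable) (q : ℕ) (β : List ℕ) : ℕ := (D.lookup (q, β)).getD q

def DigitTable.step (D : DigitTable) (d : ℕ) (x : ℕ × List ℕ) : ℕ × List ℕ :=
  (D.next x.1 (listParity d x.2), listHalf d x.2)

/-- A reachability problem for Petri nets: the number of places, the transitions, the initial and
the final marking. -/
abbrev NetProblem := ℕ × List (List ℕ × List ℕ) × List ℕ × List ℕ

/-- A digit automaton with accepting states, pairs of states related by carries, the initial state
and the number of digits to be read. -/
abbrev SepCert := DigitTable × List ℕ × List (ℕ × ℕ × List ℕ × List ℕ) × ℕ × ℕ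

/-- The result of reading a marking. -/
def SepCert.run (c : SepCert) (d : ℕ) (l : List ℕ) : ℕ × List ℕ :=
  (c.1.step d)^[c.2.2.2.2] (c.2.2.2.1, listCount d l)

/-- The certificate describes an invariant separating the initial from the final marking. -/
def SepCheck (x : NetProblem) (c : SepCert) : Prop :=
  (∀ e ∈ c.1, e.1.2 = tabulate x.1 (fun _ => 0) → (e.1.1 ∈ c.2.1 ↔ e.2 ∈ c.2.1)) ∧
  (∀ w ∈ c.2.2.1, ∀ β ∈ bitLists x.1,
    (c.1.next w.1 (listParity x.1 (listAdd x.1 β w.2.2.1)),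
      c.1.next w.2.1 (listParity x.1 (listAdd x.1 β w.2.2.2)),
      listHalf x.1 (listAdd x.1 β w.2.2.1), listHalf x.1 (listAdd x.1 β w.2.2.2)) ∈ c.2.2.1) ∧
  (∀ w ∈ c.2.2.1, listAdd x.1 [] w.2.2.1 = tabulate x.1 (fun _ => 0) →
    listAdd x.1 [] w.2.2.2 = tabulate x.1 (fun _ => 0) → w.1 ∈ c.2.1 → w.2.1 ∈ c.2.1) ∧
  (∀ τ ∈ x.2.1, (c.2.2.2.1, c.2.2.2.1, listCount x.1 τ.1, listCount x.1 τ.2) ∈ c.2.2.1) ∧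
  ((c.run x.1 x.2.2.1).2 = tabulate x.1 (fun _ => 0) ∧ (c.run x.1 x.2.2.1).1 ∈ c.2.1) ∧
  ((c.run x.1 x.2.2.2).2 = tabulate x.1 (fun _ => 0) ∧ (c.run x.1 x.2.2.2).1 ∉ c.2.1)

/-- The transitions of a net as pairs of vectors. -/
def NetProblem.transitions (x : NetProblem) : Set (Trans (Fin x.1)) :=
  {t | ∃ τ ∈ x.2.1, t = (countVec x.1 τ.1, countVec x.1 τ.2)}

def NetProblem.Reachable (x : NetProblem) : Prop :=
  NReach x.transitions (countVec x.1 x.2.2.1) (countVec x.1 x.2.2.2)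

theorem halfVec_iterate {d : ℕ} (N : ℕ) (v : Fin d → ℕ) :
    halfVec^[N] v = fun i => v i / 2 ^ N := by
  induction N with
  | zero => simp
  | succ N ih =>
    rw [Function.iterate_succ_apply', ih]
    funext i
    rw [halfVec, Nat.div_div_eq_div_mul, pow_succ]

theorem exists_halfVec_iterate_eq_zero {d : ℕ} (v : Fin d → ℕ) :
    ∃ N, ∀ M ≥ N, halfVec^[M] v = 0 := by
  refine ⟨∑ i, v i, fun M hM => ?_⟩
  rw [halfVec_iterate]
  funext i
  refine Nat.div_eq_of_lt (Nat.lt_two_pow_self.trans_le (Nat.pow_le_pow_right two_pos ?_))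
  exact (Finset.single_le_sum (f := v) (fun _ _ => Nat.zero_le _) (Finset.mem_univ i)).trans hM

theorem DigitTable.step_vecList (D : DigitTable) {d : ℕ} (q : ℕ) (v : Fin d → ℕ) :
    D.step d (q, vecList v) = (D.next q (vecList (parityVec v)), vecList (halfVec v)) := by
  simp [DigitTable.step, listParity_eq, listHalf_eq]

theorem DigitTable.step_iterate_snd (D : DigitTable) {d : ℕ} (q : ℕ) (v : Fin d → ℕ) (N : ℕ) :
    ((D.step d)^[N] (q, vecList v)).2 = vecList (halfVec^[N] v) := by
  induction N generalizing q v with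
  | zero => rfl
  | succ N ih => rw [Function.iterate_succ_apply, Function.iterate_succ_apply, step_vecList, ih]

theorem SepCheck.not_reachable {x : NetProblem} {c : SepCert} (h : SepCheck x c) :
    ¬ x.Reachable := by
  obtain ⟨d, T, s, t⟩ := x
  obtain ⟨D, F, W, q₀, N⟩ := c
  obtain ⟨hstab, hclosed, hacc, hfirst, hs, ht⟩ := h
  dsimp only at hstab hclosed hacc hfirst hs ht
  simp only [SepCert.run, tabulate_zero, listCount_eq, listAdd_eq, listParity_eq, listHalf_eq,
    listVec_vecList] at hstab hclosed hacc hfirst hs ht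
  have hnext : ∀ q, D.next q (vecList (0 : Fin d → ℕ)) ∈ F ↔ q ∈ F := by
    intro q
    rw [DigitTable.next]
    cases hl : D.lookup (q, vecList (0 : Fin d → ℕ)) with
    | none => rfl
    | some q' =>
      obtain ⟨l₁, l₂, e, -⟩ := List.lookup_eq_some_iff.1 hl
      exact (hstab ((q, vecList 0), q') (by simp [e]) rfl).symm
  have hstable : ∀ (v : Fin d → ℕ) (M : ℕ), halfVec^[M] v = 0 → ∀ M' ≥ M,
      (((D.step d)^[M'] (q₀, vecList v)).1 ∈ F ↔ ((D.step d)^[M] (q₀, vecList v)).1 ∈ F) := by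
    intro v M hM M' hM'
    induction M', hM' using Nat.le_induction with
    | base => rfl
    | succ M' hle ih =>
      have h0 : halfVec^[M'] v = 0 := by
        rw [halfVec_iterate] at hM ⊢
        funext i
        have h1 := congrFun hM i
        exact Nat.eq_zero_of_le_zero
          ((Nat.div_le_div_left (Nat.pow_le_pow_right two_pos hle) (by positivity)).trans h1.le)
      have h1 : (D.step d)^[M'] (q₀, vecList v) =
          (((D.step d)^[M'] (q₀, vecList v)).1, vecList (0 : Fin d → ℕ)) :=
        Prod.ext rfl (by rw [DigitTable.step_iterate_snd, h0])
      rw [Function.iterate_succ_apply', ← ih, h1, DigitTable.step_vecList]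
      exact hnext _
  have hsim : ∀ (M : ℕ) (w) (_ : w ∈ W) (z : Fin d → ℕ),
      halfVec^[M] (z + listVec d w.2.2.1) = 0 → halfVec^[M] (z + listVec d w.2.2.2) = 0 →
      ((D.step d)^[M] (w.1, vecList (z + listVec d w.2.2.1))).1 ∈ F →
      ((D.step d)^[M] (w.2.1, vecList (z + listVec d w.2.2.2))).1 ∈ F := by
    intro M
    induction M with
    | zero =>
      intro w hw z h1 h2 h3
      have e1 : listVec d w.2.2.1 = 0 := (add_eq_zero.1 h1).2
      have e2 : listVec d w.2.2.2 = 0 := (add_eq_zero.1 h2).2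
      have e3 : listVec d [] = 0 := by funext i; simp [listVec]
      exact hacc w hw (by rw [e1, e3, add_zero]) (by rw [e2, e3, add_zero]) h3
    | succ M ih =>
      intro w hw z h1 h2 h3
      simp only [Function.iterate_succ_apply, DigitTable.step_vecList] at h1 h2 h3 ⊢
      have hw' := hclosed w hw _ (vecList_mem_bitLists (parityVec_le z))
      simp only [listVec_vecList] at hw'
      rw [halfVec_add] at h1 h2
      rw [halfVec_add, parityVec_add] at h3 ⊢
      have := ih _ hw' (halfVec z)
      simp only [listVec_vecList] at this
      exact this h1 h2 h3
  intro hr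
  have key : ∀ v, NReach (NetProblem.transitions (d, T, s, t)) (countVec d s) v →
      ∃ N₀, ∀ M ≥ N₀, ((D.step d)^[M] (q₀, vecList v)).1 ∈ F := by
    intro v hv
    induction hv with
    | refl =>
      refine ⟨N, fun M hM => (hstable _ N ?_ M hM).2 hs.2⟩
      exact vecList_injective ((DigitTable.step_iterate_snd _ _ _ _).symm.trans hs.1)
    | tail _ hstep ih =>
      obtain ⟨N₀, hN₀⟩ := ih
      obtain ⟨_, ⟨τ, hτ, rfl⟩, z, rfl, rfl⟩ := hstep
      obtain ⟨N₁, hN₁⟩ := exists_halfVec_iterate_eq_zero (z + countVec d τ.1)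
      obtain ⟨N₂, hN₂⟩ := exists_halfVec_iterate_eq_zero (z + countVec d τ.2)
      refine ⟨N₀ + N₁ + N₂, fun M hM => ?_⟩
      have := hsim M _ (hfirst τ hτ) z
      simp only [listVec_vecList] at this
      exact this (hN₁ M (by omega)) (hN₂ M (by omega)) (hN₀ M (by omega))
  obtain ⟨N₀, hN₀⟩ := key _ hr
  refine ht.2 ((hstable _ N ?_ (max N N₀) (le_max_left _ _)).1 (hN₀ _ (le_max_right _ _)))
  exact vecList_injective ((DigitTable.step_iterate_snd _ _ _ _).symm.trans ht.1)

end SeparationCertificate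

section SeparationCompleteness

theorem DigitTable.next_eq {D : DigitTable} {q q' : ℕ} {β : List ℕ} (h : ((q, β), q') ∈ D)
    (hD : ∀ q'', ((q, β), q'') ∈ D → q'' = q') : D.next q β = q' := by
  rw [DigitTable.next]
  cases hl : D.lookup (q, β) with
  | none =>
    have := (List.lookup_eq_none_iff.1 hl) _ h
    simp at this
  | some q'' =>
    obtain ⟨l₁, l₂, e, -⟩ := List.lookup_eq_some_iff.1 hl
    exact hD q'' (by simp [e])

theorem NetProblem.transitions_finite (x : NetProblem) : x.transitions.Finite := by
  refine (List.finite_toSet (x.2.1.map fun τ => (countVec x.1 τ.1, countVec x.1 τ.2))).subset ?_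
  rintro _ ⟨τ, hτ, rfl⟩
  exact List.mem_map.2 ⟨τ, hτ, rfl⟩

theorem exists_sepCheck {x : NetProblem} (h : ¬ x.Reachable) : ∃ c, SepCheck x c := by
  classical
  obtain ⟨A, hA, hsA, htA, hinv⟩ := exists_semilinear_invariant x.transitions_finite h
  obtain ⟨F, hF, hAF, hFr⟩ := HasFiniteKernel.of_isSemilinearSet hA
  obtain ⟨enc, henc⟩ := Set.countable_iff_exists_injOn.1 hF.countable
  obtain ⟨d, T, s, t⟩ := x
  dsimp only at A F enc
  obtain ⟨B, hB1, hB⟩ : ∃ B : Fin d → ℕ, 1 ≤ B ∧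
      ∀ τ ∈ T, countVec d τ.1 ≤ B ∧ countVec d τ.2 ≤ B := by
    refine ⟨1 + (T.map fun τ => countVec d τ.1 + countVec d τ.2).sum, le_self_add, fun τ hτ => ?_⟩
    have h1 := List.single_le_sum (l := T.map fun τ => countVec d τ.1 + countVec d τ.2)
      (fun _ _ => zero_le) _ (List.mem_map.2 ⟨τ, hτ, rfl⟩)
    exact ⟨(le_self_add.trans h1).trans le_add_self, (le_add_self.trans h1).trans le_add_self⟩
  have hbits : {b : Fin d → ℕ | b ≤ 1}.Finite :=
    (Set.finite_Icc 0 1).subset fun b hb => ⟨zero_le, hb⟩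
  have hbox : {v : Fin d → ℕ | v ≤ B}.Finite :=
    (Set.finite_Icc 0 B).subset fun b hb => ⟨zero_le, hb⟩
  have hDfin : {e : (ℕ × List ℕ) × ℕ | ∃ X ∈ F, ∃ b : Fin d → ℕ, b ≤ 1 ∧
      e = ((enc X, vecList b), enc (residual X b))}.Finite := by
    refine (hF.image2 (fun X b => ((enc X, vecList b), enc (residual X b))) hbits).subset ?_
    rintro _ ⟨X, hX, b, hb, rfl⟩
    exact ⟨X, hX, b, hb, rfl⟩
  have hAfin : {n | ∃ X ∈ F, (0 : Fin d → ℕ) ∈ X ∧ n = enc X}.Finite := by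
    refine (hF.image enc).subset ?_
    rintro _ ⟨X, hX, -, rfl⟩
    exact ⟨X, hX, rfl⟩
  have hWfin : {w : ℕ × ℕ × List ℕ × List ℕ | ∃ X ∈ F, ∃ Y ∈ F, ∃ u v : Fin d → ℕ, u ≤ B ∧ v ≤ B ∧
      (∀ z, z + u ∈ X → z + v ∈ Y) ∧ w = (enc X, enc Y, vecList u, vecList v)}.Finite := by
    refine ((hF.prod hF).image2 (fun p q : _ × _ => (enc p.1, enc p.2, vecList q.1, vecList q.2))
      (hbox.prod hbox)).subset ?_
    rintro _ ⟨X, hX, Y, hY, u, v, hu, hv, -, rfl⟩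
    exact ⟨(X, Y), ⟨hX, hY⟩, (u, v), ⟨hu, hv⟩, rfl⟩
  set D : DigitTable := hDfin.toFinset.toList with hD
  set Acc : List ℕ := hAfin.toFinset.toList with hAcc
  have hmemD : ∀ e, e ∈ D ↔ ∃ X ∈ F, ∃ b : Fin d → ℕ, b ≤ 1 ∧
      e = ((enc X, vecList b), enc (residual X b)) := fun e => by simp [hD]
  have hmemAcc : ∀ X ∈ F, (enc X ∈ Acc ↔ (0 : Fin d → ℕ) ∈ X) := fun X hX => by
    simp only [hAcc, Finset.mem_toList, Set.Finite.mem_toFinset, Set.mem_ofPred_eq]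
    exact ⟨fun ⟨Y, hY, h0, e⟩ => henc hX hY e ▸ h0, fun h0 => ⟨X, hX, h0, rfl⟩⟩
  have hnext : ∀ X ∈ F, ∀ b : Fin d → ℕ, b ≤ 1 →
      D.next (enc X) (vecList b) = enc (residual X b) := fun X hX b hb => by
    refine DigitTable.next_eq ((hmemD _).2 ⟨X, hX, b, hb, rfl⟩) fun q hq => ?_
    obtain ⟨Y, hY, b', -, e⟩ := (hmemD _).1 hq
    simp only [Prod.mk.injEq] at e
    obtain ⟨⟨e1, e2⟩, rfl⟩ := e
    rw [henc hX hY e1, vecList_injective e2]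
  have hrun : ∀ (v : Fin d → ℕ) (N : ℕ), ∃ X ∈ F,
      (D.step d)^[N] (enc A, vecList v) = (enc X, vecList (halfVec^[N] v)) ∧
        (halfVec^[N] v ∈ X ↔ v ∈ A) := by
    intro v N
    induction N with
    | zero => exact ⟨A, hAF, rfl, Iff.rfl⟩
    | succ N ih =>
      obtain ⟨X, hX, e, hiff⟩ := ih
      refine ⟨_, hFr X hX _ (parityVec_le (halfVec^[N] v)), ?_, ?_⟩
      · rw [Function.iterate_succ_apply', Function.iterate_succ_apply', e,
          DigitTable.step_vecList, hnext X hX _ (parityVec_le _)]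
      · rw [Function.iterate_succ_apply', ← hiff]
        change 2 • halfVec _ + parityVec _ ∈ X ↔ _
        rw [two_smul_halfVec_add_parityVec]
  obtain ⟨N₁, hN₁⟩ := exists_halfVec_iterate_eq_zero (countVec d s)
  obtain ⟨N₂, hN₂⟩ := exists_halfVec_iterate_eq_zero (countVec d t)
  refine ⟨(D, Acc, hWfin.toFinset.toList, enc A, N₁ + N₂), ?_⟩
  simp only [SepCheck, SepCert.run, tabulate_zero, listCount_eq, listAdd_eq, listParity_eq,
    listHalf_eq, listVec_vecList, Finset.mem_toList, Set.Finite.mem_toFinset, Set.mem_ofPred_eq]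
  refine ⟨?_, ?_, ?_, ?_, ?_, ?_⟩
  · intro e he h0
    obtain ⟨X, hX, b, hb, rfl⟩ := (hmemD e).1 he
    obtain rfl : b = 0 := vecList_injective h0
    rw [hmemAcc X hX, hmemAcc _ (hFr X hX 0 hb)]
    simp [residual]
  · rintro _ ⟨X, hX, Y, hY, u, v, hu, hv, huv, rfl⟩ β hβ
    have hβ1 := listVec_le_one hβ
    simp only [listVec_vecList]
    refine ⟨residual X (parityVec (listVec d β + u)), hFr X hX _ (parityVec_le _),
      residual Y (parityVec (listVec d β + v)), hFr Y hY _ (parityVec_le _),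
      halfVec (listVec d β + u), halfVec (listVec d β + v), ?_, ?_, ?_, ?_⟩
    · intro i
      have h1 : listVec d β i ≤ 1 := hβ1 i
      have h2 : u i ≤ B i := hu i
      have h3 : 1 ≤ B i := hB1 i
      change (listVec d β i + u i) / 2 ≤ B i
      omega
    · intro i
      have h1 : listVec d β i ≤ 1 := hβ1 i
      have h2 : v i ≤ B i := hv i
      have h3 : 1 ≤ B i := hB1 i
      change (listVec d β i + v i) / 2 ≤ B i
      omega
    · intro z hz
      have e : ∀ w : Fin d → ℕ, 2 • (z + halfVec (listVec d β + w)) +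
          parityVec (listVec d β + w) = (2 • z + listVec d β) + w := fun w => by
        rw [smul_add, add_assoc, two_smul_halfVec_add_parityVec, add_assoc]
      change 2 • (z + _) + _ ∈ Y
      rw [e]
      refine huv _ ?_
      rw [← e]
      exact hz
    · rw [hnext X hX _ (parityVec_le _), hnext Y hY _ (parityVec_le _)]
  · rintro _ ⟨X, hX, Y, hY, u, v, hu, hv, huv, rfl⟩ h1 h2 h3
    have e3 : listVec d [] = 0 := by funext i; simp [listVec]
    simp only [listVec_vecList, e3, zero_add] at h1 h2
    obtain rfl := vecList_injective h1
    obtain rfl := vecList_injective h2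
    rw [hmemAcc Y hY]
    exact huv 0 ((hmemAcc X hX).1 h3)
  · intro τ hτ
    exact ⟨A, hAF, A, hAF, _, _, (hB τ hτ).1, (hB τ hτ).2,
      fun z hz => hinv _ hz _ ⟨_, ⟨τ, hτ, rfl⟩, z, rfl, rfl⟩, rfl⟩
  · obtain ⟨X, hX, e, hiff⟩ := hrun (countVec d s) (N₁ + N₂)
    rw [hN₁ _ (by omega)] at e hiff
    rw [e]
    exact ⟨rfl, (hmemAcc X hX).2 (hiff.2 hsA)⟩
  · obtain ⟨X, hX, e, hiff⟩ := hrun (countVec d t) (N₁ + N₂)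
    rw [hN₂ _ (by omega)] at e hiff
    rw [e]
    exact ⟨rfl, fun h => htA (hiff.1 ((hmemAcc X hX).1 h))⟩

end SeparationCompleteness

section RunCertificate

def listSub (d : ℕ) (a b : List ℕ) : List ℕ := tabulate d fun i => a.getD i 0 - b.getD i 0

theorem listSub_eq (d : ℕ) (a b : List ℕ) :
    listSub d a b = vecList (listVec d a - listVec d b) := tabulate_eq_vecList _ _

/-- Fire the transition `τ` if it is enabled at `v`. -/
def fireTrans (d : ℕ) (v : List ℕ) (τ : List ℕ × List ℕ) : List ℕ :=
  if listSub d (listCount d τ.1) v = tabulate d (fun _ => 0) then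
    listAdd d (listSub d v (listCount d τ.1)) (listCount d τ.2)
  else v

/-- Fire a transition given by its index. -/
def NetProblem.fire (x : NetProblem) (v : List ℕ) (k : ℕ) : List ℕ :=
  fireTrans x.1 v (x.2.1.getD k ([], []))

/-- Firing the listed transitions leads to the final marking. -/
def RunCheck (x : NetProblem) (c : List ℕ) : Prop :=
  c.foldl x.fire (listCount x.1 x.2.2.1) = listCount x.1 x.2.2.2

theorem fireTrans_add {d : ℕ} (z : Fin d → ℕ) (τ : List ℕ × List ℕ) :
    fireTrans d (vecList (z + countVec d τ.1)) τ = vecList (z + countVec d τ.2) := by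
  simp only [fireTrans, listCount_eq, listSub_eq, listAdd_eq, listVec_vecList, tabulate_zero]
  rw [if_pos (congrArg _ (tsub_eq_zero_of_le le_add_self)), add_tsub_cancel_right]

theorem exists_fireTrans_eq {d : ℕ} (v : Fin d → ℕ) (τ : List ℕ × List ℕ) :
    fireTrans d (vecList v) τ = vecList v ∨
      ∃ z, v = z + countVec d τ.1 ∧ fireTrans d (vecList v) τ = vecList (z + countVec d τ.2) := by
  by_cases h : countVec d τ.1 ≤ v
  · refine Or.inr ⟨v - countVec d τ.1, (tsub_add_cancel_of_le h).symm, ?_⟩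
    conv_lhs => rw [← tsub_add_cancel_of_le h]
    exact fireTrans_add _ _
  · refine Or.inl (if_neg fun h' => h ?_)
    simp only [listCount_eq, listSub_eq, listVec_vecList, tabulate_zero] at h'
    exact tsub_eq_zero_iff_le.1 (vecList_injective h')

theorem RunCheck.reachable {x : NetProblem} {c : List ℕ} (h : RunCheck x c) : x.Reachable := by
  obtain ⟨d, T, s, t⟩ := x
  have key : ∀ (c : List ℕ) (v : Fin d → ℕ), ∃ v',
      c.foldl (NetProblem.fire (d, T, s, t)) (vecList v) = vecList v' ∧
        NReach (NetProblem.transitions (d, T, s, t)) v v' := by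
    intro c
    induction c with
    | nil => exact fun v => ⟨v, rfl, .refl⟩
    | cons k c ih =>
      intro v
      have hstep : ∃ v', NetProblem.fire (d, T, s, t) (vecList v) k = vecList v' ∧
          NReach (NetProblem.transitions (d, T, s, t)) v v' := by
        simp only [NetProblem.fire]
        rcases exists_fireTrans_eq v (T.getD k ([], [])) with h | ⟨z, rfl, h⟩
        · exact ⟨v, h, .refl⟩
        · refine ⟨_, h, ?_⟩
          by_cases hk : k < T.length
          · rw [List.getD_eq_getElem _ _ hk]
            exact .single ⟨_, ⟨_, List.getElem_mem hk, rfl⟩, z, rfl, rfl⟩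
          · rw [List.getD_eq_default _ _ (by omega)]
            exact .refl
      obtain ⟨v₁, e₁, h₁⟩ := hstep
      obtain ⟨v₂, e₂, h₂⟩ := ih v₁
      exact ⟨v₂, by rw [List.foldl_cons, e₁, e₂], h₁.trans h₂⟩
  obtain ⟨v, e, hv⟩ := key c (countVec d s)
  simp only [RunCheck, listCount_eq] at h
  obtain rfl := vecList_injective (e.symm.trans h)
  exact hv

theorem exists_runCheck {x : NetProblem} (h : x.Reachable) : ∃ c, RunCheck x c := by
  obtain ⟨d, T, s, t⟩ := x
  have key : ∀ v, NReach (NetProblem.transitions (d, T, s, t)) (countVec d s) v →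
      ∃ c : List ℕ, c.foldl (NetProblem.fire (d, T, s, t)) (vecList (countVec d s)) =
        vecList v := by
    intro v hv
    induction hv with
    | refl => exact ⟨[], rfl⟩
    | tail _ hstep ih =>
      obtain ⟨c, hc⟩ := ih
      obtain ⟨_, ⟨τ, hτ, rfl⟩, z, rfl, rfl⟩ := hstep
      obtain ⟨k, hk, rfl⟩ := List.mem_iff_getElem.1 hτ
      refine ⟨c ++ [k], ?_⟩
      rw [List.foldl_append, hc, List.foldl_cons, List.foldl_nil, NetProblem.fire,
        List.getD_eq_getElem _ _ hk]
      exact fireTrans_add _ _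
  obtain ⟨c, hc⟩ := key _ h
  exact ⟨c, by simpa only [RunCheck, listCount_eq] using hc⟩

end RunCertificate

section CertificatePrimrec

variable {α β : Type*} [Primcodable α] [Primcodable β]

theorem primrecPred_forall_mem {f : α → List β} (hf : Primrec f) {R : α → β → Prop}
    (hR : PrimrecPred fun p : α × β => R p.1 p.2) : PrimrecPred fun a => ∀ b ∈ f a, R a b := by
  have h : PrimrecRel fun (b : β) (a : α) => R a b := hR.comp (Primrec.snd.pair Primrec.fst)
  exact h.forall_mem_list.comp hf .id

theorem primrecPred_mem {f : α → List β} (hf : Primrec f) {g : α → β} (hg : Primrec g) :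
    PrimrecPred fun a => g a ∈ f a :=
  (Primrec.eq.exists_mem_list.comp hf hg).of_eq fun a => by simp

theorem primrecPred_imp {p q : α → Prop} (hp : PrimrecPred p) (hq : PrimrecPred q) :
    PrimrecPred fun a => p a → q a :=
  (hp.not.or hq).of_eq fun _ => imp_iff_not_or.symm

theorem primrecPred_iff {p q : α → Prop} (hp : PrimrecPred p) (hq : PrimrecPred q) :
    PrimrecPred fun a => p a ↔ q a :=
  ((primrecPred_imp hp hq).and (primrecPred_imp hq hp)).of_eq fun _ => iff_iff_implies_and_implies.symm

theorem primrec_tabulate {d : α → ℕ} (hd : Primrec d) {f : α → ℕ → ℕ} (hf : Primrec₂ f) :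
    Primrec fun a => tabulate (d a) (f a) :=
  Primrec.list_map (Primrec.list_range.comp hd) hf

variable {d : α → ℕ} {a b : α → List ℕ}

theorem primrec_zeros (hd : Primrec d) : Primrec fun x => tabulate (d x) (fun _ => 0) :=
  primrec_tabulate hd (Primrec.const 0)

theorem primrec_bitLists (hd : Primrec d) : Primrec fun x => bitLists (d x) := by
  refine Primrec.nat_rec' hd (Primrec.const [[]])
    (h := fun _ p => p.2.flatMap fun β => [0 :: β, 1 :: β]) ?_
  refine Primrec.list_flatMap (Primrec.snd.comp Primrec.snd) ?_
  have h : ∀ n : ℕ, Primrec fun p : (α × ℕ × List (List ℕ)) × List ℕ => n :: p.2 := fun n =>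
    Primrec.list_cons.comp (.const n) .snd
  exact Primrec.list_cons.comp (h 0) (Primrec.list_cons.comp (h 1) (.const []))

theorem primrec_getD (ha : Primrec a) : Primrec₂ fun x i => (a x).getD i 0 :=
  ((Primrec.list_getD 0).comp (ha.comp .fst) .snd).to₂

theorem primrec_listParity (hd : Primrec d) (ha : Primrec a) : Primrec fun x => listParity (d x) (a x) :=
  primrec_tabulate hd (Primrec.nat_mod.comp₂ (primrec_getD ha) (.const 2))

theorem primrec_listHalf (hd : Primrec d) (ha : Primrec a) : Primrec fun x => listHalf (d x) (a x) :=
  primrec_tabulate hd (Primrec.nat_div.comp₂ (primrec_getD ha) (.const 2))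

theorem primrec_listCount (hd : Primrec d) (ha : Primrec a) : Primrec fun x => listCount (d x) (a x) := by
  refine primrec_tabulate hd (Primrec.list_length.comp ?_)
  exact (Primrec.eq.listFilter).comp (ha.comp .fst) .snd

theorem primrec_listAdd (hd : Primrec d) (ha : Primrec a)
    (hb : Primrec b) : Primrec fun x => listAdd (d x) (a x) (b x) :=
  primrec_tabulate hd (Primrec.nat_add.comp₂ (primrec_getD ha) (primrec_getD hb))

theorem primrec_listSub (hd : Primrec d) (ha : Primrec a)
    (hb : Primrec b) : Primrec fun x => listSub (d x) (a x) (b x) :=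
  primrec_tabulate hd (Primrec.nat_sub.comp₂ (primrec_getD ha) (primrec_getD hb))

end CertificatePrimrec

section NetDecidability

variable {α : Type*} [Primcodable α]

theorem primrec_next {D : α → DigitTable} (hD : Primrec D) {q : α → ℕ} (hq : Primrec q)
    {β : α → List ℕ} (hβ : Primrec β) : Primrec fun x => (D x).next (q x) (β x) :=
  (Primrec.option_getD.comp (Primrec.listLookup.comp (hq.pair hβ) hD) hq).of_eq fun x => by
    rw [DigitTable.next, lawful_beq_subsingleton instBEqProd instBEqOfDecidableEq]

theorem primrec_sepRun {c : α → SepCert} (hc : Primrec c) {d : α → ℕ} (hd : Primrec d)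
    {l : α → List ℕ} (hl : Primrec l) : Primrec fun x => (c x).run (d x) (l x) := by
  have hc2 := Primrec.snd.comp (Primrec.snd.comp (Primrec.snd.comp hc))
  refine Primrec.nat_iterate (Primrec.snd.comp hc2)
    ((Primrec.fst.comp hc2).pair (primrec_listCount hd hl)) ?_
  have h2 : Primrec fun p : α × ℕ × List ℕ => p.2.2 := Primrec.snd.comp .snd
  have hd' : Primrec fun p : α × ℕ × List ℕ => d p.1 := hd.comp .fst
  exact (primrec_next (Primrec.fst.comp (hc.comp .fst)) (Primrec.fst.comp .snd)
    (primrec_listParity hd' h2)).pair (primrec_listHalf hd' h2)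

theorem primrecRel_sepCheck : PrimrecRel SepCheck := by
  have hd : Primrec fun p : NetProblem × SepCert => p.1.1 := Primrec.fst.comp .fst
  have hT : Primrec fun p : NetProblem × SepCert => p.1.2.1 :=
    Primrec.fst.comp (Primrec.snd.comp .fst)
  have hs : Primrec fun p : NetProblem × SepCert => p.1.2.2.1 :=
    Primrec.fst.comp (Primrec.snd.comp (Primrec.snd.comp .fst))
  have ht : Primrec fun p : NetProblem × SepCert => p.1.2.2.2 :=
    Primrec.snd.comp (Primrec.snd.comp (Primrec.snd.comp .fst))
  have hc : Primrec fun p : NetProblem × SepCert => p.2 := Primrec.snd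
  have hD : Primrec fun p : NetProblem × SepCert => p.2.1 := Primrec.fst.comp hc
  have hF : Primrec fun p : NetProblem × SepCert => p.2.2.1 :=
    Primrec.fst.comp (Primrec.snd.comp hc)
  have hW : Primrec fun p : NetProblem × SepCert => p.2.2.2.1 :=
    Primrec.fst.comp (Primrec.snd.comp (Primrec.snd.comp hc))
  have hq : Primrec fun p : NetProblem × SepCert => p.2.2.2.2.1 :=
    Primrec.fst.comp (Primrec.snd.comp (Primrec.snd.comp (Primrec.snd.comp hc)))
  refine .and ?_ (.and ?_ (.and ?_ (.and ?_ (.and (.and ?_ ?_) (.and ?_ ?_)))))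
  · refine primrecPred_forall_mem hD (primrecPred_imp (Primrec.eq.comp
      (Primrec.snd.comp (Primrec.fst.comp .snd)) (primrec_zeros (hd.comp .fst))) ?_)
    exact primrecPred_iff
      (primrecPred_mem (hF.comp .fst) (Primrec.fst.comp (Primrec.fst.comp .snd)))
      (primrecPred_mem (hF.comp .fst) (Primrec.snd.comp .snd))
  · refine primrecPred_forall_mem hW (primrecPred_forall_mem (primrec_bitLists (hd.comp .fst))
      (primrecPred_mem (hW.comp (Primrec.fst.comp .fst)) ?_))
    have hd' : Primrec fun p : ((NetProblem × SepCert) × ℕ × ℕ × List ℕ × List ℕ) × List ℕ =>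
      p.1.1.1.1 := hd.comp (Primrec.fst.comp .fst)
    have hD' : Primrec fun p : ((NetProblem × SepCert) × ℕ × ℕ × List ℕ × List ℕ) × List ℕ =>
      p.1.1.2.1 := hD.comp (Primrec.fst.comp .fst)
    have hw : Primrec fun p : ((NetProblem × SepCert) × ℕ × ℕ × List ℕ × List ℕ) × List ℕ =>
      p.1.2 := Primrec.snd.comp .fst
    have hw2 := Primrec.snd.comp (Primrec.snd.comp hw)
    have h1 := primrec_listAdd hd' Primrec.snd (Primrec.fst.comp hw2)
    have h2 := primrec_listAdd hd' Primrec.snd (Primrec.snd.comp hw2)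
    exact (primrec_next hD' (Primrec.fst.comp hw) (primrec_listParity hd' h1)).pair
      ((primrec_next hD' (Primrec.fst.comp (Primrec.snd.comp hw))
        (primrec_listParity hd' h2)).pair ((primrec_listHalf hd' h1).pair
          (primrec_listHalf hd' h2)))
  · have hw : Primrec fun p : (NetProblem × SepCert) × ℕ × ℕ × List ℕ × List ℕ => p.2 :=
      Primrec.snd
    have hw2 := Primrec.snd.comp (Primrec.snd.comp hw)
    have hd' : Primrec fun p : (NetProblem × SepCert) × ℕ × ℕ × List ℕ × List ℕ => p.1.1.1 :=
      hd.comp .fst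
    exact primrecPred_forall_mem hW (primrecPred_imp
      (Primrec.eq.comp (primrec_listAdd hd' (.const []) (Primrec.fst.comp hw2))
        (primrec_zeros hd')) (primrecPred_imp
      (Primrec.eq.comp (primrec_listAdd hd' (.const []) (Primrec.snd.comp hw2))
        (primrec_zeros hd')) (primrecPred_imp
      (primrecPred_mem (hF.comp .fst) (Primrec.fst.comp hw))
      (primrecPred_mem (hF.comp .fst) (Primrec.fst.comp (Primrec.snd.comp hw))))))
  · refine primrecPred_forall_mem hT (primrecPred_mem (hW.comp .fst) ?_)
    have hq' := hq.comp (Primrec.fst (β := List ℕ × List ℕ))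
    have hd' := hd.comp (Primrec.fst (β := List ℕ × List ℕ))
    exact hq'.pair (hq'.pair ((primrec_listCount hd' (Primrec.fst.comp .snd)).pair
      (primrec_listCount hd' (Primrec.snd.comp .snd))))
  · exact Primrec.eq.comp (Primrec.snd.comp (primrec_sepRun hc hd hs)) (primrec_zeros hd)
  · exact primrecPred_mem hF (Primrec.fst.comp (primrec_sepRun hc hd hs))
  · exact Primrec.eq.comp (Primrec.snd.comp (primrec_sepRun hc hd ht)) (primrec_zeros hd)
  · exact (primrecPred_mem hF (Primrec.fst.comp (primrec_sepRun hc hd ht))).not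

theorem primrecRel_runCheck : PrimrecRel RunCheck := by
  have hd : Primrec fun p : NetProblem × List ℕ => p.1.1 := Primrec.fst.comp .fst
  have hs : Primrec fun p : NetProblem × List ℕ => p.1.2.2.1 :=
    Primrec.fst.comp (Primrec.snd.comp (Primrec.snd.comp .fst))
  have ht : Primrec fun p : NetProblem × List ℕ => p.1.2.2.2 :=
    Primrec.snd.comp (Primrec.snd.comp (Primrec.snd.comp .fst))
  refine Primrec.eq.comp ?_ (primrec_listCount hd ht)
  refine Primrec.list_foldl (h := fun p q => p.1.fire q.1 q.2) Primrec.snd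
    (primrec_listCount hd hs) ?_
  have hd' := hd.comp (Primrec.fst (β := List ℕ × ℕ))
  have hv : Primrec fun p : (NetProblem × List ℕ) × List ℕ × ℕ => p.2.1 :=
    Primrec.fst.comp .snd
  have hT : Primrec fun p : (NetProblem × List ℕ) × List ℕ × ℕ => p.1.1.2.1 :=
    Primrec.fst.comp (Primrec.snd.comp (Primrec.fst.comp .fst))
  have hτ := (Primrec.list_getD (([], []) : List ℕ × List ℕ)).comp hT (Primrec.snd.comp .snd)
  have h1 := primrec_listCount hd' (Primrec.fst.comp hτ)
  have h2 := primrec_listCount hd' (Primrec.snd.comp hτ)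
  exact Primrec.ite (Primrec.eq.comp (primrec_listSub hd' h1 hv) (primrec_zeros hd'))
    (primrec_listAdd hd' (primrec_listSub hd' hv h1) h2) hv

/-- A predicate for which both positive and negative instances have recognisable certificates is
decidable. -/
theorem exists_computable_of_certificates {β γ : Type*} [Primcodable β] [Primcodable γ]
    {p : α → Prop} {r : α → β → Prop} {s : α → γ → Prop} (hr : PrimrecRel r) (hs : PrimrecRel s)
    (hp : ∀ a, p a ↔ ∃ b, r a b) (hn : ∀ a, ¬ p a ↔ ∃ c, s a c) :
    ∃ f : α → Bool, Computable f ∧ ∀ a, f a = true ↔ p a := by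
  obtain ⟨_, hr⟩ := hr
  obtain ⟨_, hs⟩ := hs
  classical
  let yes (a : α) (n : ℕ) : Option Bool :=
    (Encodable.decode (α := β) n).bind fun b => if r a b then some true else none
  let no (a : α) (n : ℕ) : Option Bool :=
    (Encodable.decode (α := γ) n).bind fun c => if s a c then some false else none
  let g (a : α) (n : ℕ) : Option Bool := yes a n <|> no a n
  have hyes : Primrec₂ yes := by
    refine Primrec.option_bind (Primrec.decode.comp .snd) ?_
    exact Primrec.ite (Primrec.primrecPred (p := fun x : (α × ℕ) × β => r x.1.1 x.2)
      ((hr.comp ((Primrec.fst.comp .fst).pair .snd)).of_eq fun _ => by simp))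
      (.const _) (.const _)
  have hno : Primrec₂ no := by
    refine Primrec.option_bind (Primrec.decode.comp .snd) ?_
    exact Primrec.ite (Primrec.primrecPred (p := fun x : (α × ℕ) × γ => s x.1.1 x.2)
      ((hs.comp ((Primrec.fst.comp .fst).pair .snd)).of_eq fun _ => by simp))
      (.const _) (.const _)
  have hg : Primrec₂ g := Primrec.option_orElse.comp hyes hno
  have hsound : ∀ a n b, b ∈ g a n → (b = true ↔ p a) := by
    intro a n b hb
    simp only [g, yes, no, Option.mem_def, Option.orElse_eq_some, Option.bind_eq_some_iff,
      Option.bind_eq_none_iff] at hb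
    rcases hb with ⟨x, -, h⟩ | ⟨-, x, -, h⟩
    · split_ifs at h with h'
      simp only [Option.some.injEq] at h
      simp [← h, (hp a).2 ⟨x, h'⟩]
    · split_ifs at h with h'
      simp only [Option.some.injEq] at h
      simp [← h, (hn a).2 ⟨x, h'⟩]
  have hdom : ∀ a, (Nat.rfindOpt (g a)).Dom := by
    intro a
    refine Nat.rfindOpt_dom.2 ?_
    by_cases h : p a
    · obtain ⟨b, hb⟩ := (hp a).1 h
      exact ⟨Encodable.encode b, true, by simp [g, yes, hb]⟩
    · obtain ⟨c, hc⟩ := (hn a).1 h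
      have hne : ∀ b, ¬ r a b := fun b hb => h ((hp a).2 ⟨b, hb⟩)
      have hy : yes a (Encodable.encode c) = none := by simp [yes, hne]
      exact ⟨Encodable.encode c, false, by simp [g, hy, no, hc]⟩
  refine ⟨fun a => (Nat.rfindOpt (g a)).get (hdom a), ?_, fun a => ?_⟩
  · exact (Partrec.rfindOpt hg.to_comp).of_eq_tot fun a => Part.get_mem _
  · obtain ⟨n, hn⟩ := Nat.rfindOpt_spec (Part.get_mem (hdom a))
    exact hsound a n _ hn

theorem exists_computable_reachable :
    ∃ f : NetProblem → Bool, Computable f ∧ ∀ x, f x = true ↔ x.Reachable :=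
  exists_computable_of_certificates primrecRel_runCheck primrecRel_sepCheck
    (fun _ => ⟨exists_runCheck, fun ⟨_, h⟩ => h.reachable⟩)
    (fun _ => ⟨exists_sepCheck, fun ⟨_, h⟩ => h.not_reachable⟩)

end NetDecidability

section Transfer

variable {α : Type*}

/-- The marking of the numbered places given by a multiset of tokens. -/
def codeCount (c : α → ℕ) (d : ℕ) : Multiset α →+ (Fin d → ℕ) where
  toFun M i := (M.map c).count (i : ℕ)
  map_zero' := by ext; simp
  map_add' M N := by ext; simp

theorem le_of_codeCount_le {c : α → ℕ} (hc : Function.Injective c) {d : ℕ} {A B : Multiset α}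
    (hA : ∀ a ∈ A, c a < d) (h : codeCount c d A ≤ codeCount c d B) : A ≤ B := by
  classical
  refine Multiset.le_iff_count.2 fun a => ?_
  by_cases ha : a ∈ A
  · have h1 : (A.map c).count (c a) ≤ (B.map c).count (c a) := h ⟨c a, hA a ha⟩
    rwa [Multiset.count_map_eq_count' c _ hc, Multiset.count_map_eq_count' c _ hc] at h1
  · rw [Multiset.count_eq_zero_of_notMem ha]
    exact zero_le

/-- A net on multisets and its numbered presentation have the same reachability relation. -/
theorem NetProblem.reachable_iff {c : α → ℕ} (hc : Function.Injective c) {x : NetProblem}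
    {T : Set (Multiset α × Multiset α)} {M M' : Multiset α}
    (h₁ : ∀ t ∈ T, ∃ τ ∈ x.2.1, (τ.1 : Multiset ℕ) = t.1.map c ∧ (τ.2 : Multiset ℕ) = t.2.map c)
    (h₂ : ∀ τ ∈ x.2.1, ∃ t ∈ T, (τ.1 : Multiset ℕ) = t.1.map c ∧ (τ.2 : Multiset ℕ) = t.2.map c)
    (hM : (x.2.2.1 : Multiset ℕ) = M.map c) (hM' : (x.2.2.2 : Multiset ℕ) = M'.map c)
    (hd : ∀ τ ∈ x.2.1, (∀ i ∈ τ.1, i < x.1) ∧ ∀ i ∈ τ.2, i < x.1)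
    (hds : ∀ i ∈ x.2.2.1, i < x.1) (hdt : ∀ i ∈ x.2.2.2, i < x.1) :
    x.Reachable ↔ MReach T M M' := by
  obtain ⟨d, ts, s, t⟩ := x
  have cv : ∀ {l : List ℕ} {A : Multiset α}, (l : Multiset ℕ) = A.map c →
      countVec d l = codeCount c d A := by
    intro l A h
    ext i
    change l.count (i : ℕ) = (A.map c).count (i : ℕ)
    rw [← h, Multiset.coe_count]
  have bd : ∀ {l : List ℕ} {A : Multiset α}, (l : Multiset ℕ) = A.map c →
      (∀ i ∈ l, i < d) → ∀ a ∈ A, c a < d := by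
    intro l A h hl a ha
    exact hl _ (Multiset.mem_coe.1 (h ▸ Multiset.mem_map_of_mem c ha))
  have bdT : ∀ u ∈ T, (∀ a ∈ u.1, c a < d) ∧ ∀ a ∈ u.2, c a < d := by
    intro u hu
    obtain ⟨τ, hτ, e1, e2⟩ := h₁ u hu
    exact ⟨bd e1 (hd τ hτ).1, bd e2 (hd τ hτ).2⟩
  unfold NetProblem.Reachable
  simp only at hM hM' hds hdt h₁ h₂
  rw [cv hM, cv hM']
  constructor
  · intro h
    have key : ∀ y, NReach (NetProblem.transitions (d, ts, s, t)) (codeCount c d M) y →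
        ∃ N, (∀ a ∈ N, c a < d) ∧ MReach T M N ∧ y = codeCount c d N := by
      intro y hy
      induction hy with
      | refl => exact ⟨M, bd hM hds, .refl, rfl⟩
      | tail _ hstep ih =>
        obtain ⟨N, hN, hMN, rfl⟩ := ih
        obtain ⟨_, ⟨τ, hτ, rfl⟩, z, e1, rfl⟩ := hstep
        obtain ⟨u, hu, f1, f2⟩ := h₂ τ hτ
        simp only [cv f1, cv f2] at e1 ⊢
        have hle : u.1 ≤ N := le_of_codeCount_le hc (bdT u hu).1 (e1 ▸ le_add_self)
        obtain ⟨w, rfl⟩ := Multiset.le_iff_exists_add.1 hle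
        rw [map_add, add_comm] at e1
        obtain rfl := add_right_cancel e1
        refine ⟨w + u.2, fun a ha => ?_, hMN.tail ⟨u, hu, w, add_comm _ _, rfl⟩, (map_add _ _ _).symm⟩
        rcases Multiset.mem_add.1 ha with ha | ha
        · exact hN a (Multiset.mem_add.2 (Or.inr ha))
        · exact (bdT u hu).2 a ha
    obtain ⟨N, hN, hMN, e⟩ := key _ h
    rwa [le_antisymm (le_of_codeCount_le hc (bd hM' hdt) e.le) (le_of_codeCount_le hc hN e.ge)]
  · intro h
    refine Relation.ReflTransGen.lift (codeCount c d) (fun A B hAB => ?_) _ _ h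
    obtain ⟨u, hu, w, rfl, rfl⟩ := hAB
    obtain ⟨τ, hτ, f1, f2⟩ := h₁ u hu
    exact ⟨_, ⟨τ, hτ, rfl⟩, codeCount c d w, by rw [map_add, cv f1], by rw [map_add, cv f2]⟩

end Transfer

section Decoding

theorem encode_list_map_encode {α : Type*} [Encodable α] (l : List α) :
    Encodable.encode (l.map Encodable.encode) = Encodable.encode l := by
  induction l with
  | nil => rfl
  | cons a l ih => simp [ih]

theorem encode_list_congr {α β : Type*} [Encodable α] [Encodable β] {l : List α} {f : α → β}
    (h : ∀ a, Encodable.encode (f a) = Encodable.encode a) :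
    Encodable.encode (l.map f) = Encodable.encode l := by
  rw [← encode_list_map_encode, ← encode_list_map_encode l, List.map_map]
  exact congrArg _ (List.map_congr_left fun a _ => h a)

theorem exists_list_encode_eq {α : Type*} [Encodable α] (M : Multiset α) :
    ∃ l : List α, (l : Multiset α) = M ∧ Encodable.encode l = Encodable.encode M := by
  obtain ⟨l, h⟩ : ∃ l : List α, encodeMultiset M = Encodable.encode l := by
    unfold encodeMultiset
    exact ⟨_, rfl⟩
  refine ⟨l, Option.some_injective _ ?_, h.symm⟩
  have h1 : decodeMultiset (encodeMultiset M) = some M := Encodable.encodek M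
  rwa [h, decodeMultiset, Encodable.encodek] at h1

/-- The list with a given code. -/
def unlist (α : Type*) [Primcodable α] (n : ℕ) : List α := (Encodable.decode n).getD []

theorem primrec_unlist {α : Type*} [Primcodable α] : Primrec (unlist α) :=
  Primrec.option_getD.comp Primrec.decode (Primrec.const [])

theorem unlist_encode {α : Type*} [Primcodable α] (l : List α) :
    unlist α (Encodable.encode l) = l := by
  simp [unlist]

theorem coe_unlist_encode {α : Type*} [Primcodable α] (M : Multiset α) :
    (unlist α (Encodable.encode M) : Multiset α) = M := by
  obtain ⟨l, rfl, h⟩ := exists_list_encode_eq M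
  rw [← h, unlist_encode]

theorem coe_unlist_encodeVec (v : Vec) :
    (unlist (ℕ × ℕ) (encodeVec v) : Multiset (ℕ × ℕ)) = v.graph.val :=
  coe_unlist_encode _

theorem coe_unlist_encodeZVec (v : ZVec) :
    (unlist (ℕ × ℕ) (encodeZVec v) : Multiset (ℕ × ℕ)) =
      v.graph.val.map fun e => (e.1, Encodable.encode e.2) := by
  obtain ⟨l, hl, h⟩ := exists_list_encode_eq v.graph.val
  rw [encodeZVec, ← h, ← hl,
    ← encode_list_congr (f := fun e : ℕ × ℤ => (e.1, Encodable.encode e.2)) (by simp),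
    unlist_encode, Multiset.map_coe]

theorem encodeVec_injective : Function.Injective encodeVec := by
  intro v w h
  apply Finsupp.graph_injective ℕ ℕ
  exact Finset.val_injective (Encodable.encode_injective h)

theorem mem_unlist_encodeVec {v : Vec} {π n : ℕ} :
    (π, n) ∈ unlist (ℕ × ℕ) (encodeVec v) ↔ v π = n ∧ n ≠ 0 := by
  rw [← Multiset.mem_coe, coe_unlist_encodeVec, Finset.mem_val, Finsupp.mk_mem_graph_iff]

/-- The code of a linear set. -/
def linCode (ℓ : Lin) : ℕ × List ℕ := (encodeVec ℓ.1, ℓ.2.map encodeVec)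

theorem linCode_injective : Function.Injective linCode := by
  rintro ⟨b, ps⟩ ⟨b', ps'⟩ h
  simp only [linCode, Prod.mk.injEq] at h
  rw [encodeVec_injective h.1, List.map_injective_iff.2 encodeVec_injective h.2]

theorem unlist_encodeSL (L : SemilinRep) : unlist (ℕ × List ℕ) (encodeSL L) = L.map linCode :=
  unlist_encode _

/-- The list containing `f e` copies of `g i` for every entry `e = (i, k)` of `l`. -/
def expand (f : ℕ × ℕ → ℕ) (g : ℕ → ℕ) (l : List (ℕ × ℕ)) : List ℕ :=
  l.flatMap fun e => (List.range (f e)).map fun _ => g e.1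

theorem coe_expand {f : ℕ × ℕ → ℕ} (g : ℕ → ℕ) (l : List (ℕ × ℕ)) :
    (expand f g l : Multiset ℕ) =
      ((l : Multiset (ℕ × ℕ)).map fun e => Multiset.replicate (f e) (g e.1)).sum := by
  induction l with
  | nil => rfl
  | cons e l ih =>
    have h1 : expand f g (e :: l) = List.replicate (f e) (g e.1) ++ expand f g l := by
      simp [expand]
    rw [h1, ← Multiset.coe_add, ih, ← Multiset.cons_coe, Multiset.map_cons, Multiset.sum_cons,
      Multiset.coe_replicate]

theorem sum_graph {β : Type*} [Zero β] (v : ℕ →₀ β) (F : ℕ → β → Multiset ℕ) :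
    (v.graph.val.map fun e => F e.1 e.2).sum = v.sum F := by
  rw [Finsupp.graph, Finset.map_val, Multiset.map_map]
  rfl

theorem coe_expand_vec (g : ℕ → Tok) (c : Tok → ℕ) (v : Vec) :
    (expand Prod.snd (fun i => c (g i)) (unlist (ℕ × ℕ) (encodeVec v)) : Multiset ℕ) =
      ((Finsupp.toMultiset v).map g).map c := by
  rw [coe_expand, coe_unlist_encodeVec, Multiset.map_map]
  refine (sum_graph v fun i k => Multiset.replicate k (c (g i))).trans ?_
  rw [Finsupp.toMultiset_map, Finsupp.toMultiset_apply, Finsupp.sum_mapDomain_index]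
  · simp [Finsupp.sum, Multiset.nsmul_singleton]
  · simp
  · simp [add_smul]

theorem coe_expand_zvec {φ : ℕ → ℕ} {ψ : ℤ → ℕ} (h0 : ψ 0 = 0)
    (h : ∀ n : ℤ, φ (Encodable.encode n) = ψ n) (c : Tok → ℕ) (v : ZVec) :
    (expand (fun e => φ e.2) (fun i => c (.pl i)) (unlist (ℕ × ℕ) (encodeZVec v)) : Multiset ℕ) =
      (plv (v.mapRange ψ h0)).map c := by
  rw [coe_expand, coe_unlist_encodeZVec, Multiset.map_map, plv, Multiset.map_map]
  simp only [Function.comp_def, h]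
  refine (sum_graph v fun i k => Multiset.replicate (ψ k) (c (.pl i))).trans ?_
  rw [Finsupp.toMultiset_map, Finsupp.toMultiset_apply, Finsupp.sum_mapDomain_index,
    Finsupp.sum_mapRange_index]
  · simp [Finsupp.sum, Multiset.nsmul_singleton]
  · simp
  · simp
  · simp [add_smul]

theorem coe_expand_single (h : Hist) (v : Vec) (π p : ℕ) (c : Tok → ℕ) :
    (expand (fun e => if e.1 = π ∧ h.lookup π = none then e.2 else 0) (fun _ => c (.pl p))
      (unlist (ℕ × ℕ) (encodeVec v)) : Multiset ℕ) =
      (plv (Finsupp.single p (undelivered h v π))).map c := by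
  rw [coe_expand, coe_unlist_encodeVec]
  refine (sum_graph v fun i k => Multiset.replicate (if i = π ∧ h.lookup π = none then k else 0)
    (c (.pl p))).trans ?_
  rw [undelivered_apply, plv, Finsupp.toMultiset_single, Multiset.map_nsmul, Multiset.map_nsmul]
  by_cases hh : h.lookup π = none
  · rw [if_pos hh]
    simp only [hh, and_true]
    rw [Finsupp.sum, Finset.sum_eq_single π]
    · simp [Multiset.nsmul_singleton]
    · intro b _ hb
      simp [hb]
    · intro hb
      simp [Finsupp.notMem_support_iff.1 hb]
  · simp [hh, Finsupp.sum]

/-- The nonnegative part of the integer with a given code. -/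
def intPos (n : ℕ) : ℕ := if n % 2 = 0 then n / 2 else 0

/-- The nonpositive part of the integer with a given code. -/
def intNeg (n : ℕ) : ℕ := if n % 2 = 1 then n / 2 + 1 else 0

theorem intPos_encode (n : ℤ) : intPos (Encodable.encode n) = n.toNat := by
  rcases n with n | n
  · change intPos (2 * n) = _
    simp [intPos]
  · change intPos (2 * n + 1) = _
    simp [intPos]

theorem intNeg_encode (n : ℤ) : intNeg (Encodable.encode n) = (-n).toNat := by
  rcases n with n | n
  · change intNeg (2 * n) = _
    simp [intNeg]
  · change intNeg (2 * n + 1) = _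
    rw [intNeg, if_pos (by omega), Int.neg_negSucc, Int.toNat_natCast]
    omega

end Decoding

section NetCodes

abbrev LinC : Type := ℕ × List ℕ

/-- The code of an edge: source, code of the operation, target. -/
abbrev EdgeC : Type := ℕ × ℕ × ℕ

/-- The data of a balloon apart from its state: slot, code of the linear set, deliveries. -/
abbrev Slot : Type := ℕ × LinC × Hist

def plC (p : ℕ) : ℕ := Nat.pair 0 p
def ctlC (q : ℕ) : ℕ := Nat.pair 1 q
def frC (j : ℕ) : ℕ := Nat.pair 2 j
def sbC (j s : ℕ) (c : LinC) (h : Hist) : ℕ := Nat.pair 3 (Encodable.encode (j, s, c, h))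
def dnC (j : ℕ) (c : LinC) (h : Hist) : ℕ := Nat.pair 4 (Encodable.encode (j, c, h))
def exC (j π : ℕ) : ℕ := Nat.pair 5 (Nat.pair j π)

def Tok.code : Tok → ℕ
  | .pl p => plC p
  | .ctl q => ctlC q
  | .fr j => frC j
  | .sb j s ℓ h => sbC j s (linCode ℓ) h
  | .dn j ℓ h => dnC j (linCode ℓ) h
  | .ex j π => exC j π

theorem Tok.code_injective : Function.Injective Tok.code := by
  intro a b h
  cases a <;> cases b <;>
    simp only [Tok.code, plC, ctlC, frC, sbC, dnC, exC, Nat.pair_eq_pair, Encodable.encode_inj,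
      Prod.mk.injEq, linCode_injective.eq_iff] at h
  all_goals first | (simp at h; done) | simp [h]

/-- The states that balloons can assume by an edge. -/
def edgeStates (e : EdgeC) : List ℕ :=
  if e.2.1.unpair.1 = 1 then [e.2.1.unpair.2.unpair.1]
  else if e.2.1.unpair.1 = 2 then [e.2.1.unpair.2.unpair.2.unpair.1] else []

/-- The linear sets of an edge. -/
def edgeLins (e : EdgeC) : List LinC :=
  if e.2.1.unpair.1 = 1 then unlist LinC e.2.1.unpair.2.unpair.2 else []

/-- The deliveries of an edge. -/
def edgeDeliveries (e : EdgeC) : List (ℕ × ℕ) :=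
  if e.2.1.unpair.1 = 2 then [e.2.1.unpair.2.unpair.2.unpair.2.unpair] else []

/-- The results of at most `n` deliveries from `P`. -/
def hists (P : List (ℕ × ℕ)) : ℕ → List Hist
  | 0 => [[]]
  | n + 1 => hists P n ++ (hists P n ×ˢ P).map fun x => x.1.push x.2.1 x.2.2

theorem nodup_keys_push {h : Hist} {π p : ℕ} (hh : (h.map Prod.fst).Nodup) :
    ((h.push π p).map Prod.fst).Nodup := by
  unfold Hist.push
  split_ifs with hπ
  · rw [List.lookup_eq_none_iff] at hπ
    rw [List.map_append, List.nodup_append']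
    refine ⟨hh, by simp, ?_⟩
    simp only [List.map_cons, List.map_nil, List.disjoint_singleton, List.mem_map, not_exists,
      not_and]
    exact fun x hx hx' => bne_iff_ne.1 (hπ x hx) hx'.symm
  · exact hh

theorem push_subset {h : Hist} {π p : ℕ} {P : List (ℕ × ℕ)} (hh : h ⊆ P) (he : (π, p) ∈ P) :
    h.push π p ⊆ P := by
  unfold Hist.push
  split_ifs
  · exact List.append_subset.2 ⟨hh, by simpa using he⟩
  · exact hh

theorem mem_hists {P : List (ℕ × ℕ)} {n : ℕ} {h : Hist} :
    h ∈ hists P n ↔ (h.map Prod.fst).Nodup ∧ h ⊆ P ∧ h.length ≤ n := by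
  induction n generalizing h with
  | zero =>
    simp only [hists, List.mem_singleton, Nat.le_zero, List.length_eq_zero_iff]
    constructor
    · rintro rfl
      simp
    · exact fun h => h.2.2
  | succ n ih =>
    simp only [hists, List.mem_append, List.mem_map, Prod.exists, List.mem_product]
    constructor
    · rintro (h1 | ⟨h', π, p, ⟨h1, h2⟩, rfl⟩)
      · obtain ⟨h2, h3, h4⟩ := ih.1 h1
        exact ⟨h2, h3, h4.trans n.le_succ⟩
      · obtain ⟨h3, h4, h5⟩ := ih.1 h1
        refine ⟨nodup_keys_push h3, push_subset h4 h2, ?_⟩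
        exact (Hist.length_push_le _ _ _).trans (Nat.succ_le_succ h5)
    · rintro ⟨h1, h2, h3⟩
      rcases List.eq_nil_or_concat' h with rfl | ⟨h', ⟨π, p⟩, rfl⟩
      · exact Or.inl (ih.2 ⟨h1, h2, Nat.zero_le n⟩)
      · rw [List.map_append, List.nodup_append'] at h1
        rw [List.append_subset] at h2
        refine Or.inr ⟨h', π, p, ⟨ih.2 ⟨h1.1, h2.1, ?_⟩, h2.2 (List.mem_singleton_self _)⟩, ?_⟩
        · simpa using h3
        · rw [Hist.push, if_pos]
          rw [List.lookup_eq_none_iff]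
          rintro x hx
          rw [bne_iff_ne]
          rintro rfl
          exact h1.2.2 (List.mem_map_of_mem hx) (by simp)

theorem push_mem_hists {P : List (ℕ × ℕ)} {h : Hist} (hh : h ∈ hists P P.length) {e : ℕ × ℕ}
    (he : e ∈ P) : h.push e.1 e.2 ∈ hists P P.length := by
  obtain ⟨h1, h2, -⟩ := mem_hists.1 hh
  have h3 := nodup_keys_push (π := e.1) (p := e.2) h1
  have h4 := push_subset (π := e.1) (p := e.2) h2 he
  exact mem_hists.2 ⟨h3, h4, (h3.of_map.subperm h4).length_le⟩

/-- The number of proper slots. -/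
def slotBound (s l h r : ℕ) : ℕ := l * h * (fun N => (s + 1) * N * N)^[r] 2

def netStates (E : List EdgeC) : List ℕ := E.flatMap edgeStates
def netLins (E : List EdgeC) : List LinC := E.flatMap edgeLins
def netDeliveries (E : List EdgeC) : List (ℕ × ℕ) := E.flatMap edgeDeliveries
def netHists (E : List EdgeC) : List Hist := hists (netDeliveries E) (netDeliveries E).length
def netBound (E : List EdgeC) : ℕ := slotBound (netStates E).length (netLins E).length
  (netHists E).length (netDeliveries E).length
def netSlots (E : List EdgeC) : List Slot :=
  List.range (netBound E + 1) ×ˢ (netLins E ×ˢ netHists E)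

abbrev TransC : Type := List ℕ × List ℕ

def deltaTrans (e : EdgeC) : TransC :=
  (ctlC e.1 :: expand (fun x => intNeg x.2) plC (unlist (ℕ × ℕ) e.2.1.unpair.2),
    ctlC e.2.2 :: expand (fun x => intPos x.2) plC (unlist (ℕ × ℕ) e.2.1.unpair.2))

def inflateTrans (e : EdgeC) (x : ℕ × LinC) : TransC :=
  (ctlC e.1 :: (if x.1 = 0 then [] else [frC x.1]),
    [ctlC e.2.2, sbC x.1 e.2.1.unpair.2.unpair.1 x.2 []])

def deflateTrans (e : EdgeC) (t : Slot) : TransC :=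
  ([ctlC e.1, sbC t.1 e.2.1.unpair.2.unpair.1 t.2.1 t.2.2],
    ctlC e.2.2 :: sbC t.1 e.2.1.unpair.2.unpair.2.unpair.1 t.2.1
      (t.2.2.push e.2.1.unpair.2.unpair.2.unpair.2.unpair.1
        e.2.1.unpair.2.unpair.2.unpair.2.unpair.2) ::
    expand (fun x => if x.1 = e.2.1.unpair.2.unpair.2.unpair.2.unpair.1 ∧
        t.2.2.lookup e.2.1.unpair.2.unpair.2.unpair.2.unpair.1 = none then x.2 else 0)
      (fun _ => plC e.2.1.unpair.2.unpair.2.unpair.2.unpair.2) (unlist (ℕ × ℕ) t.2.1.1))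

def burstTrans (e : EdgeC) (t : Slot) : TransC :=
  ([ctlC e.1, sbC t.1 e.2.1.unpair.2 t.2.1 t.2.2], [ctlC e.2.2, dnC t.1 t.2.1 t.2.2])

/-- The transitions contributed by an edge. -/
def edgeTrans (K : ℕ) (ts : List Slot) (e : EdgeC) : List TransC :=
  if e.2.1.unpair.1 = 0 then [deltaTrans e]
  else if e.2.1.unpair.1 = 1 then
    (List.range (K + 1) ×ˢ unlist LinC e.2.1.unpair.2.unpair.2).map (inflateTrans e)
  else if e.2.1.unpair.1 = 2 then ts.map (deflateTrans e)
  else ts.map (burstTrans e)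

def fillTrans (t : Slot) (x : ℕ × ℕ) : TransC :=
  ([sbC t.1 x.1 t.2.1 []],
    sbC t.1 x.1 t.2.1 [] :: expand Prod.snd (exC t.1) (unlist (ℕ × ℕ) x.2))

def deliverTrans (t : Slot) (x : ℕ × ℕ × ℕ) : TransC :=
  ([sbC t.1 x.1 t.2.1 t.2.2, exC t.1 x.2.1], [sbC t.1 x.1 t.2.1 t.2.2, plC x.2.2])

def trashTrans (t : Slot) (e : ℕ × ℕ) : TransC :=
  ([dnC t.1 t.2.1 t.2.2, exC t.1 e.1], [dnC t.1 t.2.1 t.2.2])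

/-- The transitions contributed by a slot. -/
def slotTrans (S : List ℕ) (P : List (ℕ × ℕ)) (t : Slot) : List TransC :=
  ([dnC t.1 t.2.1 t.2.2], []) ::
    if t.1 = 0 then [] else
      (S ×ˢ t.2.1.2).map (fillTrans t) ++
      ((S ×ˢ P).flatMap fun x =>
        if t.2.2.lookup x.2.1 = some x.2.2 then [deliverTrans t x] else []) ++
      ((t.2.1.2.flatMap (unlist (ℕ × ℕ))).flatMap fun e =>
        if t.2.2.lookup e.1 = none then [trashTrans t e] else [])

/-- The transitions of the net simulating a VASSB. -/
def netTrans (E : List EdgeC) : List TransC :=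
  E.flatMap (edgeTrans (netBound E) (netSlots E)) ++
    (netSlots E).flatMap (slotTrans (netStates E) (netDeliveries E)) ++
    (List.range (netBound E)).map fun i => ([frC (i + 1)], [])

/-- The marking of a semiconfiguration. -/
def semiTokens (q m : ℕ) : List ℕ := ctlC q :: expand Prod.snd plC (unlist (ℕ × ℕ) m)

/-- The free slots. -/
def freeTokens (E : List EdgeC) : List ℕ := (List.range (netBound E)).map fun i => frC (i + 1)

/-- A strict upper bound for all tokens of a presentation. -/
def tokenBound (ts : List TransC) (s t : List ℕ) : ℕ :=
  (ts.flatMap fun τ => τ.1 ++ τ.2).sum + s.sum + t.sum + 1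

/-- The reachability problem of the net simulating a VASSB. -/
def netOf (E : List EdgeC) (q m q' m' : ℕ) : NetProblem :=
  (tokenBound (netTrans E) (semiTokens q m ++ freeTokens E) (semiTokens q' m'), netTrans E,
    semiTokens q m ++ freeTokens E, semiTokens q' m')

end NetCodes

section NetCorrectness

/-- The token lists `τ` present the transition `t`. -/
def Codes (τ : TransC) (t : Multiset Tok × Multiset Tok) : Prop :=
  (τ.1 : Multiset ℕ) = t.1.map Tok.code ∧ (τ.2 : Multiset ℕ) = t.2.map Tok.code

theorem codes_delta (q q' : ℕ) (d : ZVec) : Codes (deltaTrans (q, encodeVOp (.delta d), q'))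
    ({.ctl q} + plv (d.mapRange (fun n => (-n).toNat) rfl),
      {.ctl q'} + plv (d.mapRange Int.toNat rfl)) := by
  simp only [Codes, deltaTrans, encodeVOp, Nat.unpair_pair, ← Multiset.cons_coe,
    Multiset.map_cons, Multiset.singleton_add]
  constructor
  · exact congrArg (Multiset.cons _) (coe_expand_zvec _ intNeg_encode Tok.code d)
  · exact congrArg (Multiset.cons _) (coe_expand_zvec _ intPos_encode Tok.code d)

theorem codes_inflate (j q q' s : ℕ) (L : SemilinRep) (ℓ : Lin) :
    Codes (inflateTrans (q, encodeVOp (.inflate s L), q') (j, linCode ℓ))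
      ({.ctl q} + frm j, {.ctl q'} + {.sb j s ℓ []}) := by
  simp only [Codes, inflateTrans, encodeVOp, Nat.unpair_pair, ← Multiset.cons_coe,
    Multiset.map_cons, Multiset.singleton_add, frm]
  constructor
  · split_ifs <;> rfl
  · rfl

theorem codes_deflate (j q q' s s' π p : ℕ) (ℓ : Lin) (h : Hist) :
    Codes (deflateTrans (q, encodeVOp (.deflate s s' π p), q') (j, linCode ℓ, h))
      ({.ctl q} + {.sb j s ℓ h}, {.ctl q'} + {.sb j s' ℓ (h.push π p)} +
        plv (Finsupp.single p (undelivered h ℓ.1 π))) := by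
  simp only [Codes, deflateTrans, encodeVOp, Nat.unpair_pair, ← Multiset.cons_coe,
    Multiset.map_cons, Multiset.singleton_add, Encodable.encode_prod_val,
    Encodable.encode_nat, Multiset.cons_add]
  exact ⟨rfl, congrArg (Multiset.cons _) (congrArg (Multiset.cons _) (coe_expand_single h ℓ.1 π p Tok.code))⟩

theorem codes_burst (j q q' s : ℕ) (ℓ : Lin) (h : Hist) :
    Codes (burstTrans (q, encodeVOp (.burst s), q') (j, linCode ℓ, h))
      ({.ctl q} + {.sb j s ℓ h}, {.ctl q'} + {.dn j ℓ h}) := by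
  simp only [Codes, burstTrans, encodeVOp, Nat.unpair_pair, ← Multiset.cons_coe,
    Multiset.map_cons, Multiset.singleton_add]
  exact ⟨rfl, rfl⟩

theorem codes_fill (j s : ℕ) (ℓ : Lin) (h : Hist) (v : Vec) :
    Codes (fillTrans (j, linCode ℓ, h) (s, encodeVec v))
      ({.sb j s ℓ []}, {.sb j s ℓ []} + exv j v) := by
  simp only [Codes, fillTrans, ← Multiset.cons_coe,
    Multiset.map_cons, Multiset.singleton_add]
  exact ⟨rfl, congrArg (Multiset.cons _) (coe_expand_vec (.ex j) Tok.code v)⟩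

theorem codes_deliver (j s π p : ℕ) (ℓ : Lin) (h : Hist) :
    Codes (deliverTrans (j, linCode ℓ, h) (s, π, p))
      ({.sb j s ℓ h} + {.ex j π}, {.sb j s ℓ h} + {.pl p}) := ⟨rfl, rfl⟩

theorem codes_trash (j π n : ℕ) (ℓ : Lin) (h : Hist) :
    Codes (trashTrans (j, linCode ℓ, h) (π, n)) ({.dn j ℓ h} + {.ex j π}, {.dn j ℓ h}) := ⟨rfl, rfl⟩

theorem edgeTrans_deflate (K : ℕ) (ts : List Slot) (q s s' π p q' : ℕ) :
    edgeTrans K ts (q, encodeVOp (.deflate s s' π p), q') =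
      ts.map (deflateTrans (q, encodeVOp (.deflate s s' π p), q')) := by
  have h1 : (encodeVOp (.deflate s s' π p)).unpair.1 = 2 := congrArg Prod.fst (Nat.unpair_pair _ _)
  simp [edgeTrans, h1]

theorem edgeTrans_burst (K : ℕ) (ts : List Slot) (q s q' : ℕ) :
    edgeTrans K ts (q, encodeVOp (.burst s), q') =
      ts.map (burstTrans (q, encodeVOp (.burst s), q')) := by
  have h1 : (encodeVOp (.burst s)).unpair.1 = 3 := congrArg Prod.fst (Nat.unpair_pair _ _)
  simp [edgeTrans, h1]

variable {V : VASSB} {E : List EdgeC}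

/-- `E` lists the codes of the edges of `V`. -/
def EdgeCodes (V : VASSB) (E : List EdgeC) : Prop :=
  ∀ e : EdgeC, e ∈ E ↔ ∃ o, (e.1, o, e.2.2) ∈ V.edges ∧ e.2.1 = encodeVOp o

theorem EdgeCodes.mem (hE : EdgeCodes V E) {q q' : ℕ} {o : VOp} (he : (q, o, q') ∈ V.edges) :
    (q, encodeVOp o, q') ∈ E := (hE _).2 ⟨o, he, rfl⟩

theorem mem_netStates_inflate (hE : EdgeCodes V E) {q s q' : ℕ} {L : SemilinRep}
    (he : (q, .inflate s L, q') ∈ V.edges) : s ∈ netStates E := by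
  refine List.mem_flatMap.2 ⟨_, hE.mem he, ?_⟩
  simp [edgeStates, encodeVOp]

theorem mem_netStates_deflate (hE : EdgeCodes V E) {q s s' π p q' : ℕ}
    (he : (q, .deflate s s' π p, q') ∈ V.edges) : s' ∈ netStates E := by
  refine List.mem_flatMap.2 ⟨_, hE.mem he, ?_⟩
  simp [edgeStates, encodeVOp]

theorem mem_netDeliveries (hE : EdgeCodes V E) {q s s' π p q' : ℕ}
    (he : (q, .deflate s s' π p, q') ∈ V.edges) : (π, p) ∈ netDeliveries E := by
  refine List.mem_flatMap.2 ⟨_, hE.mem he, ?_⟩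
  simp [edgeDeliveries, encodeVOp]

theorem mem_netLins (hE : EdgeCodes V E) {q s q' : ℕ} {L : SemilinRep} {ℓ : Lin}
    (he : (q, .inflate s L, q') ∈ V.edges) (hℓ : ℓ ∈ L) : linCode ℓ ∈ netLins E := by
  refine List.mem_flatMap.2 ⟨_, hE.mem he, ?_⟩
  simp only [edgeLins, encodeVOp, Nat.unpair_pair, if_true, unlist_encodeSL]
  exact List.mem_map_of_mem hℓ

theorem exists_linCode_eq (hE : EdgeCodes V E) {c : LinC} (hc : c ∈ netLins E) :
    ∃ ℓ, linCode ℓ = c := by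
  obtain ⟨⟨q, _, q'⟩, he, hc⟩ := List.mem_flatMap.1 hc
  obtain ⟨o, -, rfl⟩ := (hE _).1 he
  cases o with
  | inflate s L =>
    simp only [edgeLins, encodeVOp, Nat.unpair_pair, if_true, unlist_encodeSL] at hc
    obtain ⟨ℓ, -, h⟩ := List.mem_map.1 hc
    exact ⟨ℓ, h⟩
  | _ => simp [edgeLins, encodeVOp] at hc

theorem nil_mem_hists (P : List (ℕ × ℕ)) (n : ℕ) : [] ∈ hists P n := mem_hists.2 (by simp)

/-- The linear sets occurring in the edges `E`. -/
def linSet (E : List EdgeC) : Set Lin := {ℓ | linCode ℓ ∈ netLins E}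

theorem bounds_netOf (hE : EdgeCodes V E) : Bounds V (netStates E).toFinset
    (linSet E) {h | h ∈ netHists E} (netDeliveries E).length where
  inflate he := ⟨List.mem_toFinset.2 (mem_netStates_inflate hE he),
    fun _ hℓ => mem_netLins hE he hℓ⟩
  deflate he := ⟨List.mem_toFinset.2 (mem_netStates_deflate hE he),
    fun _ hh => push_mem_hists hh (mem_netDeliveries hE he)⟩
  nil := nil_mem_hists _ _
  length_le _ hh := (mem_hists.1 hh).2.2

theorem mem_netSlots {t : Slot} : t ∈ netSlots E ↔
    t.1 ≤ netBound E ∧ t.2.1 ∈ netLins E ∧ t.2.2 ∈ netHists E := by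
  obtain ⟨j, c, h⟩ := t
  simp [netSlots, List.mem_product]

theorem exists_netTrans_codes (hE : EdgeCodes V E) {t : Multiset Tok × Multiset Tok}
    (ht : t ∈ netSet V (netBound E) (netStates E).toFinset (linSet E) {h | h ∈ netHists E}) :
    ∃ τ ∈ netTrans E, Codes τ t := by
  have edge : ∀ {q o q' τ}, (q, o, q') ∈ V.edges →
      τ ∈ edgeTrans (netBound E) (netSlots E) (q, encodeVOp o, q') → τ ∈ netTrans E := by
    intro q o q' τ he hτ
    refine List.mem_append_left _ (List.mem_append_left _ (List.mem_flatMap.2 ⟨_, hE.mem he, hτ⟩))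
  have slots : ∀ {j ℓ h}, j ≤ netBound E → ℓ ∈ linSet E → h ∈ netHists E →
      ((j, linCode ℓ, h) : Slot) ∈ netSlots E := fun hj hℓ hh => mem_netSlots.2 ⟨hj, hℓ, hh⟩
  have slot : ∀ {j ℓ h τ}, j ≤ netBound E → ℓ ∈ linSet E → h ∈ netHists E →
      τ ∈ slotTrans (netStates E) (netDeliveries E) (j, linCode ℓ, h) → τ ∈ netTrans E := by
    intro j ℓ h τ hj hℓ hh hτ
    exact List.mem_append_left _ (List.mem_append_right _
      (List.mem_flatMap.2 ⟨_, slots hj hℓ hh, hτ⟩))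
  cases ht with
  | delta he => exact ⟨_, edge he (by simp [edgeTrans, encodeVOp]), codes_delta _ _ _⟩
  | @inflate j _ _ _ L ℓ hj he hℓ =>
    refine ⟨_, edge he ?_, codes_inflate j _ _ _ L ℓ⟩
    have h1 : (j, linCode ℓ) ∈ List.range (netBound E + 1) ×ˢ List.map linCode L :=
      List.mem_product.2 ⟨List.mem_range.2 (Nat.lt_succ_of_le hj), List.mem_map_of_mem hℓ⟩
    simpa [edgeTrans, encodeVOp, unlist_encodeSL] using List.mem_map_of_mem h1
  | deflate hj he hℓ hh =>
    refine ⟨_, edge he ?_, codes_deflate _ _ _ _ _ _ _ _ _⟩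
    rw [edgeTrans_deflate]
    exact List.mem_map_of_mem (slots hj hℓ hh)
  | burst hj he hℓ hh =>
    refine ⟨_, edge he ?_, codes_burst _ _ _ _ _ _⟩
    rw [edgeTrans_burst]
    exact List.mem_map_of_mem (slots hj hℓ hh)
  | @fill j s ℓ v hj hj' hs hℓ hv =>
    refine ⟨_, slot hj' hℓ (nil_mem_hists _ _) ?_, codes_fill _ _ _ [] _⟩
    refine List.mem_cons_of_mem _ ?_
    rw [if_neg (Nat.one_le_iff_ne_zero.1 hj)]
    refine List.mem_append_left _ (List.mem_append_left _ (List.mem_map_of_mem ?_))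
    exact List.mem_product.2 ⟨List.mem_toFinset.1 hs, List.mem_map_of_mem hv⟩
  | @deliver j s ℓ h π p hj hj' hs hℓ hh hp =>
    refine ⟨_, slot hj' hℓ hh ?_, codes_deliver _ _ _ _ _ _⟩
    refine List.mem_cons_of_mem _ ?_
    rw [if_neg (Nat.one_le_iff_ne_zero.1 hj)]
    refine List.mem_append_left _ (List.mem_append_right _ (List.mem_flatMap.2 ⟨(s, π, p), ?_, ?_⟩))
    · refine List.mem_product.2 ⟨List.mem_toFinset.1 hs, (mem_hists.1 hh).2.1 ?_⟩
      obtain ⟨l₁, l₂, rfl, -⟩ := List.lookup_eq_some_iff.1 hp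
      simp
    · rw [if_pos hp]
      exact List.mem_singleton_self _
  | @trash j ℓ h π v hj hj' hℓ hh hv hπ hp =>
    refine ⟨_, slot hj' hℓ hh ?_, codes_trash _ _ (v π) _ _⟩
    refine List.mem_cons_of_mem _ ?_
    rw [if_neg (Nat.one_le_iff_ne_zero.1 hj)]
    refine List.mem_append_right _ (List.mem_flatMap.2 ⟨(π, v π), ?_, ?_⟩)
    · exact List.mem_flatMap.2 ⟨_, List.mem_map_of_mem hv, mem_unlist_encodeVec.2 ⟨rfl, hπ⟩⟩
    · rw [if_pos hp]
      exact List.mem_singleton_self _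
  | @dropFree j hj hj' =>
    refine ⟨([frC j], []), List.mem_append_right _ (List.mem_map.2 ⟨j - 1, ?_, ?_⟩), rfl, rfl⟩
    · rw [List.mem_range]
      omega
    · rw [Nat.sub_add_cancel hj]
  | dropDone hj hℓ hh => exact ⟨_, slot hj hℓ hh List.mem_cons_self, rfl, rfl⟩

theorem exists_netSet_codes (hE : EdgeCodes V E) {τ : TransC} (hτ : τ ∈ netTrans E) :
    ∃ t ∈ netSet V (netBound E) (netStates E).toFinset (linSet E) {h | h ∈ netHists E},
      Codes τ t := by
  simp only [netTrans, List.mem_append, or_assoc] at hτ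
  rcases hτ with hτ | hτ | hτ
  · obtain ⟨⟨q, _, q'⟩, he, hτ⟩ := List.mem_flatMap.1 hτ
    obtain ⟨o, he, rfl⟩ := (hE _).1 he
    simp only at he hτ
    cases o with
    | delta d =>
      simp only [edgeTrans, encodeVOp, Nat.unpair_pair, if_true, List.mem_singleton] at hτ
      subst hτ
      exact ⟨_, .delta he, codes_delta _ _ _⟩
    | inflate s L =>
      simp only [edgeTrans, encodeVOp, Nat.unpair_pair, if_true, if_neg one_ne_zero,
        unlist_encodeSL] at hτ
      obtain ⟨⟨j, c⟩, hjc, rfl⟩ := List.mem_map.1 hτ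
      obtain ⟨hj, hc⟩ := List.mem_product.1 hjc
      obtain ⟨ℓ, hℓ, rfl⟩ := List.mem_map.1 hc
      exact ⟨_, .inflate (Nat.le_of_lt_succ (List.mem_range.1 hj)) he hℓ,
        codes_inflate _ _ _ _ L _⟩
    | deflate s s' π p =>
      rw [edgeTrans_deflate] at hτ
      obtain ⟨⟨j, c, h⟩, ht, rfl⟩ := List.mem_map.1 hτ
      obtain ⟨hj, hc, hh⟩ := mem_netSlots.1 ht
      obtain ⟨ℓ, rfl⟩ := exists_linCode_eq hE hc
      exact ⟨_, .deflate hj he hc hh, codes_deflate _ _ _ _ _ _ _ _ _⟩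
    | burst s =>
      rw [edgeTrans_burst] at hτ
      obtain ⟨⟨j, c, h⟩, ht, rfl⟩ := List.mem_map.1 hτ
      obtain ⟨hj, hc, hh⟩ := mem_netSlots.1 ht
      obtain ⟨ℓ, rfl⟩ := exists_linCode_eq hE hc
      exact ⟨_, .burst hj he hc hh, codes_burst _ _ _ _ _ _⟩
  · obtain ⟨⟨j, c, h⟩, ht, hτ⟩ := List.mem_flatMap.1 hτ
    obtain ⟨hj, hc, hh⟩ := mem_netSlots.1 ht
    obtain ⟨⟨b, ps⟩, rfl⟩ := exists_linCode_eq hE hc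
    rcases List.mem_cons.1 hτ with rfl | hτ
    · exact ⟨_, .dropDone hj hc hh, rfl, rfl⟩
    split_ifs at hτ with hj0
    · simp at hτ
    have hj1 : 1 ≤ j := Nat.one_le_iff_ne_zero.2 hj0
    simp only [List.mem_append, or_assoc] at hτ
    rcases hτ with hτ | hτ | hτ
    · obtain ⟨⟨s, c⟩, hsv, rfl⟩ := List.mem_map.1 hτ
      obtain ⟨hs, hc'⟩ := List.mem_product.1 hsv
      obtain ⟨v, hv, rfl⟩ := List.mem_map.1 hc'
      exact ⟨_, .fill hj1 hj (List.mem_toFinset.2 hs) hc hv, codes_fill _ _ _ h _⟩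
    · obtain ⟨⟨s, π, p⟩, hsv, hτ⟩ := List.mem_flatMap.1 hτ
      split_ifs at hτ with hp
      · obtain rfl := List.mem_singleton.1 hτ
        exact ⟨_, .deliver hj1 hj (List.mem_toFinset.2 (List.mem_product.1 hsv).1) hc hh hp,
          codes_deliver _ _ _ _ _ _⟩
      · simp at hτ
    · obtain ⟨⟨π, n⟩, hv', hτ⟩ := List.mem_flatMap.1 hτ
      obtain ⟨_, hc', hπ⟩ := List.mem_flatMap.1 hv'
      obtain ⟨v, hv, rfl⟩ := List.mem_map.1 hc'
      obtain ⟨rfl, hπ⟩ := mem_unlist_encodeVec.1 hπ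
      split_ifs at hτ with hp
      · obtain rfl := List.mem_singleton.1 hτ
        exact ⟨_, .trash hj1 hj hc hh hv hπ hp, codes_trash _ _ _ _ _⟩
      · simp at hτ
  · obtain ⟨i, hi, rfl⟩ := List.mem_map.1 hτ
    exact ⟨_, .dropFree (j := i + 1) (Nat.succ_pos i) (List.mem_range.1 hi), rfl, rfl⟩

theorem coe_semiTokens (s : VConfig) :
    (semiTokens s.q (encodeVec s.m) : Multiset ℕ) = (netEnd s).map Tok.code := by
  rw [semiTokens, netEnd, ← Multiset.cons_coe, Multiset.map_add, Multiset.map_singleton,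
    Multiset.singleton_add]
  exact congrArg _ (coe_expand_vec .pl Tok.code s.m)

theorem coe_freeTokens (E : List EdgeC) :
    (freeTokens E : Multiset ℕ) = ((Finset.Icc 1 (netBound E)).val.map Tok.fr).map Tok.code := by
  have h1 : (Finset.Icc 1 (netBound E)).val =
      ((List.range (netBound E)).map (· + 1) : Multiset ℕ) := by
    rw [← Multiset.map_coe, ← Multiset.range, ← Finset.range_val]
    have h2 := congrArg Finset.val (Finset.map_eq_image (addRightEmbedding 1)
      (Finset.range (netBound E)))
    rw [Finset.map_val] at h2
    refine Eq.trans (congrArg _ ?_) h2.symm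
    ext i
    simp only [Finset.mem_Icc, Finset.mem_image, Finset.mem_range, addRightEmbedding_apply]
    constructor
    · intro h
      exact ⟨i - 1, by omega, by omega⟩
    · rintro ⟨k, hk, rfl⟩
      omega
  rw [h1, freeTokens, Multiset.map_coe, Multiset.map_coe, List.map_map, List.map_map]
  rfl

theorem le_sum_of_mem_list {l : List ℕ} {i : ℕ} (h : i ∈ l) : i ≤ l.sum := List.single_le_sum (by simp) _ h

theorem lt_tokenBound {ts : List TransC} {s t : List ℕ} :
    (∀ τ ∈ ts, (∀ i ∈ τ.1, i < tokenBound ts s t) ∧ ∀ i ∈ τ.2, i < tokenBound ts s t) ∧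
      (∀ i ∈ s, i < tokenBound ts s t) ∧ ∀ i ∈ t, i < tokenBound ts s t := by
  have h0 : ∀ τ ∈ ts, ∀ i ∈ τ.1 ++ τ.2, i < tokenBound ts s t := by
    intro τ hτ i hi
    have h1 : i ∈ ts.flatMap fun τ => τ.1 ++ τ.2 := List.mem_flatMap.2 ⟨τ, hτ, hi⟩
    have h2 := le_sum_of_mem_list h1
    unfold tokenBound
    omega
  refine ⟨fun τ hτ => ⟨fun i hi => h0 τ hτ i (List.mem_append_left _ hi),
    fun i hi => h0 τ hτ i (List.mem_append_right _ hi)⟩, fun i hi => ?_, fun i hi => ?_⟩ <;>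
  · have h1 := le_sum_of_mem_list hi
    unfold tokenBound
    omega

theorem linSet_image (E : List EdgeC) :
    linCode '' linSet E ⊆ (netLins E).toFinset := by
  rintro _ ⟨ℓ, hℓ, rfl⟩
  exact List.mem_toFinset.2 hℓ

theorem finite_linSet (E : List EdgeC) : (linSet E).Finite :=
  Set.Finite.of_finite_image ((Finset.finite_toSet _).subset (linSet_image E))
    linCode_injective.injOn

theorem ncard_linSet_le (E : List EdgeC) : (linSet E).ncard ≤ (netLins E).length := by
  rw [← Set.ncard_image_of_injective _ linCode_injective]
  refine (Set.ncard_le_ncard (linSet_image E) (Finset.finite_toSet _)).trans ?_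
  rw [Set.ncard_coe_finset]
  exact List.toFinset_card_le _

theorem ncard_mem_list_le {α : Type*} (l : List α) : {a | a ∈ l}.ncard ≤ l.length := by
  classical
  rw [← List.coe_toFinset, Set.ncard_coe_finset]
  exact List.toFinset_card_le _

theorem slotBound_mono {s s' l l' h h' : ℕ} (hs : s ≤ s') (hl : l ≤ l') (hh : h ≤ h') (r : ℕ) :
    slotBound s l h r ≤ slotBound s' l' h' r := by
  have key : (fun N => (s + 1) * N * N)^[r] 2 ≤ (fun N => (s' + 1) * N * N)^[r] 2 := by
    induction r with
    | zero => exact le_rfl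
    | succ r ih =>
      simp only [Function.iterate_succ', Function.comp_apply]
      gcongr
  unfold slotBound
  gcongr

theorem netOf_reachable (hE : EdgeCodes V E) {s s' : VConfig} (hs : IsSemi s) (hs' : IsSemi s') :
    (netOf E s.q (encodeVec s.m) s'.q (encodeVec s'.m)).Reachable ↔ VReach V s s' := by
  rw [NetProblem.reachable_iff Tok.code_injective
    (T := netSet V (netBound E) (netStates E).toFinset (linSet E) {h | h ∈ netHists E})
    (M := netStart (netBound E) s) (M' := netEnd s') (fun t ht => exists_netTrans_codes hE ht)
    (fun τ hτ => exists_netSet_codes hE hτ) ?_ (coe_semiTokens s') lt_tokenBound.1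
    lt_tokenBound.2.1 lt_tokenBound.2.2]
  · refine ⟨net_sound hs hs', fun h => ?_⟩
    refine net_complete (bounds_netOf hE) (finite_linSet E) (List.finite_toSet _) ?_ hs hs' h
    exact slotBound_mono (List.toFinset_card_le _) (ncard_linSet_le E) (ncard_mem_list_le _) _
  · change ((semiTokens s.q (encodeVec s.m) ++ freeTokens E : List ℕ) : Multiset ℕ) = _
    rw [← Multiset.coe_add, coe_semiTokens, coe_freeTokens, ← Multiset.map_add]
    rfl

end NetCorrectness

section NetPrimrec

open Primrec (fst snd pair const)

variable {α β γ : Type*} [Primcodable α] [Primcodable β] [Primcodable γ]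

theorem primrec_unpair_fst {f : α → ℕ} (hf : Primrec f) : Primrec fun a => (f a).unpair.1 :=
  fst.comp (Primrec.unpair.comp hf)

theorem primrec_unpair_snd {f : α → ℕ} (hf : Primrec f) : Primrec fun a => (f a).unpair.2 :=
  snd.comp (Primrec.unpair.comp hf)

theorem primrec_product {f : α → List β} {g : α → List γ} (hf : Primrec f) (hg : Primrec g) :
    Primrec fun a => f a ×ˢ g a := by
  have h : Primrec fun a => (f a).flatMap fun b => (g a).map fun c => (b, c) :=
    Primrec.list_flatMap hf (Primrec.list_map (hg.comp fst) (pair (snd.comp fst) snd))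
  exact h

theorem primrec_lookup {f : α → List (ℕ × ℕ)} {g : α → ℕ} (hf : Primrec f) (hg : Primrec g) :
    Primrec fun a => (f a).lookup (g a) :=
  (Primrec.listLookup.comp hg hf).of_eq fun a => by
    congr

theorem primrec_singleton {f : α → β} (hf : Primrec f) : Primrec fun a => [f a] :=
  Primrec.list_cons.comp hf (const [])

theorem primrec_pair_list {f g : α → β} (hf : Primrec f) (hg : Primrec g) :
    Primrec fun a => [f a, g a] :=
  Primrec.list_cons.comp hf (primrec_singleton hg)

theorem primrec_list_sum {f : α → List ℕ} (hf : Primrec f) : Primrec fun a => (f a).sum :=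
  (Primrec.list_foldr (h := fun _ p => p.1 + p.2) hf (const 0)
    (Primrec.nat_add.comp (fst.comp snd) (snd.comp snd))).of_eq fun a => by
      rw [List.sum]

theorem primrec_push {f : α → Hist} {g h : α → ℕ} (hf : Primrec f) (hg : Primrec g)
    (hh : Primrec h) : Primrec fun a => (f a).push (g a) (h a) :=
  Primrec.ite (Primrec.eq.comp (primrec_lookup hf hg) (const none))
    (Primrec.list_append.comp hf (primrec_singleton (pair hg hh))) hf

theorem primrec_expand {f : α → ℕ × ℕ → ℕ} {g : α → ℕ → ℕ} {l : α → List (ℕ × ℕ)}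
    (hf : Primrec fun p : α × ℕ × ℕ => f p.1 p.2) (hg : Primrec fun p : α × ℕ => g p.1 p.2)
    (hl : Primrec l) : Primrec fun a => expand (f a) (g a) (l a) :=
  Primrec.list_flatMap hl (Primrec.list_map (Primrec.list_range.comp hf)
    (hg.comp (pair (fst.comp fst) (fst.comp (snd.comp fst)))))

theorem primrec_plC : Primrec plC := Primrec₂.natPair.comp (const 0) Primrec.id
theorem primrec_ctlC : Primrec ctlC := Primrec₂.natPair.comp (const 1) Primrec.id
theorem primrec_frC : Primrec frC := Primrec₂.natPair.comp (const 2) Primrec.id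

theorem primrec_sbC {j s : α → ℕ} {c : α → LinC} {h : α → Hist} (hj : Primrec j) (hs : Primrec s)
    (hc : Primrec c) (hh : Primrec h) : Primrec fun a => sbC (j a) (s a) (c a) (h a) :=
  Primrec₂.natPair.comp (const 3) (Primrec.encode.comp (pair hj (pair hs (pair hc hh))))

theorem primrec_dnC {j : α → ℕ} {c : α → LinC} {h : α → Hist} (hj : Primrec j)
    (hc : Primrec c) (hh : Primrec h) : Primrec fun a => dnC (j a) (c a) (h a) :=
  Primrec₂.natPair.comp (const 4) (Primrec.encode.comp (pair hj (pair hc hh)))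

theorem primrec_exC {j π : α → ℕ} (hj : Primrec j) (hπ : Primrec π) :
    Primrec fun a => exC (j a) (π a) :=
  Primrec₂.natPair.comp (const 5) (Primrec₂.natPair.comp hj hπ)

theorem primrec_opTag : Primrec fun e : EdgeC => e.2.1.unpair.1 :=
  primrec_unpair_fst (fst.comp snd)

theorem primrec_opArg : Primrec fun e : EdgeC => e.2.1.unpair.2 :=
  primrec_unpair_snd (fst.comp snd)

theorem primrec_ite_eq {f : α → ℕ} {k : ℕ} {g h : α → β} (hf : Primrec f) (hg : Primrec g)
    (hh : Primrec h) : Primrec fun a => if f a = k then g a else h a :=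
  Primrec.ite (Primrec.eq.comp hf (const k)) hg hh

theorem primrec_edgeStates : Primrec edgeStates :=
  primrec_ite_eq primrec_opTag (primrec_singleton (primrec_unpair_fst primrec_opArg))
    (primrec_ite_eq primrec_opTag
      (primrec_singleton (primrec_unpair_fst (primrec_unpair_snd primrec_opArg))) (const []))

theorem primrec_edgeLins : Primrec edgeLins :=
  primrec_ite_eq primrec_opTag (primrec_unlist.comp (primrec_unpair_snd primrec_opArg)) (const [])

theorem primrec_edgeDeliveries : Primrec edgeDeliveries :=
  primrec_ite_eq primrec_opTag (primrec_singleton (Primrec.unpair.comp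
    (primrec_unpair_snd (primrec_unpair_snd primrec_opArg)))) (const [])

theorem primrec_hists {P : α → List (ℕ × ℕ)} {n : α → ℕ} (hP : Primrec P) (hn : Primrec n) :
    Primrec fun a => hists (P a) (n a) := by
  refine (Primrec.nat_rec' (g := fun _ => [[]]) (h := fun a (p : ℕ × List Hist) =>
    p.2 ++ (p.2 ×ˢ P a).map fun x => Hist.push x.1 x.2.1 x.2.2) hn (const [[]]) ?_).of_eq fun a => ?_
  · refine Primrec.list_append.comp (snd.comp snd)
      (Primrec.list_map (primrec_product (snd.comp snd) (hP.comp fst)) ?_)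
    exact primrec_push (fst.comp snd) (fst.comp (snd.comp snd)) (snd.comp (snd.comp snd))
  · induction n a with
    | zero => rfl
    | succ k ih => exact congrArg (fun H => H ++ (H ×ˢ P a).map fun x => Hist.push x.1 x.2.1 x.2.2) ih

theorem primrec_slotBound {s l h r : α → ℕ} (hs : Primrec s) (hl : Primrec l) (hh : Primrec h)
    (hr : Primrec r) : Primrec fun a => slotBound (s a) (l a) (h a) (r a) := by
  refine Primrec.nat_mul.comp (Primrec.nat_mul.comp hl hh)
    (Primrec.nat_iterate (h := fun a N => (s a + 1) * N * N) hr (const 2) ?_)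
  exact Primrec.nat_mul.comp
    (Primrec.nat_mul.comp (Primrec.succ.comp (hs.comp fst)) snd) snd

theorem primrec_netStates : Primrec netStates :=
  Primrec.list_flatMap Primrec.id (primrec_edgeStates.comp snd)

theorem primrec_netLins : Primrec netLins :=
  Primrec.list_flatMap Primrec.id (primrec_edgeLins.comp snd)

theorem primrec_netDeliveries : Primrec netDeliveries :=
  Primrec.list_flatMap Primrec.id (primrec_edgeDeliveries.comp snd)

theorem primrec_netHists : Primrec netHists :=
  primrec_hists primrec_netDeliveries (Primrec.list_length.comp primrec_netDeliveries)

theorem primrec_netBound : Primrec netBound :=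
  primrec_slotBound (Primrec.list_length.comp primrec_netStates)
    (Primrec.list_length.comp primrec_netLins) (Primrec.list_length.comp primrec_netHists)
    (Primrec.list_length.comp primrec_netDeliveries)

theorem primrec_netSlots : Primrec netSlots :=
  primrec_product (Primrec.list_range.comp (Primrec.succ.comp primrec_netBound))
    (primrec_product primrec_netLins primrec_netHists)

theorem primrec_intNeg : Primrec intNeg :=
  primrec_ite_eq (Primrec.nat_mod.comp Primrec.id (const 2))
    (Primrec.succ.comp (Primrec.nat_div.comp Primrec.id (const 2))) (const 0)

theorem primrec_intPos : Primrec intPos :=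
  primrec_ite_eq (Primrec.nat_mod.comp Primrec.id (const 2))
    (Primrec.nat_div.comp Primrec.id (const 2)) (const 0)

theorem primrec_ctlC_source : Primrec fun e : EdgeC => ctlC e.1 := primrec_ctlC.comp fst

theorem primrec_ctlC_target : Primrec fun e : EdgeC => ctlC e.2.2 :=
  primrec_ctlC.comp (snd.comp snd)

theorem primrec_deltaTrans : Primrec deltaTrans := by
  have h1 : Primrec fun e : EdgeC => unlist (ℕ × ℕ) e.2.1.unpair.2 :=
    primrec_unlist.comp primrec_opArg
  refine pair (Primrec.list_cons.comp primrec_ctlC_source (primrec_expand ?_ ?_ h1))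
    (Primrec.list_cons.comp primrec_ctlC_target (primrec_expand ?_ ?_ h1))
  · exact primrec_intNeg.comp (snd.comp snd)
  · exact primrec_plC.comp snd
  · exact primrec_intPos.comp (snd.comp snd)
  · exact primrec_plC.comp snd

theorem primrec_inflateTrans : Primrec fun p : EdgeC × ℕ × LinC => inflateTrans p.1 p.2 := by
  refine pair (Primrec.list_cons.comp (primrec_ctlC_source.comp fst)
    (primrec_ite_eq (fst.comp snd) (const []) (primrec_singleton
      (primrec_frC.comp (fst.comp snd)))))
    (primrec_pair_list (primrec_ctlC_target.comp fst) (primrec_sbC (fst.comp snd) ?_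
      (snd.comp snd) (const [])))
  exact (primrec_unpair_fst primrec_opArg).comp fst

theorem primrec_deflateTrans : Primrec fun p : EdgeC × Slot => deflateTrans p.1 p.2 := by
  have a1 := (primrec_unpair_fst primrec_opArg).comp (fst (α := EdgeC) (β := Slot))
  have a2 := (primrec_unpair_fst (primrec_unpair_snd primrec_opArg)).comp
    (fst (α := EdgeC) (β := Slot))
  have a3 := (primrec_unpair_fst (primrec_unpair_snd (primrec_unpair_snd primrec_opArg))).comp
    (fst (α := EdgeC) (β := Slot))
  have a4 := (primrec_unpair_snd (primrec_unpair_snd (primrec_unpair_snd primrec_opArg))).comp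
    (fst (α := EdgeC) (β := Slot))
  have t1 : Primrec fun p : EdgeC × Slot => p.2.1 := fst.comp snd
  have t2 : Primrec fun p : EdgeC × Slot => p.2.2.1 := fst.comp (snd.comp snd)
  have t3 : Primrec fun p : EdgeC × Slot => p.2.2.2 := snd.comp (snd.comp snd)
  refine pair (primrec_pair_list (primrec_ctlC_source.comp fst) (primrec_sbC t1 a1 t2 t3))
    (Primrec.list_cons.comp (primrec_ctlC_target.comp fst)
      (Primrec.list_cons.comp (primrec_sbC t1 a2 t2 (primrec_push t3 a3 a4))
        (primrec_expand ?_ ?_ (primrec_unlist.comp (fst.comp t2)))))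
  · refine Primrec.ite (PrimrecPred.and (Primrec.eq.comp (fst.comp snd) (a3.comp fst))
      (Primrec.eq.comp ((primrec_lookup t3 a3).comp fst) (const none))) (snd.comp snd) (const 0)
  · exact (primrec_plC.comp a4).comp fst

theorem primrec_burstTrans : Primrec fun p : EdgeC × Slot => burstTrans p.1 p.2 := by
  have t1 : Primrec fun p : EdgeC × Slot => p.2.1 := fst.comp snd
  have t2 : Primrec fun p : EdgeC × Slot => p.2.2.1 := fst.comp (snd.comp snd)
  have t3 : Primrec fun p : EdgeC × Slot => p.2.2.2 := snd.comp (snd.comp snd)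
  exact pair (primrec_pair_list (primrec_ctlC_source.comp fst)
      (primrec_sbC t1 (primrec_opArg.comp fst) t2 t3))
    (primrec_pair_list (primrec_ctlC_target.comp fst) (primrec_dnC t1 t2 t3))

theorem primrec_edgeTrans {K : α → ℕ} {ts : α → List Slot} {e : α → EdgeC} (hK : Primrec K)
    (hts : Primrec ts) (he : Primrec e) : Primrec fun a => edgeTrans (K a) (ts a) (e a) := by
  have tag := primrec_opTag.comp he
  refine primrec_ite_eq tag (primrec_singleton (primrec_deltaTrans.comp he))
    (primrec_ite_eq tag ?_ (primrec_ite_eq tag ?_ ?_))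
  · exact Primrec.list_map (primrec_product (Primrec.list_range.comp (Primrec.succ.comp hK))
      (primrec_unlist.comp ((primrec_unpair_snd primrec_opArg).comp he)))
      (primrec_inflateTrans.comp (pair (he.comp fst) snd))
  · exact Primrec.list_map hts (primrec_deflateTrans.comp (pair (he.comp fst) snd))
  · exact Primrec.list_map hts (primrec_burstTrans.comp (pair (he.comp fst) snd))

theorem primrec_fillTrans : Primrec fun p : Slot × ℕ × ℕ => fillTrans p.1 p.2 := by
  have h1 : Primrec fun p : Slot × ℕ × ℕ => sbC p.1.1 p.2.1 p.1.2.1 [] :=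
    primrec_sbC (fst.comp fst) (fst.comp snd) (fst.comp (snd.comp fst)) (const [])
  refine pair (primrec_singleton h1) (Primrec.list_cons.comp h1
    (primrec_expand (snd.comp snd) ?_ (primrec_unlist.comp (snd.comp snd))))
  exact primrec_exC (fst.comp (fst.comp fst)) snd

theorem primrec_deliverTrans : Primrec fun p : Slot × ℕ × ℕ × ℕ => deliverTrans p.1 p.2 := by
  have h1 : Primrec fun p : Slot × ℕ × ℕ × ℕ => sbC p.1.1 p.2.1 p.1.2.1 p.1.2.2 :=
    primrec_sbC (fst.comp fst) (fst.comp snd) (fst.comp (snd.comp fst)) (snd.comp (snd.comp fst))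
  exact pair (primrec_pair_list h1 (primrec_exC (fst.comp fst) (fst.comp (snd.comp snd))))
    (primrec_pair_list h1 (primrec_plC.comp (snd.comp (snd.comp snd))))

theorem primrec_dnC_slot : Primrec fun t : Slot => dnC t.1 t.2.1 t.2.2 :=
  primrec_dnC fst (fst.comp snd) (snd.comp snd)

theorem primrec_trashTrans : Primrec fun p : Slot × ℕ × ℕ => trashTrans p.1 p.2 :=
  pair (primrec_pair_list (primrec_dnC_slot.comp fst) (primrec_exC (fst.comp fst) (fst.comp snd)))
    (primrec_singleton (primrec_dnC_slot.comp fst))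

theorem primrec_deliverList : Primrec fun p : Slot × ℕ × ℕ × ℕ =>
    if p.1.2.2.lookup p.2.2.1 = some p.2.2.2 then [deliverTrans p.1 p.2] else [] := by
  have hl : Primrec fun p : Slot × ℕ × ℕ × ℕ => p.1.2.2.lookup p.2.2.1 :=
    primrec_lookup (snd.comp (snd.comp fst)) (fst.comp (snd.comp snd))
  have hs : Primrec fun p : Slot × ℕ × ℕ × ℕ => some p.2.2.2 :=
    Primrec.option_some.comp (snd.comp (snd.comp snd))
  exact Primrec.ite (Primrec.eq.comp hl hs) (primrec_singleton primrec_deliverTrans) (const [])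

theorem primrec_trashList : Primrec fun p : Slot × ℕ × ℕ =>
    if p.1.2.2.lookup p.2.1 = none then [trashTrans p.1 p.2] else [] := by
  have hl : Primrec fun p : Slot × ℕ × ℕ => p.1.2.2.lookup p.2.1 :=
    primrec_lookup (snd.comp (snd.comp fst)) (fst.comp snd)
  exact Primrec.ite (Primrec.eq.comp hl (const none)) (primrec_singleton primrec_trashTrans)
    (const [])

theorem primrec_slotTrans {S : α → List ℕ} {P : α → List (ℕ × ℕ)} {t : α → Slot}
    (hS : Primrec S) (hP : Primrec P) (ht : Primrec t) :
    Primrec fun a => slotTrans (S a) (P a) (t a) := by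
  have hps : Primrec fun a => (t a).2.1.2 := (snd.comp (fst.comp snd)).comp ht
  have h1 : Primrec fun a => (S a ×ˢ (t a).2.1.2).map (fillTrans (t a)) :=
    Primrec.list_map (primrec_product hS hps) (primrec_fillTrans.comp (pair (ht.comp fst) snd))
  have h2 : Primrec fun a => (S a ×ˢ P a).flatMap fun x =>
      if (t a).2.2.lookup x.2.1 = some x.2.2 then [deliverTrans (t a) x] else [] :=
    Primrec.list_flatMap (primrec_product hS hP)
      (primrec_deliverList.comp (pair (ht.comp fst) snd))
  have h3 : Primrec fun a => ((t a).2.1.2.flatMap (unlist (ℕ × ℕ))).flatMap fun e =>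
      if (t a).2.2.lookup e.1 = none then [trashTrans (t a) e] else [] :=
    Primrec.list_flatMap (Primrec.list_flatMap hps (primrec_unlist.comp snd))
      (primrec_trashList.comp (pair (ht.comp fst) snd))
  exact Primrec.list_cons.comp (pair (primrec_singleton (primrec_dnC_slot.comp ht)) (const []))
    (primrec_ite_eq (fst.comp ht) (const []) (Primrec.list_append.comp
      (Primrec.list_append.comp h1 h2) h3))

theorem primrec_netTrans : Primrec netTrans := by
  refine Primrec.list_append.comp (Primrec.list_append.comp
    (Primrec.list_flatMap Primrec.id ?_) (Primrec.list_flatMap primrec_netSlots ?_))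
    (Primrec.list_map (Primrec.list_range.comp primrec_netBound) ?_)
  · exact primrec_edgeTrans (primrec_netBound.comp fst) (primrec_netSlots.comp fst) snd
  · exact primrec_slotTrans (primrec_netStates.comp fst) (primrec_netDeliveries.comp fst) snd
  · exact pair (primrec_singleton (primrec_frC.comp (Primrec.succ.comp snd))) (const [])

theorem primrec_semiTokens {q m : α → ℕ} (hq : Primrec q) (hm : Primrec m) :
    Primrec fun a => semiTokens (q a) (m a) :=
  Primrec.list_cons.comp (primrec_ctlC.comp hq)
    (primrec_expand (snd.comp snd) (primrec_plC.comp snd) (primrec_unlist.comp hm))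

theorem primrec_freeTokens : Primrec freeTokens :=
  Primrec.list_map (Primrec.list_range.comp primrec_netBound)
    (primrec_frC.comp (Primrec.succ.comp snd))

theorem primrec_tokenBound {ts : α → List TransC} {s t : α → List ℕ} (hts : Primrec ts)
    (hs : Primrec s) (ht : Primrec t) : Primrec fun a => tokenBound (ts a) (s a) (t a) := by
  refine Primrec.succ.comp (Primrec.nat_add.comp (Primrec.nat_add.comp (primrec_list_sum
    (Primrec.list_flatMap hts ?_)) (primrec_list_sum hs)) (primrec_list_sum ht))
  exact Primrec.list_append.comp (fst.comp snd) (snd.comp snd)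

theorem primrec_netOf {E : α → List EdgeC} {q m q' m' : α → ℕ} (hE : Primrec E) (hq : Primrec q)
    (hm : Primrec m) (hq' : Primrec q') (hm' : Primrec m') :
    Primrec fun a => netOf (E a) (q a) (m a) (q' a) (m' a) := by
  have h1 := primrec_netTrans.comp hE
  have h2 := Primrec.list_append.comp (primrec_semiTokens hq hm) (primrec_freeTokens.comp hE)
  have h3 := primrec_semiTokens hq' hm'
  exact pair (primrec_tokenBound h1 h2 h3) (pair h1 (pair h2 h3))

/-- The net of a coded instance of the reachability problem. -/
def instanceNet (n : ℕ) : NetProblem :=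
  netOf (unlist EdgeC n.unpair.1.unpair.2.unpair.2.unpair.2.unpair.2) n.unpair.2.unpair.1.unpair.1
    n.unpair.2.unpair.1.unpair.2.unpair.1 n.unpair.2.unpair.2.unpair.1
    n.unpair.2.unpair.2.unpair.2.unpair.1

theorem primrec_instanceNet : Primrec instanceNet := by
  have h1 := primrec_unpair_fst (f := fun n => n) Primrec.id
  have h2 := primrec_unpair_snd (f := fun n => n) Primrec.id
  exact primrec_netOf (primrec_unlist.comp (primrec_unpair_snd (primrec_unpair_snd
    (primrec_unpair_snd (primrec_unpair_snd h1)))))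
    (primrec_unpair_fst (primrec_unpair_fst h2))
    (primrec_unpair_fst (primrec_unpair_snd (primrec_unpair_fst h2)))
    (primrec_unpair_fst (primrec_unpair_snd h2))
    (primrec_unpair_fst (primrec_unpair_snd (primrec_unpair_snd h2)))

theorem edgeCodes_unlist (V : VASSB) : EdgeCodes V (unlist EdgeC
    (Encodable.encode (V.edges.val.map fun e => (e.1, encodeVOp e.2.1, e.2.2)))) := by
  rintro ⟨q, o, q'⟩
  rw [← Multiset.mem_coe, coe_unlist_encode, Multiset.mem_map]
  constructor
  · rintro ⟨⟨q₁, o₁, q₂⟩, he, h⟩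
    simp only [Prod.mk.injEq] at h
    obtain ⟨rfl, rfl, rfl⟩ := h
    exact ⟨o₁, he, rfl⟩
  · rintro ⟨o', he, rfl⟩
    exact ⟨_, he, rfl⟩

theorem instanceNet_eq (V : VASSB) (s s' : VConfig) :
    instanceNet (Nat.pair (encodeVASSB V) (Nat.pair (encodeVConfig s) (encodeVConfig s'))) =
      netOf (unlist EdgeC (Encodable.encode
        (V.edges.val.map fun e => (e.1, encodeVOp e.2.1, e.2.2))))
        s.q (encodeVec s.m) s'.q (encodeVec s'.m) := by
  simp only [instanceNet, encodeVASSB, encodeVConfig, Nat.unpair_pair, Encodable.encode_prod_val,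
    Encodable.encode_nat]

end NetPrimrec

/-- The reachability problem for VASSB is decidable: there
is an algorithm that, given a VASSB `V` and two semiconfigurations `s1` and
`s2` of `V`, decides whether there is a run `s1 →* s2` in `V`. -/
theorem vassb_reachability_decidable :
    ∃ f : ℕ → Bool, Computable f ∧
      ∀ (V : VASSB) (s1 s2 : VConfig), IsSemi s1 → IsSemi s2 →
        (f (Nat.pair (encodeVASSB V)
            (Nat.pair (encodeVConfig s1) (encodeVConfig s2))) = true ↔
          VReach V s1 s2) := by
  obtain ⟨f, hf, hfx⟩ := exists_computable_reachable
  refine ⟨fun n => f (instanceNet n), hf.comp primrec_instanceNet.to_comp, fun V s s' hs hs' => ?_⟩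
  rw [hfx, instanceNet_eq]
  exact netOf_reachable (edgeCodes_unlist V) hs hs'

end CBL
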